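/- Let f_0 = Π_{i=0}^m g_i^{c_i} be a product of pairwise coprime irreducible holomorphic function germs g_i at the origin of ℂ², with c_i ≥ 1, μ_i the Milnor number of g_i, and I_O(g_i, Π_{j≠i} g_j) the intersection multiplicity at the origin. Then the Euler characteristic of the Milnor fibre of f_0 equals Σ_{i=0}^m c_i (1 - μ_i - I_O(g_i, Π_{j≠i} g_j)). -/

import Mathlib

open CategoryTheory

/-- The singular chain complex of a topological space with rational coefficients, obtained by
applying the free `ℚ`-module functor to the singular simplicial set levelwise and taking the
alternating face map complex. -/
noncomputable def singularChainComplex (X : TopCat) : ChainComplex (ModuleCat ℚ) ℕ :=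
  (AlgebraicTopology.alternatingFaceMapComplex (ModuleCat ℚ)).obj
    (((CategoryTheory.SimplicialObject.whiskering (Type) (ModuleCat ℚ)).obj
      (ModuleCat.free ℚ)).obj (TopCat.toSSet.obj X))

/-- Singular homology with rational coefficients. -/
noncomputable def singularHomologyQ (X : TopCat) (n : ℕ) : ModuleCat ℚ :=
  (singularChainComplex X).homology n

/-- The Euler characteristic of a topological space, as the alternating sum of the ranks of its
rational singular homology in degrees `0`, `1`, `2`.  (For the compact surfaces considered here
all higher homology vanishes, so this is the usual Euler characteristic.) -/
noncomputable def eulerChar (X : Type) [TopologicalSpace X] : ℤ :=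
  ∑ n ∈ Finset.range 3, (-1 : ℤ) ^ n * (Module.finrank ℚ (singularHomologyQ (TopCat.of X) n) : ℤ)

/-- The gluing relation for the Möbius band: `(0, y) ~ (1, 1 - y)` on the unit square. -/
def mobiusRel (p q : unitInterval × unitInterval) : Prop :=
  p.1 = 0 ∧ q.1 = 1 ∧ p.2 = unitInterval.symm q.2

/-- The Möbius band, as a quotient of the unit square. -/
def MobiusBand : Type := Quot mobiusRel

instance : TopologicalSpace MobiusBand := by unfold MobiusBand; infer_instance

/-- A surface is orientable iff it contains no embedded Möbius band. -/
def Orientable (S : Type) [TopologicalSpace S] : Prop :=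
  ¬ ∃ f : MobiusBand → S, Topology.IsEmbedding f

/-- The standard closed disc. -/
abbrev Disc2 : Type := Metric.closedBall (0 : EuclideanSpace ℝ (Fin 2)) 1


open MvPolynomial

/-- The Milnor number at the origin of a plane curve germ given by a polynomial `g`: the
dimension of the quotient of the ring of germs (formal power series) by the Jacobian ideal. -/
noncomputable def milnorNumber (g : MvPolynomial (Fin 2) ℂ) : ℕ :=
  Module.finrank ℂ
    (MvPowerSeries (Fin 2) ℂ ⧸
      Ideal.span {(↑(pderiv 0 g) : MvPowerSeries (Fin 2) ℂ),
        (↑(pderiv 1 g) : MvPowerSeries (Fin 2) ℂ)})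

/-- The intersection multiplicity at the origin of two plane curve germs given by polynomials:
the dimension of the quotient of the ring of germs by the ideal they generate. -/
noncomputable def interMult (f g : MvPolynomial (Fin 2) ℂ) : ℕ :=
  Module.finrank ℂ
    (MvPowerSeries (Fin 2) ℂ ⧸
      Ideal.span {(↑f : MvPowerSeries (Fin 2) ℂ), (↑g : MvPowerSeries (Fin 2) ℂ)})

namespace MilnorFibre

/-- The forgetful functor on `ℚ`-modules is corepresented by `ℚ`. -/
noncomputable def forgetIsoCoyoneda :
    forget (ModuleCat.{0} ℚ) ≅ coyoneda.obj (Opposite.op (ModuleCat.of ℚ ℚ)) :=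
  NatIso.ofComponents (fun M => Equiv.toIso
    { toFun := fun m => ModuleCat.ofHom (LinearMap.toSpanSingleton ℚ M m)
      invFun := fun f => f.hom (1 : ℚ)
      left_inv := fun m => by simp
      right_inv := fun f => ModuleCat.hom_ext (LinearMap.ext_ring (by simp)) }) (by
    intro M N f
    ext m
    refine ModuleCat.hom_ext (LinearMap.ext_ring ?_)
    simp)

/-- The free module functor is the copower functor of `ℚ`. -/
noncomputable def freeIsoSigmaConst :
    ModuleCat.free.{0} ℚ ≅ Limits.sigmaConst.obj (ModuleCat.of ℚ ℚ) :=
  Adjunction.leftAdjointUniq ((ModuleCat.adj ℚ).ofNatIsoRight forgetIsoCoyoneda)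
    (Limits.sigmaConstAdj (ModuleCat.of ℚ ℚ))

/-- The functor of simplicial chains with rational coefficients. -/
noncomputable abbrev chainsQ : SSet.{0} ⥤ ChainComplex (ModuleCat.{0} ℚ) ℕ :=
  (SimplicialObject.whiskering (Type) (ModuleCat ℚ)).obj (ModuleCat.free ℚ) ⋙
    AlgebraicTopology.alternatingFaceMapComplex (ModuleCat ℚ)

/-- The rational singular chain complex functor agrees with Mathlib's. -/
noncomputable def singularChainsIso :
    TopCat.toSSet ⋙ chainsQ ≅
      (AlgebraicTopology.singularChainComplexFunctor (ModuleCat.{0} ℚ)).obj (ModuleCat.of ℚ ℚ) :=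
  Functor.isoWhiskerLeft TopCat.toSSet (Functor.isoWhiskerRight
    ((SimplicialObject.whiskering (Type) (ModuleCat ℚ)).mapIso freeIsoSigmaConst)
    (AlgebraicTopology.alternatingFaceMapComplex (ModuleCat ℚ)))

/-- The rational singular homology functor of the statement. -/
noncomputable def homologyFunctorQ (n : ℕ) : TopCat.{0} ⥤ ModuleCat.{0} ℚ :=
  (TopCat.toSSet ⋙ chainsQ) ⋙ HomologicalComplex.homologyFunctor _ _ n

/-- The rational singular homology functor agrees with Mathlib's. -/
noncomputable def homologyIso (n : ℕ) : homologyFunctorQ n ≅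
    (AlgebraicTopology.singularHomologyFunctor (ModuleCat.{0} ℚ) n).obj (ModuleCat.of ℚ ℚ) :=
  Functor.isoWhiskerRight singularChainsIso (HomologicalComplex.homologyFunctor _ _ n)

theorem homologyFunctorQ_map_eq_of_homotopy {X Y : TopCat.{0}} {f g : X ⟶ Y}
    (h : TopCat.Homotopy f g) (n : ℕ) :
    (homologyFunctorQ n).map f = (homologyFunctorQ n).map g := by
  have := h.congr_homologyMap_singularChainComplexFunctor (ModuleCat.of ℚ ℚ) n
  rw [← cancel_mono ((homologyIso n).hom.app Y), (homologyIso n).hom.naturality,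
    (homologyIso n).hom.naturality]
  congr 1

/-- A homotopy equivalence induces an isomorphism on homology. -/
noncomputable def homologyIsoOfHomotopyEquiv {X Y : Type} [TopologicalSpace X]
    [TopologicalSpace Y] (e : ContinuousMap.HomotopyEquiv X Y) (n : ℕ) :
    (homologyFunctorQ n).obj (TopCat.of X) ≅ (homologyFunctorQ n).obj (TopCat.of Y) where
  hom := (homologyFunctorQ n).map (TopCat.ofHom e.toFun)
  inv := (homologyFunctorQ n).map (TopCat.ofHom e.invFun)
  hom_inv_id := by
    rw [← Functor.map_comp]
    obtain ⟨h⟩ := e.left_inv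
    refine Eq.trans (homologyFunctorQ_map_eq_of_homotopy (g := 𝟙 _) ?_ n)
      ((homologyFunctorQ n).map_id _)
    exact h
  inv_hom_id := by
    rw [← Functor.map_comp]
    obtain ⟨h⟩ := e.right_inv
    refine Eq.trans (homologyFunctorQ_map_eq_of_homotopy (g := 𝟙 _) ?_ n)
      ((homologyFunctorQ n).map_id _)
    exact h

theorem isZero_singularHomologyQ_of_totallyDisconnected (X : Type) [TopologicalSpace X]
    [TotallyDisconnectedSpace X] {n : ℕ} (hn : n ≠ 0) :
    Limits.IsZero (singularHomologyQ (TopCat.of X) n) := by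
  have : TotallyDisconnectedSpace (TopCat.of X) := ‹_›
  exact (AlgebraicTopology.isZero_singularHomologyFunctor_of_totallyDisconnectedSpace
    (ModuleCat.{0} ℚ) n (ModuleCat.of ℚ ℚ) (TopCat.of X) hn).of_iso ((homologyIso n).app _)

/-- The zeroth homology of a totally disconnected space is free on its points. -/
noncomputable def singularHomologyQZeroIso (X : Type) [TopologicalSpace X]
    [TotallyDisconnectedSpace X] :
    singularHomologyQ (TopCat.of X) 0 ≅ (ModuleCat.free ℚ).obj X :=
  have : TotallyDisconnectedSpace (TopCat.of X) := ‹_›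
  ((homologyIso 0).app (TopCat.of X)) ≪≫
    AlgebraicTopology.singularHomologyFunctorZeroOfTotallyDisconnectedSpace
      (ModuleCat.{0} ℚ) (ModuleCat.of ℚ ℚ) (TopCat.of X) ≪≫ (freeIsoSigmaConst.app X).symm

theorem finrank_singularHomologyQ_zero (X : Type) [TopologicalSpace X]
    [TotallyDisconnectedSpace X] [Finite X] :
    Module.Finite ℚ (singularHomologyQ (TopCat.of X) 0) ∧
    Module.finrank ℚ (singularHomologyQ (TopCat.of X) 0) = Nat.card X := by
  have : Fintype X := Fintype.ofFinite X
  let e := (singularHomologyQZeroIso X).toLinearEquiv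
  have e' : singularHomologyQ (TopCat.of X) 0 ≃ₗ[ℚ] (X →₀ ℚ) := e
  refine ⟨Module.Finite.equiv e'.symm, ?_⟩
  rw [e'.finrank_eq]
  simp

/-! ### Barycentric subdivision of ordered tuples -/

section Tuples

variable {W W' : Type*}

/-- The boundary of formal combinations of tuples (augmented, indexed by number of vertices). -/
noncomputable def tupleBoundary (W : Type*) (k : ℕ) :
    ((Fin (k + 1) → W) →₀ ℚ) →ₗ[ℚ] ((Fin k → W) →₀ ℚ) :=
  Finsupp.lsum ℚ fun v => LinearMap.toSpanSingleton ℚ _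
    (∑ i : Fin (k + 1), (-1 : ℚ) ^ (i : ℕ) • Finsupp.single (v ∘ i.succAbove) (1 : ℚ))

/-- The cone over a combination of tuples. -/
noncomputable def tupleCone (b : W) (k : ℕ) :
    ((Fin k → W) →₀ ℚ) →ₗ[ℚ] ((Fin (k + 1) → W) →₀ ℚ) :=
  Finsupp.lmapDomain ℚ ℚ (fun v => (Fin.cons b v : Fin (k + 1) → W))

/-- The map induced on combinations of tuples by a map of points. -/
noncomputable def tupleMap (φ : W → W') (k : ℕ) :
    ((Fin k → W) →₀ ℚ) →ₗ[ℚ] ((Fin k → W') →₀ ℚ) :=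
  Finsupp.lmapDomain ℚ ℚ (φ ∘ ·)

/-- Barycentric subdivision of tuples, with respect to a choice of barycentres. -/
noncomputable def tupleSd (b : ∀ k, (Fin (k + 1) → W) → W) :
    ∀ k, ((Fin k → W) →₀ ℚ) →ₗ[ℚ] ((Fin k → W) →₀ ℚ)
  | 0 => LinearMap.id
  | k + 1 => Finsupp.lsum ℚ fun v => LinearMap.toSpanSingleton ℚ _
      (tupleCone (b k v) k (tupleSd b k (tupleBoundary W k (Finsupp.single v 1))))

/-- The chain homotopy between the identity and barycentric subdivision. -/
noncomputable def tupleHomotopy (b : ∀ k, (Fin (k + 1) → W) → W) :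
    ∀ k, ((Fin k → W) →₀ ℚ) →ₗ[ℚ] ((Fin (k + 1) → W) →₀ ℚ)
  | 0 => 0
  | k + 1 => Finsupp.lsum ℚ fun v => LinearMap.toSpanSingleton ℚ _
      (tupleCone (b k v) (k + 1) (Finsupp.single v 1 -
        tupleHomotopy b k (tupleBoundary W k (Finsupp.single v 1))))

@[simp] theorem tupleBoundary_single (k : ℕ) (v : Fin (k + 1) → W) :
    tupleBoundary W k (Finsupp.single v 1) =
      ∑ i : Fin (k + 1), (-1 : ℚ) ^ (i : ℕ) • Finsupp.single (v ∘ i.succAbove) (1 : ℚ) := by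
  simp [tupleBoundary]

@[simp] theorem tupleCone_single (b : W) (k : ℕ) (v : Fin k → W) :
    tupleCone b k (Finsupp.single v 1) = Finsupp.single (Fin.cons b v : Fin (k + 1) → W) 1 := by
  simp [tupleCone, Finsupp.mapDomain_single]

@[simp] theorem tupleMap_single (φ : W → W') (k : ℕ) (v : Fin k → W) :
    tupleMap φ k (Finsupp.single v 1) = Finsupp.single (φ ∘ v) 1 := by
  simp [tupleMap, Finsupp.mapDomain_single]

theorem tupleSd_single (b : ∀ k, (Fin (k + 1) → W) → W) (k : ℕ) (v : Fin (k + 1) → W) :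
    tupleSd b (k + 1) (Finsupp.single v 1) =
      tupleCone (b k v) k (tupleSd b k (tupleBoundary W k (Finsupp.single v 1))) := by
  simp [tupleSd]

theorem tupleHomotopy_single (b : ∀ k, (Fin (k + 1) → W) → W) (k : ℕ) (v : Fin (k + 1) → W) :
    tupleHomotopy b (k + 1) (Finsupp.single v 1) =
      tupleCone (b k v) (k + 1) (Finsupp.single v 1 -
        tupleHomotopy b k (tupleBoundary W k (Finsupp.single v 1))) := by
  simp [tupleHomotopy]

theorem finsupp_hom_ext {α M : Type*} [AddCommGroup M] [Module ℚ M] {f g : (α →₀ ℚ) →ₗ[ℚ] M}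
    (h : ∀ a, f (Finsupp.single a 1) = g (Finsupp.single a 1)) : f = g := by
  ext a; simpa using h a

theorem tupleBoundary_cone_zero (b : W) (c : (Fin 0 → W) →₀ ℚ) :
    tupleBoundary W 0 (tupleCone b 0 c) = c := by
  suffices h : tupleBoundary W 0 ∘ₗ tupleCone b 0 = LinearMap.id from LinearMap.congr_fun h c
  refine finsupp_hom_ext fun v => ?_
  simp only [LinearMap.comp_apply, tupleCone_single, tupleBoundary_single, LinearMap.id_apply]
  simp

theorem tupleBoundary_cone (b : W) (k : ℕ) (c : (Fin (k + 1) → W) →₀ ℚ) :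
    tupleBoundary W (k + 1) (tupleCone b (k + 1) c) =
      c - tupleCone b k (tupleBoundary W k c) := by
  suffices h : tupleBoundary W (k + 1) ∘ₗ tupleCone b (k + 1) =
    LinearMap.id - tupleCone b k ∘ₗ tupleBoundary W k from LinearMap.congr_fun h c
  refine finsupp_hom_ext fun v => ?_
  simp only [LinearMap.comp_apply, tupleCone_single, tupleBoundary_single, LinearMap.id_apply,
    LinearMap.sub_apply]
  rw [Fin.sum_univ_succ, map_sum, sub_eq_add_neg, ← Finset.sum_neg_distrib]
  congr 1
  · simp
  · refine Finset.sum_congr rfl fun i _ => ?_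
    rw [map_smul, tupleCone_single, Fin.val_succ, pow_succ, mul_neg_one, neg_smul]
    congr 3
    ext j
    refine Fin.cases ?_ (fun j => ?_) j
    · simp
    · simp

theorem tupleBoundary_boundary (k : ℕ) (c : (Fin (k + 2) → W) →₀ ℚ) :
    tupleBoundary W k (tupleBoundary W (k + 1) c) = 0 := by
  suffices h : ∀ k, tupleBoundary W k ∘ₗ tupleBoundary W (k + 1) = 0 from
    LinearMap.congr_fun (h k) c
  intro k
  induction k with
  | zero =>
    refine finsupp_hom_ext fun v => ?_
    simp [Fin.sum_univ_succ]
    rw [Subsingleton.elim ((v ∘ Fin.succ) ∘ Fin.succ) ((v ∘ Fin.succAbove 1) ∘ Fin.succ),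
      add_neg_cancel]
  | succ k ih =>
    refine finsupp_hom_ext fun v => ?_
    have hv : Finsupp.single v (1 : ℚ) =
        tupleCone (v 0) (k + 2) (Finsupp.single (Fin.tail v) 1) := by
      rw [tupleCone_single, Fin.cons_self_tail]
    rw [LinearMap.comp_apply, hv, tupleBoundary_cone, map_sub, tupleBoundary_cone]
    have := LinearMap.congr_fun ih (Finsupp.single (Fin.tail v) 1)
    simp only [LinearMap.comp_apply, LinearMap.zero_apply] at this
    simp only [this, map_zero, sub_zero, sub_self, LinearMap.zero_apply]

theorem tupleBoundary_sd (b : ∀ k, (Fin (k + 1) → W) → W) (k : ℕ)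
    (c : (Fin (k + 1) → W) →₀ ℚ) :
    tupleBoundary W k (tupleSd b (k + 1) c) = tupleSd b k (tupleBoundary W k c) := by
  suffices h : ∀ k, tupleBoundary W k ∘ₗ tupleSd b (k + 1) = tupleSd b k ∘ₗ tupleBoundary W k from
    LinearMap.congr_fun (h k) c
  intro k
  induction k with
  | zero =>
    refine finsupp_hom_ext fun v => ?_
    rw [LinearMap.comp_apply, tupleSd_single, tupleBoundary_cone_zero, LinearMap.comp_apply]
  | succ k ih =>
    refine finsupp_hom_ext fun v => ?_
    have := LinearMap.congr_fun ih (tupleBoundary W (k + 1) (Finsupp.single v 1))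
    simp only [LinearMap.comp_apply] at this
    rw [LinearMap.comp_apply, tupleSd_single, tupleBoundary_cone, LinearMap.comp_apply, this,
      tupleBoundary_boundary, map_zero, map_zero, sub_zero]

theorem tupleBoundary_homotopy (b : ∀ k, (Fin (k + 1) → W) → W) (k : ℕ)
    (c : (Fin (k + 1) → W) →₀ ℚ) :
    tupleBoundary W (k + 1) (tupleHomotopy b (k + 1) c) =
      c - tupleSd b (k + 1) c - tupleHomotopy b k (tupleBoundary W k c) := by
  suffices h : ∀ k, tupleBoundary W (k + 1) ∘ₗ tupleHomotopy b (k + 1) =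
    LinearMap.id - tupleSd b (k + 1) - tupleHomotopy b k ∘ₗ tupleBoundary W k from
    LinearMap.congr_fun (h k) c
  intro k
  induction k with
  | zero =>
    refine finsupp_hom_ext fun v => ?_
    simp only [LinearMap.comp_apply, LinearMap.sub_apply, LinearMap.id_apply]
    rw [tupleHomotopy_single, tupleBoundary_cone, tupleSd_single]
    simp only [tupleHomotopy, tupleSd, LinearMap.zero_apply, sub_zero, LinearMap.id_apply]
  | succ k ih =>
    refine finsupp_hom_ext fun v => ?_
    have := LinearMap.congr_fun ih (tupleBoundary W (k + 1) (Finsupp.single v 1))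
    simp only [LinearMap.comp_apply, LinearMap.sub_apply, LinearMap.id_apply,
      tupleBoundary_boundary, map_zero, sub_zero] at this
    simp only [LinearMap.comp_apply, LinearMap.sub_apply, LinearMap.id_apply]
    rw [tupleHomotopy_single, tupleBoundary_cone, map_sub, this, tupleSd_single b (k + 1)]
    simp only [sub_sub_cancel]
    abel

theorem tupleBoundary_map (φ : W → W') (k : ℕ) (c : (Fin (k + 1) → W) →₀ ℚ) :
    tupleBoundary W' k (tupleMap φ (k + 1) c) = tupleMap φ k (tupleBoundary W k c) := by
  suffices h : tupleBoundary W' k ∘ₗ tupleMap φ (k + 1) = tupleMap φ k ∘ₗ tupleBoundary W k from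
    LinearMap.congr_fun h c
  refine finsupp_hom_ext fun v => ?_
  simp only [LinearMap.comp_apply, tupleMap_single, tupleBoundary_single, map_sum, map_smul,
    Function.comp_assoc]

theorem tupleCone_map (φ : W → W') (b : W) (k : ℕ) (c : (Fin k → W) →₀ ℚ) :
    tupleCone (φ b) k (tupleMap φ k c) = tupleMap φ (k + 1) (tupleCone b k c) := by
  suffices h : tupleCone (φ b) k ∘ₗ tupleMap φ k = tupleMap φ (k + 1) ∘ₗ tupleCone b k from
    LinearMap.congr_fun h c
  refine finsupp_hom_ext fun v => ?_
  simp only [LinearMap.comp_apply, tupleMap_single, tupleCone_single]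
  congr 1
  ext j
  refine Fin.cases ?_ (fun j => ?_) j <;> simp

theorem tupleSd_map {b : ∀ k, (Fin (k + 1) → W) → W} {b' : ∀ k, (Fin (k + 1) → W') → W'}
    {φ : W → W'} (hφ : ∀ k v, φ (b k v) = b' k (φ ∘ v)) (k : ℕ) (c : (Fin k → W) →₀ ℚ) :
    tupleSd b' k (tupleMap φ k c) = tupleMap φ k (tupleSd b k c) := by
  suffices h : ∀ k, tupleSd b' k ∘ₗ tupleMap φ k = tupleMap φ k ∘ₗ tupleSd b k from
    LinearMap.congr_fun (h k) c
  intro k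
  induction k with
  | zero => rfl
  | succ k ih =>
    refine finsupp_hom_ext fun v => ?_
    have := LinearMap.congr_fun ih (tupleBoundary W k (Finsupp.single v 1))
    simp only [LinearMap.comp_apply] at this
    rw [LinearMap.comp_apply, LinearMap.comp_apply, tupleSd_single, ← tupleCone_map, ← this,
      ← tupleBoundary_map, tupleMap_single, tupleSd_single, hφ]

theorem tupleHomotopy_map {b : ∀ k, (Fin (k + 1) → W) → W} {b' : ∀ k, (Fin (k + 1) → W') → W'}
    {φ : W → W'} (hφ : ∀ k v, φ (b k v) = b' k (φ ∘ v)) (k : ℕ) (c : (Fin k → W) →₀ ℚ) :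
    tupleHomotopy b' k (tupleMap φ k c) = tupleMap φ (k + 1) (tupleHomotopy b k c) := by
  suffices h : ∀ k, tupleHomotopy b' k ∘ₗ tupleMap φ k =
    tupleMap φ (k + 1) ∘ₗ tupleHomotopy b k from LinearMap.congr_fun (h k) c
  intro k
  induction k with
  | zero => simp [tupleHomotopy]
  | succ k ih =>
    refine finsupp_hom_ext fun v => ?_
    have := LinearMap.congr_fun ih (tupleBoundary W k (Finsupp.single v 1))
    simp only [LinearMap.comp_apply] at this
    rw [LinearMap.comp_apply, LinearMap.comp_apply, tupleHomotopy_single, ← tupleCone_map, map_sub,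
      ← this, ← tupleBoundary_map, tupleMap_single, tupleHomotopy_single, hφ]

/-- Iterated barycentric subdivision. -/
noncomputable def tupleSdIter (b : ∀ k, (Fin (k + 1) → W) → W) (r k : ℕ) :
    ((Fin k → W) →₀ ℚ) →ₗ[ℚ] ((Fin k → W) →₀ ℚ) := (tupleSd b k) ^ r

/-- The chain homotopy between the identity and iterated barycentric subdivision. -/
noncomputable def tupleHomotopyIter (b : ∀ k, (Fin (k + 1) → W) → W) (k : ℕ) :
    ℕ → (((Fin k → W) →₀ ℚ) →ₗ[ℚ] ((Fin (k + 1) → W) →₀ ℚ))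
  | 0 => 0
  | r + 1 => tupleHomotopyIter b k r + tupleHomotopy b k ∘ₗ tupleSdIter b r k

theorem tupleBoundary_sdIter (b : ∀ k, (Fin (k + 1) → W) → W) (r k : ℕ)
    (c : (Fin (k + 1) → W) →₀ ℚ) :
    tupleBoundary W k (tupleSdIter b r (k + 1) c) = tupleSdIter b r k (tupleBoundary W k c) := by
  induction r with
  | zero => rfl
  | succ r ih =>
    rw [tupleSdIter, tupleSdIter, pow_succ', pow_succ', Module.End.mul_apply,
      Module.End.mul_apply, tupleBoundary_sd, ← tupleSdIter, ← tupleSdIter, ih]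

theorem tupleBoundary_homotopyIter (b : ∀ k, (Fin (k + 1) → W) → W) (r k : ℕ)
    (c : (Fin (k + 1) → W) →₀ ℚ) :
    tupleBoundary W (k + 1) (tupleHomotopyIter b (k + 1) r c) =
      c - tupleSdIter b r (k + 1) c - tupleHomotopyIter b k r (tupleBoundary W k c) := by
  induction r with
  | zero => simp [tupleHomotopyIter, tupleSdIter]
  | succ r ih =>
    simp only [tupleHomotopyIter, LinearMap.add_apply, LinearMap.comp_apply, map_add, ih,
      tupleBoundary_homotopy, tupleBoundary_sdIter]
    have : tupleSdIter b (r + 1) (k + 1) c = tupleSd b (k + 1) (tupleSdIter b r (k + 1) c) := by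
      rw [tupleSdIter, pow_succ', Module.End.mul_apply, ← tupleSdIter]
    rw [this]
    abel

theorem tupleSdIter_map {b : ∀ k, (Fin (k + 1) → W) → W} {b' : ∀ k, (Fin (k + 1) → W') → W'}
    {φ : W → W'} (hφ : ∀ k v, φ (b k v) = b' k (φ ∘ v)) (r k : ℕ) (c : (Fin k → W) →₀ ℚ) :
    tupleSdIter b' r k (tupleMap φ k c) = tupleMap φ k (tupleSdIter b r k c) := by
  induction r with
  | zero => rfl
  | succ r ih =>
    rw [tupleSdIter, tupleSdIter, pow_succ', pow_succ', Module.End.mul_apply,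
      Module.End.mul_apply, ← tupleSdIter, ← tupleSdIter, ih, tupleSd_map hφ]

theorem tupleHomotopyIter_map {b : ∀ k, (Fin (k + 1) → W) → W}
    {b' : ∀ k, (Fin (k + 1) → W') → W'}
    {φ : W → W'} (hφ : ∀ k v, φ (b k v) = b' k (φ ∘ v)) (r k : ℕ) (c : (Fin k → W) →₀ ℚ) :
    tupleHomotopyIter b' k r (tupleMap φ k c) =
      tupleMap φ (k + 1) (tupleHomotopyIter b k r c) := by
  induction r with
  | zero => simp [tupleHomotopyIter]
  | succ r ih =>
    simp only [tupleHomotopyIter, LinearMap.add_apply, LinearMap.comp_apply, map_add, ih,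
      tupleSdIter_map hφ, tupleHomotopy_map hφ]

end Tuples

/-! ### A concrete model of the singular chain complex -/

section Singular

/-- Convex combination of points of a standard simplex. -/
noncomputable def simplexComb {k n : ℕ} (v : Fin (k + 1) → stdSimplex ℝ (Fin (n + 1)))
    (t : stdSimplex ℝ (Fin (k + 1))) : stdSimplex ℝ (Fin (n + 1)) :=
  ⟨∑ i, t i • (v i : Fin (n + 1) → ℝ),
    (convex_stdSimplex ℝ (Fin (n + 1))).sum_mem (fun i _ => t.2.1 i) t.2.2
      fun i _ => (v i).2⟩

/-- The affine singular simplex with given vertices. -/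
noncomputable def affineSimplex {k n : ℕ} (v : Fin (k + 1) → stdSimplex ℝ (Fin (n + 1))) :
    C(stdSimplex ℝ (Fin (k + 1)), stdSimplex ℝ (Fin (n + 1))) where
  toFun := simplexComb v
  continuous_toFun := by
    refine Continuous.subtype_mk ?_ _
    refine continuous_finsetSum _ fun i _ => ?_
    exact ((continuous_apply i).comp continuous_subtype_val).smul continuous_const

theorem coe_affineSimplex {k n : ℕ} (v : Fin (k + 1) → stdSimplex ℝ (Fin (n + 1)))
    (t : stdSimplex ℝ (Fin (k + 1))) :
    (affineSimplex v t : Fin (n + 1) → ℝ) = ∑ i, t i • (v i : Fin (n + 1) → ℝ) := rfl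

/-- The inclusion of a face of the standard simplex. -/
noncomputable def simplexFace {n : ℕ} (i : Fin (n + 2)) :
    C(stdSimplex ℝ (Fin (n + 1)), stdSimplex ℝ (Fin (n + 2))) :=
  ⟨stdSimplex.map i.succAbove, stdSimplex.continuous_map _⟩

/-- The vertices of the standard simplex. -/
noncomputable def simplexVertices (n : ℕ) : Fin (n + 1) → stdSimplex ℝ (Fin (n + 1)) :=
  stdSimplex.vertex

theorem affineSimplex_vertices (n : ℕ) :
    affineSimplex (simplexVertices n) = ContinuousMap.id _ := by
  ext t j
  change (affineSimplex (simplexVertices n) t : Fin (n + 1) → ℝ) j = t j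
  rw [coe_affineSimplex]
  simp [simplexVertices, stdSimplex.vertex_coe, Pi.single_apply]

theorem coe_simplexFace {n : ℕ} (i : Fin (n + 2)) (t : stdSimplex ℝ (Fin (n + 1))) :
    (simplexFace i t : Fin (n + 2) → ℝ) = ∑ j, t j • Pi.single (i.succAbove j) (1 : ℝ) := by
  change (stdSimplex.map i.succAbove t : Fin (n + 2) → ℝ) = _
  rw [stdSimplex.map_coe]
  ext l
  simp [FunOnFinite.linearMap_apply_apply, Pi.single_apply, Finset.sum_ite, eq_comm]

theorem affineSimplex_comp_face {k n : ℕ} (v : Fin (k + 2) → stdSimplex ℝ (Fin (n + 1)))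
    (i : Fin (k + 2)) :
    (affineSimplex v).comp (simplexFace i) = affineSimplex (v ∘ i.succAbove) := by
  ext t j
  change (affineSimplex v (simplexFace i t) : Fin (n + 1) → ℝ) j =
    (affineSimplex (v ∘ i.succAbove) t : Fin (n + 1) → ℝ) j
  rw [coe_affineSimplex, coe_affineSimplex]
  have : ∀ l, simplexFace i t l = ∑ j, t j • (Pi.single (i.succAbove j) (1 : ℝ) : _ → ℝ) l := by
    intro l
    have := congrFun (coe_simplexFace i t) l
    simpa using this
  simp only [this, Finset.sum_apply, Pi.smul_apply, Finset.sum_smul]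
  simp only [Function.comp_apply]
  rw [Finset.sum_comm]
  simp [Pi.single_apply]

variable (X : Type) [TopologicalSpace X]

/-- Singular chains. -/
abbrev SingChain (n : ℕ) : Type := C(stdSimplex ℝ (Fin (n + 1)), X) →₀ ℚ

/-- The boundary of singular chains. -/
noncomputable def singBoundary (n : ℕ) : SingChain X (n + 1) →ₗ[ℚ] SingChain X n :=
  Finsupp.lsum ℚ fun σ => LinearMap.toSpanSingleton ℚ _
    (∑ i : Fin (n + 2), (-1 : ℚ) ^ (i : ℕ) • Finsupp.single (σ.comp (simplexFace i)) (1 : ℚ))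

variable {X}

@[simp] theorem singBoundary_single (n : ℕ) (σ : C(stdSimplex ℝ (Fin (n + 2)), X)) :
    singBoundary X n (Finsupp.single σ 1) = ∑ i : Fin (n + 2), (-1 : ℚ) ^ (i : ℕ) •
      Finsupp.single (σ.comp (simplexFace i)) (1 : ℚ) := by
  simp [singBoundary]

/-- A singular simplex transports combinations of tuples of points to singular chains. -/
noncomputable def pushTuples {n : ℕ} (σ : C(stdSimplex ℝ (Fin (n + 1)), X)) (k : ℕ) :
    ((Fin (k + 1) → stdSimplex ℝ (Fin (n + 1))) →₀ ℚ) →ₗ[ℚ] SingChain X k :=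
  Finsupp.lmapDomain ℚ ℚ fun v => σ.comp (affineSimplex v)

@[simp] theorem pushTuples_single {n : ℕ} (σ : C(stdSimplex ℝ (Fin (n + 1)), X)) (k : ℕ)
    (v : Fin (k + 1) → stdSimplex ℝ (Fin (n + 1))) :
    pushTuples σ k (Finsupp.single v 1) = Finsupp.single (σ.comp (affineSimplex v)) 1 := by
  simp [pushTuples, Finsupp.mapDomain_single]

theorem singBoundary_push {n : ℕ} (σ : C(stdSimplex ℝ (Fin (n + 1)), X)) (k : ℕ)
    (c : (Fin (k + 2) → stdSimplex ℝ (Fin (n + 1))) →₀ ℚ) :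
    singBoundary X k (pushTuples σ (k + 1) c) = pushTuples σ k (tupleBoundary _ (k + 1) c) := by
  suffices h : singBoundary X k ∘ₗ pushTuples σ (k + 1) =
    pushTuples σ k ∘ₗ tupleBoundary _ (k + 1) from LinearMap.congr_fun h c
  refine finsupp_hom_ext fun v => ?_
  simp only [LinearMap.comp_apply, pushTuples_single, tupleBoundary_single, map_sum, map_smul,
    singBoundary_single, ContinuousMap.comp_assoc, affineSimplex_comp_face]

theorem pushTuples_vertices {n : ℕ} (σ : C(stdSimplex ℝ (Fin (n + 1)), X)) :
    pushTuples σ n (Finsupp.single (simplexVertices n) 1) = Finsupp.single σ 1 := by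
  rw [pushTuples_single, affineSimplex_vertices, ContinuousMap.comp_id]

theorem singBoundary_boundary (n : ℕ) : singBoundary X n ∘ₗ singBoundary X (n + 1) = 0 := by
  refine finsupp_hom_ext fun σ => ?_
  rw [LinearMap.comp_apply, ← pushTuples_vertices, singBoundary_push, singBoundary_push,
    tupleBoundary_boundary, map_zero, LinearMap.zero_apply]

variable (X) in
/-- The concrete singular chain complex. -/
noncomputable def singComplex : ChainComplex (ModuleCat.{0} ℚ) ℕ :=
  ChainComplex.of (fun n => ModuleCat.of ℚ (SingChain X n))
    (fun n => ModuleCat.ofHom (singBoundary X n)) fun n => by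
      rw [← ModuleCat.ofHom_comp, singBoundary_boundary]; rfl

theorem singComplex_d (n : ℕ) :
    (singComplex X).d (n + 1) n = ModuleCat.ofHom (singBoundary X n) :=
  ChainComplex.of_d (fun n => ModuleCat.of ℚ (SingChain X n))
    (fun n => ModuleCat.ofHom (singBoundary X n)) n

theorem neg_one_zpow_smul_eq {M : Type*} [AddCommGroup M] [Module ℚ M] (i : ℕ) (x : M) :
    (-1 : ℤ) ^ i • x = (-1 : ℚ) ^ i • x := by
  rw [← Int.cast_smul_eq_zsmul ℚ]
  simp

theorem moduleCat_sum_apply {ι : Type*} (s : Finset ι) {A B : ModuleCat.{0} ℚ} (a : ι → ℤ)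
    (f : ι → (A ⟶ B)) (x : A) :
    (∑ i ∈ s, a i • f i).hom x = ∑ i ∈ s, a i • (f i).hom x := by
  simp [ModuleCat.hom_sum, LinearMap.sum_apply]

theorem singularChains_d_single (Y : TopCat.{0}) (n : ℕ)
    (s : (TopCat.toSSet.obj Y).obj (Opposite.op (SimplexCategory.mk (n + 1)))) :
    (((TopCat.toSSet ⋙ chainsQ).obj Y).d (n + 1) n).hom (Finsupp.single s (1 : ℚ)) =
      ∑ i : Fin (n + 2), (-1 : ℚ) ^ (i : ℕ) •
        Finsupp.single ((TopCat.toSSet.obj Y).δ i s) (1 : ℚ) := by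
  have h : ((TopCat.toSSet ⋙ chainsQ).obj Y).d (n + 1) n =
    ∑ i : Fin (n + 2), (-1 : ℤ) ^ (i : ℕ) • (ModuleCat.free ℚ).map ((TopCat.toSSet.obj Y).δ i) :=
    AlgebraicTopology.AlternatingFaceMapComplex.obj_d_eq _ n
  rw [h]
  refine (moduleCat_sum_apply _ _ _ _).trans (Finset.sum_congr rfl fun i _ => ?_)
  have : ((ModuleCat.free ℚ).map ((TopCat.toSSet.obj Y).δ i)).hom (Finsupp.single s (1 : ℚ)) =
    Finsupp.single ((TopCat.toSSet.obj Y).δ i s) (1 : ℚ) := ModuleCat.free_map_apply _ _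
  refine (congrArg _ this).trans ?_
  exact neg_one_zpow_smul_eq _ _

variable (X) in
/-- The concrete singular chain complex is isomorphic to the one of the statement. -/
noncomputable def singComplexIso :
    (TopCat.toSSet ⋙ chainsQ).obj (TopCat.of X) ≅ singComplex X :=
  HomologicalComplex.Hom.isoOfComponents
    (fun n => LinearEquiv.toModuleIso
      (X₁ := ((TopCat.toSSet.obj (TopCat.of X)).obj
        (Opposite.op (SimplexCategory.mk n)) →₀ ℚ)) (X₂ := SingChain X n)
      (Finsupp.domLCongr (TopCat.toSSetObjEquiv (TopCat.of X) _)))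
    (by
      rintro _ n rfl
      refine ModuleCat.hom_ext (finsupp_hom_ext fun s => ?_)
      have he : ∀ n (s : (TopCat.toSSet.obj (TopCat.of X)).obj
          (Opposite.op (SimplexCategory.mk n))),
          (Finsupp.domLCongr (TopCat.toSSetObjEquiv (TopCat.of X) _) :
          ((TopCat.toSSet.obj (TopCat.of X)).obj (Opposite.op (SimplexCategory.mk n)) →₀ ℚ) ≃ₗ[ℚ] _)
            (Finsupp.single s 1) = Finsupp.single (TopCat.toSSetObjEquiv (TopCat.of X) _ s) 1 :=
        fun n s => Finsupp.domLCongr_single _ _ _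
      refine (congrArg ((singComplex X).d (n + 1) n).hom (he (n + 1) s)).trans ?_
      refine Eq.trans ?_ (congrArg (Finsupp.domLCongr (TopCat.toSSetObjEquiv (TopCat.of X) _) :
        ((TopCat.toSSet.obj (TopCat.of X)).obj (Opposite.op (SimplexCategory.mk n)) →₀ ℚ) ≃ₗ[ℚ] _)
        (singularChains_d_single _ n s).symm)
      rw [singComplex_d]
      refine (singBoundary_single (X := X) n _).trans ?_
      rw [map_sum]
      refine Finset.sum_congr rfl fun i _ => ?_
      refine ((LinearEquiv.map_smul _ _ _).trans ?_).symm
      exact congrArg _ (he n _))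

end Singular

/-! ### Subdivision of singular chains -/

section Subdivision

theorem linearMap_mem_of_supported {α M : Type*} [AddCommGroup M] [Module ℚ M]
    (f : (α →₀ ℚ) →ₗ[ℚ] M) {s : Set α} {p : Submodule ℚ M}
    (h : ∀ a ∈ s, f (Finsupp.single a 1) ∈ p) {c : α →₀ ℚ} (hc : c ∈ Finsupp.supported ℚ ℚ s) :
    f c ∈ p := by
  rw [Finsupp.supported_eq_span_single] at hc
  have : Submodule.span ℚ ((fun i => Finsupp.single i (1 : ℚ)) '' s) ≤ p.comap f := by
    rw [Submodule.span_le]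
    rintro _ ⟨a, ha, rfl⟩
    exact h a ha
  exact this hc

theorem single_one_mem_supported {α : Type*} {s : Set α} {a : α} (h : a ∈ s) :
    Finsupp.single a (1 : ℚ) ∈ Finsupp.supported ℚ ℚ s :=
  Finsupp.single_mem_supported ℚ 1 h

theorem affineSimplex_comp {k m n : ℕ} (w : Fin (m + 1) → stdSimplex ℝ (Fin (n + 1)))
    (v : Fin (k + 1) → stdSimplex ℝ (Fin (m + 1))) :
    (affineSimplex w).comp (affineSimplex v) = affineSimplex (affineSimplex w ∘ v) := by
  ext t j
  change (affineSimplex w (affineSimplex v t) : Fin (n + 1) → ℝ) j =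
    (affineSimplex (affineSimplex w ∘ v) t : Fin (n + 1) → ℝ) j
  have e1 := coe_affineSimplex w (affineSimplex v t)
  have e2 := coe_affineSimplex (affineSimplex w ∘ v) t
  have : ∀ l, affineSimplex v t l = ∑ i, t i * v i l := by
    intro l
    have := congrFun (coe_affineSimplex v t) l
    simpa using this
  have h2 : ∀ i, (affineSimplex w (v i) : Fin (n + 1) → ℝ) = ∑ l, v i l • (w l : _ → ℝ) :=
    fun i => coe_affineSimplex w (v i)
  refine (congrFun e1 j).trans (Eq.trans ?_ (congrFun e2 j).symm)
  simp only [Function.comp_apply, h2, this, Finset.sum_apply, Pi.smul_apply, smul_eq_mul,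
    Finset.sum_mul, Finset.mul_sum]
  rw [Finset.sum_comm]
  simp only [mul_assoc]

theorem simplexFace_eq {n : ℕ} (i : Fin (n + 2)) :
    simplexFace i = affineSimplex (simplexVertices (n + 1) ∘ i.succAbove) := by
  rw [← affineSimplex_comp_face, affineSimplex_vertices, ContinuousMap.id_comp]

/-- The barycentre of a tuple of points of a simplex. -/
noncomputable def simplexBary {n : ℕ} (k : ℕ) (v : Fin (k + 1) → stdSimplex ℝ (Fin (n + 1))) :
    stdSimplex ℝ (Fin (n + 1)) := affineSimplex v stdSimplex.barycenter

theorem affineSimplex_bary {k m n : ℕ} (w : Fin (m + 1) → stdSimplex ℝ (Fin (n + 1)))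
    (v : Fin (k + 1) → stdSimplex ℝ (Fin (m + 1))) :
    affineSimplex w (simplexBary k v) = simplexBary k (affineSimplex w ∘ v) :=
  congrArg (fun f => f stdSimplex.barycenter) (affineSimplex_comp w v)

theorem affineSimplex_mem_closedBall {k n : ℕ} (v : Fin (k + 1) → stdSimplex ℝ (Fin (n + 1)))
    (t : stdSimplex ℝ (Fin (k + 1))) {p : stdSimplex ℝ (Fin (n + 1))} {ρ : ℝ}
    (h : ∀ i, dist (v i) p ≤ ρ) : dist (affineSimplex v t) p ≤ ρ := by
  have := (convex_closedBall (p : Fin (n + 1) → ℝ) ρ).sum_mem (t := Finset.univ)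
    (fun i _ => t.2.1 i) t.2.2 (z := fun i => (v i : Fin (n + 1) → ℝ)) (fun i _ => h i)
  exact this

theorem dist_simplexBary_le {k n N : ℕ} (hk : k + 1 ≤ N)
    (v : Fin (k + 1) → stdSimplex ℝ (Fin (n + 1))) {ρ : ℝ}
    (h : ∀ i j, dist (v i) (v j) ≤ ρ) (j : Fin (k + 1)) :
    dist (v j) (simplexBary k v) ≤ (1 - 1 / (N : ℝ)) * ρ := by
  have hρ : 0 ≤ ρ := dist_nonneg.trans (h j j)
  have hkpos : (0 : ℝ) < k + 1 := by positivity
  have e : (v j : Fin (n + 1) → ℝ) - (simplexBary k v : Fin (n + 1) → ℝ) =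
      ∑ i ∈ Finset.univ.erase j, (1 / ((k : ℝ) + 1)) • ((v j : Fin (n + 1) → ℝ) - v i) := by
    rw [Finset.sum_erase _ (by simp)]
    rw [simplexBary, coe_affineSimplex]
    have hb : ∀ i : Fin (k + 1), (stdSimplex.barycenter : stdSimplex ℝ (Fin (k + 1))) i =
        1 / ((k : ℝ) + 1) := fun i => by
      refine (stdSimplex.barycenter_apply (𝕜 := ℝ) i).trans ?_; simp
    simp only [hb, ← Finset.smul_sum, Finset.sum_sub_distrib,
      Finset.sum_const, Finset.card_univ, Fintype.card_fin, smul_sub]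
    congr 1
    · rw [← Nat.cast_smul_eq_nsmul ℝ, smul_smul]
      push_cast
      rw [one_div_mul_cancel hkpos.ne', one_smul]
  have h1 : dist (v j) (simplexBary k v) ≤ ∑ i ∈ Finset.univ.erase j, (1 / ((k : ℝ) + 1)) * ρ := by
    rw [Subtype.dist_eq, dist_eq_norm]
    refine (congrArg norm e).trans_le ?_
    refine norm_sum_le_of_le _ fun i _ => ?_
    rw [norm_smul, Real.norm_of_nonneg (by positivity)]
    have := h j i
    rw [Subtype.dist_eq, dist_eq_norm] at this
    exact mul_le_mul_of_nonneg_left this (by positivity)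
  refine h1.trans ?_
  rw [Finset.sum_const, Finset.card_erase_of_mem (Finset.mem_univ _), Finset.card_univ,
    Fintype.card_fin, nsmul_eq_mul, ← mul_assoc]
  refine mul_le_mul_of_nonneg_right ?_ hρ
  simp only [Nat.add_sub_cancel]
  have h2 : (1 : ℝ) / N ≤ 1 / (k + 1) := one_div_le_one_div_of_le hkpos (by exact_mod_cast hk)
  have h3 : (k : ℝ) * (1 / (k + 1)) = 1 - 1 / (k + 1) := by field_simp; ring
  rw [h3]; linarith

theorem tupleSd_small {n : ℕ} (N : ℕ) : ∀ (k : ℕ), k ≤ N →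
    ∀ (u : Fin k → stdSimplex ℝ (Fin (n + 1))),
    tupleSd simplexBary k (Finsupp.single u 1) ∈ Finsupp.supported ℚ ℚ
      {v | (∀ p ρ, (∀ j, dist (u j) p ≤ ρ) → ∀ i, dist (v i) p ≤ ρ) ∧
        ∀ ρ, 0 ≤ ρ → (∀ i j, dist (u i) (u j) ≤ ρ) → ∀ i j, dist (v i) (v j) ≤ (1 - 1 / (N : ℝ)) * ρ} := by
  intro k
  induction k with
  | zero =>
    intro _ u
    exact single_one_mem_supported ⟨fun _ _ h => h, fun _ _ _ i => i.elim0⟩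
  | succ k ih =>
    intro hk u
    rw [tupleSd_single, tupleBoundary_single, map_sum, map_sum]
    refine Submodule.sum_mem _ fun l _ => ?_
    rw [map_smul, map_smul]
    refine Submodule.smul_mem _ _ (linearMap_mem_of_supported _ ?_ (ih (by omega) _))
    rintro v ⟨hv1, hv2⟩
    rw [tupleCone_single]
    have hN : (0 : ℝ) ≤ 1 - 1 / (N : ℝ) := by
      have : (1 : ℝ) ≤ N := by exact_mod_cast (by omega : 1 ≤ N)
      rw [sub_nonneg]; exact (div_le_one (by linarith)).2 this
    refine single_one_mem_supported ⟨fun p ρ h => ?_, fun ρ hρ h => ?_⟩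
    · refine Fin.cases ?_ fun i => ?_
      · exact affineSimplex_mem_closedBall _ _ h
      · exact hv1 p ρ (fun j => h _) i
    · have hb : ∀ i, dist (v i) (simplexBary k u) ≤ (1 - 1 / (N : ℝ)) * ρ :=
        hv1 _ _ fun j => dist_simplexBary_le hk u h _
      refine Fin.cases (Fin.cases ?_ fun j => ?_) fun i => Fin.cases ?_ fun j => ?_
      · simp only [dist_self]; positivity
      · simpa [dist_comm] using hb j
      · simpa using hb i
      · simpa using hv2 ρ hρ (fun i j => h _ _) i j

theorem tupleSdIter_small {n : ℕ} (k r : ℕ) (u : Fin (k + 1) → stdSimplex ℝ (Fin (n + 1))) {ρ : ℝ}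
    (hρ : 0 ≤ ρ) (hu : ∀ i j, dist (u i) (u j) ≤ ρ) :
    tupleSdIter simplexBary r (k + 1) (Finsupp.single u 1) ∈ Finsupp.supported ℚ ℚ
      {v | ∀ i j, dist (v i) (v j) ≤ (1 - 1 / ((k + 1 : ℕ) : ℝ)) ^ r * ρ} := by
  induction r with
  | zero =>
    refine single_one_mem_supported ?_
    simpa using hu
  | succ r ih =>
    rw [tupleSdIter, pow_succ' (tupleSd simplexBary (k + 1)), Module.End.mul_apply, ← tupleSdIter]
    refine linearMap_mem_of_supported _ (fun v hv => ?_) ih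
    have hN : (0 : ℝ) ≤ 1 - 1 / ((k + 1 : ℕ) : ℝ) := by
      have : (1 : ℝ) ≤ ((k + 1 : ℕ) : ℝ) := by push_cast; linarith [(Nat.cast_nonneg k : (0 : ℝ) ≤ k)]
      rw [sub_nonneg]; exact (div_le_one (by linarith)).2 this
    refine Finsupp.supported_mono (fun w hw => ?_) (tupleSd_small (k + 1) (k + 1) le_rfl v)
    intro i j
    refine (hw.2 _ (by positivity) hv i j).trans (le_of_eq ?_)
    rw [pow_succ']; ring

variable {X : Type} [TopologicalSpace X]

theorem pushTuples_comp {m n : ℕ} (σ : C(stdSimplex ℝ (Fin (n + 1)), X))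
    (w : Fin (m + 1) → stdSimplex ℝ (Fin (n + 1))) (k : ℕ)
    (c : (Fin (k + 1) → stdSimplex ℝ (Fin (m + 1))) →₀ ℚ) :
    pushTuples (σ.comp (affineSimplex w)) k c =
      pushTuples σ k (tupleMap (affineSimplex w) (k + 1) c) := by
  suffices h : pushTuples (σ.comp (affineSimplex w)) k =
    pushTuples σ k ∘ₗ tupleMap (affineSimplex w) (k + 1) from LinearMap.congr_fun h c
  refine finsupp_hom_ext fun v => ?_
  rw [LinearMap.comp_apply, tupleMap_single, pushTuples_single, pushTuples_single,
    ContinuousMap.comp_assoc, affineSimplex_comp]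

variable (X) in
/-- Iterated barycentric subdivision of singular chains. -/
noncomputable def singSd (r k : ℕ) : SingChain X k →ₗ[ℚ] SingChain X k :=
  Finsupp.lsum ℚ fun σ => LinearMap.toSpanSingleton ℚ _
    (pushTuples σ k (tupleSdIter simplexBary r (k + 1) (Finsupp.single (simplexVertices k) 1)))

variable (X) in
/-- The homotopy from the identity to iterated barycentric subdivision. -/
noncomputable def singHomotopy (r k : ℕ) : SingChain X k →ₗ[ℚ] SingChain X (k + 1) :=
  Finsupp.lsum ℚ fun σ => LinearMap.toSpanSingleton ℚ _ (pushTuples σ (k + 1)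
    (tupleHomotopyIter simplexBary (k + 1) r (Finsupp.single (simplexVertices k) 1)))

theorem singSd_single (r k : ℕ) (σ : C(stdSimplex ℝ (Fin (k + 1)), X)) :
    singSd X r k (Finsupp.single σ 1) =
      pushTuples σ k (tupleSdIter simplexBary r (k + 1) (Finsupp.single (simplexVertices k) 1)) := by
  simp [singSd]

theorem singHomotopy_single (r k : ℕ) (σ : C(stdSimplex ℝ (Fin (k + 1)), X)) :
    singHomotopy X r k (Finsupp.single σ 1) = pushTuples σ (k + 1)
      (tupleHomotopyIter simplexBary (k + 1) r (Finsupp.single (simplexVertices k) 1)) := by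
  simp [singHomotopy]

theorem singHomotopy_face (r k : ℕ) (σ : C(stdSimplex ℝ (Fin (k + 2)), X)) (i : Fin (k + 2)) :
    singHomotopy X r k (Finsupp.single (σ.comp (simplexFace i)) 1) =
      pushTuples σ (k + 1) (tupleHomotopyIter simplexBary (k + 1) r
        (Finsupp.single (simplexVertices (k + 1) ∘ i.succAbove) 1)) := by
  rw [singHomotopy_single, simplexFace_eq, pushTuples_comp, ← tupleHomotopyIter_map
    (fun _ _ => affineSimplex_bary _ _), tupleMap_single, ← simplexFace_eq]
  have : simplexFace i ∘ simplexVertices k = simplexVertices (k + 1) ∘ i.succAbove :=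
    funext fun j => stdSimplex.map_vertex i.succAbove j
  rw [this]

theorem singBoundary_homotopy_zero (r : ℕ) (c : SingChain X 0) :
    singBoundary X 0 (singHomotopy X r 0 c) = c - singSd X r 0 c := by
  suffices h : singBoundary X 0 ∘ₗ singHomotopy X r 0 = LinearMap.id - singSd X r 0 from
    LinearMap.congr_fun h c
  refine finsupp_hom_ext fun σ => ?_
  rw [LinearMap.comp_apply, singHomotopy_single, singBoundary_push, tupleBoundary_homotopyIter,
    LinearMap.sub_apply, singSd_single, map_sub, map_sub, pushTuples_vertices]
  have : tupleHomotopyIter (simplexBary (n := 0)) 0 r = 0 := by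
    induction r with
    | zero => rfl
    | succ r ih => simp [tupleHomotopyIter, ih, tupleHomotopy]
  rw [this]
  simp

theorem singBoundary_homotopy (r k : ℕ) (c : SingChain X (k + 1)) :
    singBoundary X (k + 1) (singHomotopy X r (k + 1) c) =
      c - singSd X r (k + 1) c - singHomotopy X r k (singBoundary X k c) := by
  suffices h : singBoundary X (k + 1) ∘ₗ singHomotopy X r (k + 1) =
    LinearMap.id - singSd X r (k + 1) - singHomotopy X r k ∘ₗ singBoundary X k from
    LinearMap.congr_fun h c
  refine finsupp_hom_ext fun σ => ?_
  rw [LinearMap.comp_apply, singHomotopy_single, singBoundary_push, tupleBoundary_homotopyIter,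
    LinearMap.sub_apply, LinearMap.sub_apply, singSd_single, map_sub, map_sub, pushTuples_vertices,
    LinearMap.comp_apply, singBoundary_single, tupleBoundary_single]
  simp only [map_sum, map_smul, singHomotopy_face, LinearMap.id_apply]

/-- The chains supported in a subset. -/
def chainsIn (U : Set X) (k : ℕ) : Set C(stdSimplex ℝ (Fin (k + 1)), X) := {σ | ∀ t, σ t ∈ U}

theorem pushTuples_mem_supported {U : Set X} {n : ℕ} {σ : C(stdSimplex ℝ (Fin (n + 1)), X)}
    (hσ : σ ∈ chainsIn U n) (k : ℕ) (c : (Fin (k + 1) → stdSimplex ℝ (Fin (n + 1))) →₀ ℚ) :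
    pushTuples σ k c ∈ Finsupp.supported ℚ ℚ (chainsIn U k) := by
  refine linearMap_mem_of_supported _ (s := Set.univ) (fun v _ => ?_) (by simp)
  rw [pushTuples_single]
  exact single_one_mem_supported fun t => hσ _

/-- The chains small with respect to a pair of subsets. -/
def smallChains (U V : Set X) (k : ℕ) : Submodule ℚ (SingChain X k) :=
  Finsupp.supported ℚ ℚ (chainsIn U k ∪ chainsIn V k)

theorem singHomotopy_mem {U V : Set X} (r k : ℕ) {c : SingChain X k} (hc : c ∈ smallChains U V k) :
    singHomotopy X r k c ∈ smallChains U V (k + 1) := by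
  refine linearMap_mem_of_supported _ (fun σ hσ => ?_) hc
  rw [singHomotopy_single]
  rcases hσ with h | h
  · exact Finsupp.supported_mono Set.subset_union_left (pushTuples_mem_supported h _ _)
  · exact Finsupp.supported_mono Set.subset_union_right (pushTuples_mem_supported h _ _)

theorem singBoundary_mem {U : Set X} (k : ℕ) {c : SingChain X (k + 1)}
    (hc : c ∈ Finsupp.supported ℚ ℚ (chainsIn U (k + 1))) :
    singBoundary X k c ∈ Finsupp.supported ℚ ℚ (chainsIn U k) := by
  refine linearMap_mem_of_supported _ (fun σ hσ => ?_) hc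
  rw [singBoundary_single]
  exact Submodule.sum_mem _ fun i _ => Submodule.smul_mem _ _
    (single_one_mem_supported fun t => hσ _)

theorem singBoundary_mem_small {U V : Set X} (k : ℕ) {c : SingChain X (k + 1)}
    (hc : c ∈ smallChains U V (k + 1)) : singBoundary X k c ∈ smallChains U V k := by
  refine linearMap_mem_of_supported _ (fun σ hσ => ?_) hc
  rcases hσ with h | h
  · exact Finsupp.supported_mono Set.subset_union_left
      (singBoundary_mem k (single_one_mem_supported h))
  · exact Finsupp.supported_mono Set.subset_union_right
      (singBoundary_mem k (single_one_mem_supported h))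

theorem exists_singSd_single_mem {U V : Set X} (hU : IsOpen U) (hV : IsOpen V)
    (hUV : U ∪ V = Set.univ) (k : ℕ) (σ : C(stdSimplex ℝ (Fin (k + 1)), X)) :
    ∃ r₀, ∀ r ≥ r₀, singSd X r k (Finsupp.single σ 1) ∈ smallChains U V k := by
  obtain ⟨d, hd, hball⟩ := lebesgue_number_lemma_of_metric (s := Set.univ)
    (c := fun b : Bool => cond b (σ ⁻¹' U) (σ ⁻¹' V)) isCompact_univ
    (by rintro (_ | _); exacts [hV.preimage σ.continuous, hU.preimage σ.continuous])
    (by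
      intro x _
      have : σ x ∈ U ∪ V := by rw [hUV]; trivial
      rw [Set.mem_iUnion]
      rcases this with h | h
      exacts [⟨true, h⟩, ⟨false, h⟩])
  have hk : (0 : ℝ) ≤ 1 - 1 / ((k + 1 : ℕ) : ℝ) := by
    have : (1 : ℝ) ≤ ((k + 1 : ℕ) : ℝ) := by push_cast; linarith [(Nat.cast_nonneg k : (0 : ℝ) ≤ k)]
    rw [sub_nonneg]; exact (div_le_one (by linarith)).2 this
  have hk1 : 1 - 1 / ((k + 1 : ℕ) : ℝ) < 1 := by
    have : (0 : ℝ) < 1 / ((k + 1 : ℕ) : ℝ) := by positivity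
    linarith
  set ρ := Metric.diam (Set.univ : Set (stdSimplex ℝ (Fin (k + 1)))) with hρ
  have hdist : ∀ x y : stdSimplex ℝ (Fin (k + 1)), dist x y ≤ ρ := fun x y =>
    Metric.dist_le_diam_of_mem isCompact_univ.isBounded trivial trivial
  have hlim : Filter.Tendsto (fun r : ℕ => (1 - 1 / ((k + 1 : ℕ) : ℝ)) ^ r * ρ) Filter.atTop
      (nhds 0) := by
    simpa using (tendsto_pow_atTop_nhds_zero_of_lt_one hk hk1).mul_const ρ
  obtain ⟨r₀, hr₀⟩ := Filter.eventually_atTop.1 (hlim.eventually (gt_mem_nhds hd))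
  refine ⟨r₀, fun r hr => ?_⟩
  rw [singSd_single]
  refine linearMap_mem_of_supported _ (fun v hv => ?_) (tupleSdIter_small k r (simplexVertices k)
    (Metric.diam_nonneg) fun i j => hdist _ _)
  rw [pushTuples_single]
  refine single_one_mem_supported ?_
  have hin : ∀ t, affineSimplex v t ∈ Metric.ball (v 0) d := fun t =>
    (affineSimplex_mem_closedBall v t fun i => hv i 0).trans_lt (hr₀ r hr)
  obtain ⟨b, hb⟩ := hball (v 0) trivial
  cases b
  · exact Or.inr fun t => hb (hin t)
  · exact Or.inl fun t => hb (hin t)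

theorem exists_singSd_mem {U V : Set X} (hU : IsOpen U) (hV : IsOpen V)
    (hUV : U ∪ V = Set.univ) (k : ℕ) (c : SingChain X k) :
    ∃ r, singSd X r k c ∈ smallChains U V k := by
  suffices h : ∃ r₀, ∀ r ≥ r₀, singSd X r k c ∈ smallChains U V k from
    let ⟨r, hr⟩ := h; ⟨r, hr r le_rfl⟩
  induction c using Finsupp.induction_linear with
  | zero => exact ⟨0, fun r _ => by simp⟩
  | add f g hf hg =>
    obtain ⟨a, ha⟩ := hf
    obtain ⟨b, hb⟩ := hg
    refine ⟨max a b, fun r hr => ?_⟩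
    rw [map_add]
    exact Submodule.add_mem _ (ha r ((le_max_left _ _).trans hr))
      (hb r ((le_max_right _ _).trans hr))
  | single σ q =>
    obtain ⟨a, ha⟩ := exists_singSd_single_mem hU hV hUV k σ
    refine ⟨a, fun r hr => ?_⟩
    rw [← mul_one q, ← smul_eq_mul, ← Finsupp.smul_single, map_smul]
    exact Submodule.smul_mem _ _ (ha r hr)

end Subdivision

/-! ### Euler characteristics of short exact sequences -/

section Exactness

theorem finite_of_function_exact {A B C : Type*} [AddCommGroup A] [AddCommGroup B] [AddCommGroup C]
    [Module ℚ A] [Module ℚ B] [Module ℚ C] {f : A →ₗ[ℚ] B} {g : B →ₗ[ℚ] C}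
    (h : Function.Exact f g) [Module.Finite ℚ A] [Module.Finite ℚ C] : Module.Finite ℚ B := by
  refine ⟨Submodule.fg_of_fg_map_of_fg_inf_ker g (IsNoetherian.noetherian _) ?_⟩
  rw [top_inf_eq, h.linearMap_ker_eq]
  exact Module.Finite.fg_top.map f |> fun h => by rwa [Submodule.map_top] at h

theorem finrank_eq_of_function_exact {A B C : Type*} [AddCommGroup A] [AddCommGroup B]
    [AddCommGroup C] [Module ℚ A] [Module ℚ B] [Module ℚ C] {f : A →ₗ[ℚ] B} {g : B →ₗ[ℚ] C}
    (h : Function.Exact f g) [Module.Finite ℚ B] :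
    Module.finrank ℚ B = Module.finrank ℚ (LinearMap.range f) +
      Module.finrank ℚ (LinearMap.range g) := by
  rw [← g.finrank_range_add_finrank_ker, h.linearMap_ker_eq, add_comm]

/-- A chain complex with finite-dimensional homology concentrated in degrees `0` and `1`, and with
given Euler characteristic. -/
structure GoodComplex (K : ChainComplex (ModuleCat.{0} ℚ) ℕ) (χ : ℤ) : Prop where
  isZero : ∀ n, 2 ≤ n → Limits.IsZero (K.homology n)
  finite_zero : Module.Finite ℚ (K.homology 0)
  finite_one : Module.Finite ℚ (K.homology 1)
  euler : (Module.finrank ℚ (K.homology 0) : ℤ) - Module.finrank ℚ (K.homology 1) = χ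

variable {S : ShortComplex (ChainComplex (ModuleCat.{0} ℚ) ℕ)} (hS : S.ShortExact)

include hS

theorem exact_homology_one_zero (n : ℕ) : Function.Exact
    (HomologicalComplex.homologyMap S.f n).hom (HomologicalComplex.homologyMap S.g n).hom :=
  LinearMap.exact_iff.2 (hS.homology_exact₂ n).moduleCat_range_eq_ker.symm

theorem exact_homology_δ (i j : ℕ) (h : j + 1 = i) : Function.Exact
    (HomologicalComplex.homologyMap S.g i).hom (hS.δ i j h).hom :=
  LinearMap.exact_iff.2 (hS.homology_exact₃ i j h).moduleCat_range_eq_ker.symm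

theorem exact_δ_homology (i j : ℕ) (h : j + 1 = i) : Function.Exact
    (hS.δ i j h).hom (HomologicalComplex.homologyMap S.f j).hom :=
  LinearMap.exact_iff.2 (hS.homology_exact₁ i j h).moduleCat_range_eq_ker.symm

theorem surjective_homologyMap_zero :
    Function.Surjective (HomologicalComplex.homologyMap S.g 0).hom := by
  have := hS.epi_g
  have : Epi (S.g.f 0) := by
    have := (HomologicalComplex.shortExact_iff_degreewise_shortExact S).1 hS 0
    exact this.epi_g
  have := HomologicalComplex.epi_homologyMap_of_epi_of_not_rel S.g 0 (by simp)
  exact (ModuleCat.epi_iff_surjective _).1 this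

theorem finrank_alternating [Module.Finite ℚ (S.X₁.homology 0)] [Module.Finite ℚ (S.X₁.homology 1)]
    [Module.Finite ℚ (S.X₂.homology 0)] [Module.Finite ℚ (S.X₂.homology 1)]
    [Module.Finite ℚ (S.X₃.homology 0)] [Module.Finite ℚ (S.X₃.homology 1)]
    (h2 : Limits.IsZero (S.X₃.homology 2)) :
    (Module.finrank ℚ (S.X₂.homology 0) : ℤ) - Module.finrank ℚ (S.X₂.homology 1) =
      Module.finrank ℚ (S.X₁.homology 0) - Module.finrank ℚ (S.X₁.homology 1) +
      (Module.finrank ℚ (S.X₃.homology 0) - Module.finrank ℚ (S.X₃.homology 1)) := by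
  have e1 := finrank_eq_of_function_exact (exact_δ_homology hS 2 1 rfl)
  have e2 := finrank_eq_of_function_exact (exact_homology_one_zero hS 1)
  have e3 := finrank_eq_of_function_exact (exact_homology_δ hS 1 0 rfl)
  have e4 := finrank_eq_of_function_exact (exact_δ_homology hS 1 0 rfl)
  have e5 := finrank_eq_of_function_exact (exact_homology_one_zero hS 0)
  have e6 : Module.finrank ℚ (LinearMap.range (HomologicalComplex.homologyMap S.g 0).hom) =
      Module.finrank ℚ (S.X₃.homology 0) := by
    rw [LinearMap.range_eq_top.2 (surjective_homologyMap_zero hS), finrank_top]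
  have e0 : Module.finrank ℚ (LinearMap.range (hS.δ 2 1 rfl).hom) = 0 := by
    have := ModuleCat.subsingleton_of_isZero h2
    refine Nat.eq_zero_of_le_zero ((LinearMap.finrank_range_le _).trans (le_of_eq ?_))
    exact Module.finrank_zero_of_subsingleton
  omega

theorem GoodComplex.mid {a b : ℤ} (h1 : GoodComplex S.X₁ a) (h3 : GoodComplex S.X₃ b) :
    GoodComplex S.X₂ (a + b) := by
  have := h1.finite_zero
  have := h1.finite_one
  have := h3.finite_zero
  have := h3.finite_one
  have := finite_of_function_exact (exact_homology_one_zero hS 0)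
  have := finite_of_function_exact (exact_homology_one_zero hS 1)
  refine ⟨fun n hn => ?_, inferInstance, inferInstance, ?_⟩
  · exact (hS.homology_exact₂ n).isZero_of_both_zeros ((h1.isZero n hn).eq_of_src _ _)
      ((h3.isZero n hn).eq_of_tgt _ _)
  · rw [finrank_alternating hS (h3.isZero 2 le_rfl), h1.euler, h3.euler]

theorem GoodComplex.right {a b : ℤ} (h1 : GoodComplex S.X₁ a)
    (h1' : Limits.IsZero (S.X₁.homology 1)) (h2 : GoodComplex S.X₂ b) :
    GoodComplex S.X₃ (b - a) := by
  have := h1.finite_zero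
  have := h1.finite_one
  have := h2.finite_zero
  have := h2.finite_one
  have := finite_of_function_exact (exact_homology_δ hS 1 0 rfl)
  have : Module.Finite ℚ (S.X₃.homology 0) :=
    Module.Finite.of_surjective _ (surjective_homologyMap_zero hS)
  have hz : ∀ n, 2 ≤ n → Limits.IsZero (S.X₃.homology n) := by
    rintro (_ | n) hn
    · omega
    · refine (hS.homology_exact₃ (n + 1) n rfl).isZero_of_both_zeros
        ((h2.isZero _ hn).eq_of_src _ _) ?_
      refine Limits.IsZero.eq_of_tgt ?_ _ _
      rcases n with _ | _ | n
      · omega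
      · exact h1'
      · exact h1.isZero _ (by omega)
  refine ⟨hz, inferInstance, inferInstance, ?_⟩
  have := finrank_alternating hS (hz 2 le_rfl)
  rw [h1.euler, h2.euler] at this
  linarith

end Exactness

theorem GoodComplex.of_iso {K L : ChainComplex (ModuleCat.{0} ℚ) ℕ} (e : K ≅ L) {χ : ℤ}
    (h : GoodComplex K χ) : GoodComplex L χ := by
  have i : ∀ n, K.homology n ≅ L.homology n := fun n =>
    (HomologicalComplex.homologyFunctor _ _ n).mapIso e
  have h0 := h.finite_zero
  have h1 := h.finite_one
  refine ⟨fun n hn => (h.isZero n hn).of_iso (i n).symm,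
    Module.Finite.equiv (i 0).toLinearEquiv, Module.Finite.equiv (i 1).toLinearEquiv, ?_⟩
  rw [← (i 0).toLinearEquiv.finrank_eq, ← (i 1).toLinearEquiv.finrank_eq, h.euler]

section LinearComplex

variable {M N P : ℕ → Type} [∀ n, AddCommGroup (M n)] [∀ n, Module ℚ (M n)]
  [∀ n, AddCommGroup (N n)] [∀ n, Module ℚ (N n)] [∀ n, AddCommGroup (P n)] [∀ n, Module ℚ (P n)]

/-- The chain complex attached to a sequence of linear maps. -/
noncomputable def linComplex (d : ∀ n, M (n + 1) →ₗ[ℚ] M n) (h : ∀ n, d n ∘ₗ d (n + 1) = 0) :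
    ChainComplex (ModuleCat.{0} ℚ) ℕ :=
  ChainComplex.of (fun n => ModuleCat.of ℚ (M n)) (fun n => ModuleCat.ofHom (d n)) fun n => by
    rw [← ModuleCat.ofHom_comp, h]; rfl

variable {d : ∀ n, M (n + 1) →ₗ[ℚ] M n} {h : ∀ n, d n ∘ₗ d (n + 1) = 0}
  {d' : ∀ n, N (n + 1) →ₗ[ℚ] N n} {h' : ∀ n, d' n ∘ₗ d' (n + 1) = 0}
  {d'' : ∀ n, P (n + 1) →ₗ[ℚ] P n} {h'' : ∀ n, d'' n ∘ₗ d'' (n + 1) = 0}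

theorem linComplex_d (n : ℕ) : (linComplex d h).d (n + 1) n = ModuleCat.ofHom (d n) :=
  ChainComplex.of_d (fun n => ModuleCat.of ℚ (M n)) (fun n => ModuleCat.ofHom (d n)) n

/-- The chain map attached to a commuting sequence of linear maps. -/
noncomputable def linHom (f : ∀ n, M n →ₗ[ℚ] N n) (hf : ∀ n, d' n ∘ₗ f (n + 1) = f n ∘ₗ d n) :
    linComplex d h ⟶ linComplex d' h' where
  f n := ModuleCat.ofHom (f n)
  comm' := by
    rintro _ n rfl
    rw [linComplex_d, linComplex_d]
    exact congrArg ModuleCat.ofHom (hf n)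

theorem GoodComplex.linMid {a b : ℤ} (f : ∀ n, M n →ₗ[ℚ] N n) (g : ∀ n, N n →ₗ[ℚ] P n)
    (hf : ∀ n, d' n ∘ₗ f (n + 1) = f n ∘ₗ d n) (hg : ∀ n, d'' n ∘ₗ g (n + 1) = g n ∘ₗ d' n)
    (inj : ∀ n, Function.Injective (f n)) (ex : ∀ n, Function.Exact (f n) (g n))
    (surj : ∀ n, Function.Surjective (g n))
    (h1 : GoodComplex (linComplex d h) a) (h3 : GoodComplex (linComplex d'' h'') b) :
    GoodComplex (linComplex d' h') (a + b) := by
  let S : ShortComplex (ChainComplex (ModuleCat.{0} ℚ) ℕ) := ShortComplex.mk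
    (linHom f hf : linComplex d h ⟶ linComplex d' h')
    (linHom g hg : linComplex d' h' ⟶ linComplex d'' h'') (by
      ext n x
      exact (ex n).apply_apply_eq_zero x)
  have hS : S.ShortExact := HomologicalComplex.shortExact_of_degreewise_shortExact _ fun n =>
    ModuleCat.shortComplex_shortExact _ (ex n) (inj n) (surj n)
  exact GoodComplex.mid hS h1 h3

theorem GoodComplex.linRight {a b : ℤ} (f : ∀ n, M n →ₗ[ℚ] N n) (g : ∀ n, N n →ₗ[ℚ] P n)
    (hf : ∀ n, d' n ∘ₗ f (n + 1) = f n ∘ₗ d n) (hg : ∀ n, d'' n ∘ₗ g (n + 1) = g n ∘ₗ d' n)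
    (inj : ∀ n, Function.Injective (f n)) (ex : ∀ n, Function.Exact (f n) (g n))
    (surj : ∀ n, Function.Surjective (g n))
    (h1 : GoodComplex (linComplex d h) a) (h1' : Limits.IsZero ((linComplex d h).homology 1))
    (h2 : GoodComplex (linComplex d' h') b) :
    GoodComplex (linComplex d'' h'') (b - a) := by
  let S : ShortComplex (ChainComplex (ModuleCat.{0} ℚ) ℕ) := ShortComplex.mk
    (linHom f hf : linComplex d h ⟶ linComplex d' h')
    (linHom g hg : linComplex d' h' ⟶ linComplex d'' h'') (by
      ext n x
      exact (ex n).apply_apply_eq_zero x)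
  have hS : S.ShortExact := HomologicalComplex.shortExact_of_degreewise_shortExact _ fun n =>
    ModuleCat.shortComplex_shortExact _ (ex n) (inj n) (surj n)
  exact GoodComplex.right hS h1 h1' h2

theorem goodComplex_of_acyclic (h0 : Function.Surjective (d 0))
    (hn : ∀ n x, d n x = 0 → ∃ y, d (n + 1) y = x) : GoodComplex (linComplex d h) 0 := by
  have hz : ∀ n, Limits.IsZero ((linComplex d h).homology n) := by
    intro n
    rw [← HomologicalComplex.exactAt_iff_isZero_homology]
    rcases n with _ | n
    · rw [HomologicalComplex.exactAt_iff' _ 1 0 0 (by simp) (by simp),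
        ShortComplex.moduleCat_exact_iff]
      intro x _
      obtain ⟨y, hy⟩ := h0 x
      refine ⟨y, ?_⟩
      change ((linComplex d h).d 1 0).hom y = x
      rw [linComplex_d]; exact hy
    · rw [HomologicalComplex.exactAt_iff' _ (n + 2) (n + 1) n (by simp) (by simp),
        ShortComplex.moduleCat_exact_iff]
      intro x hx
      change ((linComplex d h).d (n + 1) n).hom x = 0 at hx
      rw [linComplex_d] at hx
      obtain ⟨y, hy⟩ := hn n x hx
      refine ⟨y, ?_⟩
      change ((linComplex d h).d (n + 2) (n + 1)).hom y = x
      rw [linComplex_d]; exact hy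
  have s : ∀ n, Subsingleton ((linComplex d h).homology n) := fun n =>
    ModuleCat.subsingleton_of_isZero (hz n)
  refine ⟨fun n _ => hz n, inferInstance, inferInstance, ?_⟩
  rw [Module.finrank_zero_of_subsingleton, Module.finrank_zero_of_subsingleton]; rfl

end LinearComplex

/-! ### Mayer-Vietoris -/

section MayerVietoris

theorem GoodComplex.lin_equiv {M N : ℕ → Type} [∀ n, AddCommGroup (M n)] [∀ n, Module ℚ (M n)]
    [∀ n, AddCommGroup (N n)] [∀ n, Module ℚ (N n)]
    {d : ∀ n, M (n + 1) →ₗ[ℚ] M n} {h : ∀ n, d n ∘ₗ d (n + 1) = 0}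
    {d' : ∀ n, N (n + 1) →ₗ[ℚ] N n} {h' : ∀ n, d' n ∘ₗ d' (n + 1) = 0}
    (e : ∀ n, M n ≃ₗ[ℚ] N n) (he : ∀ n x, d' n (e (n + 1) x) = e n (d n x)) :
    Nonempty (linComplex d h ≅ linComplex d' h') :=
  ⟨HomologicalComplex.Hom.isoOfComponents (fun n => (e n).toModuleIso) (by
    rintro _ n rfl
    rw [linComplex_d, linComplex_d]
    ext x
    exact he n x)⟩

variable {X : Type} [TopologicalSpace X]

/-- A family of submodules of singular chains stable under the boundary. -/
def IsSubcomplex (p : ∀ k, Submodule ℚ (SingChain X k)) : Prop :=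
  ∀ k, ∀ c ∈ p (k + 1), singBoundary X k c ∈ p k

/-- The boundary of a subcomplex. -/
noncomputable def subBoundary {p : ∀ k, Submodule ℚ (SingChain X k)} (hp : IsSubcomplex p) (k : ℕ) :
    p (k + 1) →ₗ[ℚ] p k := (singBoundary X k).restrict (hp k)

theorem subBoundary_boundary {p : ∀ k, Submodule ℚ (SingChain X k)} (hp : IsSubcomplex p) (n : ℕ) :
    subBoundary hp n ∘ₗ subBoundary hp (n + 1) = 0 := by
  ext1 x
  exact Subtype.ext (LinearMap.congr_fun (singBoundary_boundary n) (x : SingChain X (n + 2)))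

/-- The complex attached to a subcomplex. -/
noncomputable abbrev subComplex {p : ∀ k, Submodule ℚ (SingChain X k)} (hp : IsSubcomplex p) :
    ChainComplex (ModuleCat.{0} ℚ) ℕ :=
  linComplex (M := fun n => p n) (subBoundary hp) (subBoundary_boundary hp)

theorem goodComplex_sup {p q s t : ∀ k, Submodule ℚ (SingChain X k)} (hp : IsSubcomplex p)
    (hq : IsSubcomplex q) (hs : IsSubcomplex s) (ht : IsSubcomplex t)
    (hst : ∀ k, s k = p k ⊓ q k) (hst' : ∀ k, t k = p k ⊔ q k) {a b c : ℤ}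
    (gp : GoodComplex (subComplex hp) a) (gq : GoodComplex (subComplex hq) b)
    (gs : GoodComplex (subComplex hs) c)
    (gs' : Limits.IsZero ((subComplex hs).homology 1)) :
    GoodComplex (subComplex ht) (a + b - c) := by
  have gm : GoodComplex (linComplex (M := fun n => p n × q n)
      (fun n => (subBoundary hp n).prodMap (subBoundary hq n)) (fun n => by
        refine LinearMap.ext fun x => Prod.ext ?_ ?_
        · exact LinearMap.congr_fun (subBoundary_boundary hp n) x.1
        · exact LinearMap.congr_fun (subBoundary_boundary hq n) x.2)) (a + b) :=
    GoodComplex.linMid (M := fun n => p n) (P := fun n => q n) (d := subBoundary hp)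
      (d'' := subBoundary hq) (fun n => LinearMap.inl ℚ (p n) (q n)) (fun n => LinearMap.snd ℚ (p n) (q n))
      (fun n => by ext x <;> simp) (fun n => by ext x <;> simp) (fun n => LinearMap.inl_injective)
      (fun n => Function.Exact.inl_snd) (fun n => LinearMap.snd_surjective) gp gq
  refine GoodComplex.linRight (M := fun n => s n) (N := fun n => p n × q n) (P := fun n => t n)
    (d := subBoundary hs) (d'' := subBoundary ht)
    (fun n => ((Submodule.inclusion ((hst n).le.trans inf_le_left)).prod
      (-Submodule.inclusion ((hst n).le.trans inf_le_right))))
    (fun n => (Submodule.inclusion (le_sup_left.trans (hst' n).ge)).coprod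
      (Submodule.inclusion (le_sup_right.trans (hst' n).ge))) ?_ ?_ ?_ ?_ ?_ gs gs' gm
  · intro n
    ext1 x
    refine Prod.ext (Subtype.ext ?_) (Subtype.ext ?_)
    · rfl
    · exact map_neg (singBoundary X n) _
  · intro n
    exact LinearMap.ext fun x => Subtype.ext (map_add (singBoundary X n) _ _)
  · intro n x y hxy
    have := congrArg (fun z => ((Prod.fst z : p n) : SingChain X n)) hxy
    exact Subtype.ext this
  · rintro n ⟨x, y⟩
    constructor
    · intro hxy
      have h0 : (x : SingChain X n) + y = 0 := congrArg Subtype.val hxy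
      have h1 : (x : SingChain X n) = -y := eq_neg_of_add_eq_zero_left h0
      have hx : (x : SingChain X n) ∈ s n := by
        rw [hst]; refine ⟨x.2, ?_⟩
        rw [SetLike.mem_coe, h1]; exact Submodule.neg_mem _ y.2
      refine ⟨⟨x, hx⟩, Prod.ext (Subtype.ext rfl) (Subtype.ext ?_)⟩
      change -(x : SingChain X n) = y
      rw [h1, neg_neg]
    · rintro ⟨z, hz⟩
      rw [← hz]
      refine Subtype.ext ?_
      change (z : SingChain X n) + -(z : SingChain X n) = 0
      exact add_neg_cancel _
  · rintro n ⟨z, hz⟩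
    rw [hst'] at hz
    obtain ⟨x, hx, y, hy, rfl⟩ := Submodule.mem_sup.1 hz
    exact ⟨(⟨x, hx⟩, ⟨y, hy⟩), rfl⟩

theorem isSubcomplex_chainsIn (U : Set X) :
    IsSubcomplex fun k => Finsupp.supported ℚ ℚ (chainsIn U k) :=
  fun k _ hc => singBoundary_mem k hc

theorem isSubcomplex_smallChains (U V : Set X) : IsSubcomplex (smallChains U V) :=
  fun k _ hc => singBoundary_mem_small k hc

theorem goodComplex_of_smallChains {U V : Set X} (hU : IsOpen U) (hV : IsOpen V)
    (hUV : U ∪ V = Set.univ) {χ : ℤ}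
    (h : GoodComplex (subComplex (isSubcomplex_smallChains U V)) χ) :
    GoodComplex (singComplex X) χ := by
  let dQ : ∀ n, (SingChain X (n + 1) ⧸ smallChains U V (n + 1)) →ₗ[ℚ]
      (SingChain X n ⧸ smallChains U V n) := fun n =>
    Submodule.mapQ _ _ (singBoundary X n) fun c hc => singBoundary_mem_small n hc
  have hQ : ∀ n, dQ n ∘ₗ dQ (n + 1) = 0 := by
    intro n
    refine LinearMap.ext fun x => ?_
    obtain ⟨c, rfl⟩ := Submodule.Quotient.mk_surjective _ x
    refine (Submodule.Quotient.mk_eq_zero (smallChains U V n)).2 ?_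
    change singBoundary X n (singBoundary X (n + 1) c) ∈ _
    rw [← LinearMap.comp_apply, singBoundary_boundary]; exact Submodule.zero_mem _
  have gQ : GoodComplex (linComplex (M := fun n => SingChain X n ⧸ smallChains U V n) dQ hQ) 0 := by
    refine goodComplex_of_acyclic ?_ ?_
    · intro x
      obtain ⟨c, rfl⟩ := Submodule.Quotient.mk_surjective _ x
      obtain ⟨r, hr⟩ := exists_singSd_mem hU hV hUV 0 c
      refine ⟨Submodule.Quotient.mk (singHomotopy X r 0 c), ?_⟩
      change Submodule.Quotient.mk (singBoundary X 0 _) = _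
      rw [singBoundary_homotopy_zero, Submodule.Quotient.mk_sub,
        (Submodule.Quotient.mk_eq_zero _).2 hr, sub_zero]
    · intro n x hx
      obtain ⟨c, rfl⟩ := Submodule.Quotient.mk_surjective _ x
      have hc : singBoundary X n c ∈ smallChains U V n :=
        (Submodule.Quotient.mk_eq_zero _).1 hx
      obtain ⟨r, hr⟩ := exists_singSd_mem hU hV hUV (n + 1) c
      refine ⟨Submodule.Quotient.mk (singHomotopy X r (n + 1) c), ?_⟩
      change Submodule.Quotient.mk (singBoundary X (n + 1) _) = _
      rw [singBoundary_homotopy, Submodule.Quotient.mk_sub, Submodule.Quotient.mk_sub,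
        (Submodule.Quotient.mk_eq_zero _).2 hr,
        (Submodule.Quotient.mk_eq_zero _).2 (singHomotopy_mem r n hc), sub_zero, sub_zero]
  have := GoodComplex.linMid (M := fun n => smallChains U V n)
    (P := fun n => SingChain X n ⧸ smallChains U V n)
    (d := subBoundary (isSubcomplex_smallChains U V)) (d'' := dQ) (d' := singBoundary X) (h' := singBoundary_boundary)
    (fun n => (smallChains U V n).subtype) (fun n => (smallChains U V n).mkQ)
    (fun n => rfl) (fun n => rfl) (fun n => Submodule.injective_subtype _)
    (fun n => LinearMap.exact_subtype_mkQ _) (fun n => Submodule.mkQ_surjective _) h gQ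
  rw [add_zero] at this
  exact this

/-- Chains of a subspace as chains of the ambient space. -/
noncomputable def subspaceChains (U : Set X) (n : ℕ) :
    SingChain U n ≃ₗ[ℚ] Finsupp.supported ℚ ℚ (chainsIn U n) :=
  (Finsupp.domLCongr
    { toFun := fun σ => (⟨(⟨Subtype.val, continuous_subtype_val⟩ : C(U, X)).comp σ,
        fun t => (σ t).2⟩ : chainsIn U n)
      invFun := fun σ => ⟨fun t => ⟨σ.1 t, σ.2 t⟩, σ.1.continuous.subtype_mk _⟩
      left_inv := fun _ => rfl
      right_inv := fun _ => rfl }).trans (Finsupp.supportedEquivFinsupp (chainsIn U n)).symm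

theorem subspaceChains_single (U : Set X) (n : ℕ) (σ : C(stdSimplex ℝ (Fin (n + 1)), U)) (r : ℚ) :
    (subspaceChains U n (Finsupp.single σ r) : SingChain X n) =
      Finsupp.single ((⟨Subtype.val, continuous_subtype_val⟩ : C(U, X)).comp σ) r := by
  simp [subspaceChains]

theorem subspaceComplex_iso (U : Set X) :
    Nonempty (singComplex U ≅ subComplex (isSubcomplex_chainsIn U)) := by
  refine GoodComplex.lin_equiv (h := singBoundary_boundary) (M := fun n => SingChain U n)
    (N := fun n => Finsupp.supported ℚ ℚ (chainsIn U n))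
    (d' := subBoundary (isSubcomplex_chainsIn U)) (h' := subBoundary_boundary _) (subspaceChains U) fun n x => ?_
  refine Subtype.ext ?_
  suffices h : singBoundary X n ∘ₗ (Submodule.subtype _ ∘ₗ (subspaceChains U (n + 1)).toLinearMap) =
      Submodule.subtype _ ∘ₗ (subspaceChains U n).toLinearMap ∘ₗ singBoundary U n from
    LinearMap.congr_fun h x
  refine finsupp_hom_ext fun σ => ?_
  simp [subspaceChains_single]

/-- A space with finite-dimensional homology concentrated in degrees `0` and `1`, and with given
Euler characteristic. -/
def GoodSpace (X : Type) [TopologicalSpace X] (χ : ℤ) : Prop := GoodComplex (singComplex X) χ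

theorem GoodSpace.union {U V : Set X} (hU : IsOpen U) (hV : IsOpen V) (hUV : U ∪ V = Set.univ)
    {a b c : ℤ} (gU : GoodSpace U a) (gV : GoodSpace V b) (gW : GoodSpace ↥(U ∩ V) c)
    (gW' : Limits.IsZero ((singComplex ↥(U ∩ V)).homology 1)) : GoodSpace X (a + b - c) := by
  obtain ⟨eU⟩ := subspaceComplex_iso U
  obtain ⟨eV⟩ := subspaceComplex_iso V
  obtain ⟨eW⟩ := subspaceComplex_iso (U ∩ V)
  refine goodComplex_of_smallChains hU hV hUV (goodComplex_sup (isSubcomplex_chainsIn U)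
    (isSubcomplex_chainsIn V) (isSubcomplex_chainsIn (U ∩ V)) _ ?_ ?_ (gU.of_iso eU) (gV.of_iso eV)
    (gW.of_iso eW) (gW'.of_iso ((HomologicalComplex.homologyFunctor _ _ 1).mapIso eW.symm)))
  · intro k
    rw [← Finsupp.supported_inter]
    congr 1
    ext σ
    exact forall_and
  · intro k
    exact Finsupp.supported_union _ _

/-- The homology of the concrete complex. -/
noncomputable def singHomologyIso (X : Type) [TopologicalSpace X] (n : ℕ) :
    (homologyFunctorQ n).obj (TopCat.of X) ≅ (singComplex X).homology n :=
  (HomologicalComplex.homologyFunctor _ _ n).mapIso (singComplexIso X)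

theorem GoodSpace.eulerChar_eq {χ : ℤ} (h : GoodSpace X χ) : eulerChar X = χ := by
  have i := fun n => (singHomologyIso X n).toLinearEquiv.finrank_eq
  have e : ∀ n, Module.finrank ℚ (singularHomologyQ (TopCat.of X) n) =
    Module.finrank ℚ ((singComplex X).homology n) := i
  have := ModuleCat.subsingleton_of_isZero (h.isZero 2 le_rfl)
  have h2 : Module.finrank ℚ ((singComplex X).homology 2) = 0 :=
    Module.finrank_zero_of_subsingleton
  rw [eulerChar, Finset.sum_range_succ, Finset.sum_range_succ, Finset.sum_range_one, e, e, e, h2,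
    ← h.euler]
  push_cast
  ring

theorem GoodSpace.of_homotopyEquiv {Y : Type} [TopologicalSpace Y]
    (e : ContinuousMap.HomotopyEquiv X Y) {χ : ℤ} (h : GoodSpace X χ) : GoodSpace Y χ := by
  have i : ∀ n, (singComplex X).homology n ≅ (singComplex Y).homology n := fun n =>
    (singHomologyIso X n).symm ≪≫ homologyIsoOfHomotopyEquiv e n ≪≫ singHomologyIso Y n
  have h0 := h.finite_zero
  have h1 := h.finite_one
  refine ⟨fun n hn => (h.isZero n hn).of_iso (i n).symm,
    Module.Finite.equiv (i 0).toLinearEquiv, Module.Finite.equiv (i 1).toLinearEquiv, ?_⟩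
  rw [← (i 0).toLinearEquiv.finrank_eq, ← (i 1).toLinearEquiv.finrank_eq, h.euler]

theorem isZero_homology_of_homotopyEquiv {Y : Type} [TopologicalSpace Y]
    (e : ContinuousMap.HomotopyEquiv X Y) {n : ℕ} (h : Limits.IsZero ((singComplex X).homology n)) :
    Limits.IsZero ((singComplex Y).homology n) :=
  h.of_iso ((singHomologyIso Y n).symm ≪≫ homologyIsoOfHomotopyEquiv e.symm n ≪≫
    singHomologyIso X n)

theorem isZero_homology_of_discrete [TotallyDisconnectedSpace X] {n : ℕ} (hn : n ≠ 0) :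
    Limits.IsZero ((singComplex X).homology n) :=
  (isZero_singularHomologyQ_of_totallyDisconnected X hn).of_iso (singHomologyIso X n).symm

theorem goodSpace_of_finite [TotallyDisconnectedSpace X] [Finite X] :
    GoodSpace X (Nat.card X) := by
  obtain ⟨f, e⟩ := finrank_singularHomologyQ_zero X
  have z := fun n hn => isZero_homology_of_discrete (X := X) (n := n) hn
  have := ModuleCat.subsingleton_of_isZero (z 1 one_ne_zero)
  have i := (singHomologyIso X 0).toLinearEquiv
  refine ⟨fun n hn => z n (by omega), ?_, inferInstance, ?_⟩
  · have : Module.Finite ℚ ((homologyFunctorQ 0).obj (TopCat.of X)) := f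
    exact Module.Finite.equiv i
  · rw [Module.finrank_zero_of_subsingleton (M := (singComplex X).homology 1), ← i.finrank_eq]
    change (Module.finrank ℚ (singularHomologyQ (TopCat.of X) 0) : ℤ) - _ = _
    rw [e]; simp

end MayerVietoris

/-! ### Analytic families of polynomials -/

section AnalyticFamilies

/-- The polynomial with given coefficients in degrees less than `n`. -/
noncomputable def lowPoly (n : ℕ) : (Fin n → ℂ) →ₗ[ℂ] Polynomial ℂ :=
  (Polynomial.degreeLT ℂ n).subtype ∘ₗ (Polynomial.degreeLTEquiv ℂ n).symm.toLinearMap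

theorem lowPoly_injective (n : ℕ) : Function.Injective (lowPoly n) :=
  (Submodule.injective_subtype _).comp (Polynomial.degreeLTEquiv ℂ n).symm.injective

theorem degree_lowPoly_lt (n : ℕ) (u : Fin n → ℂ) : (lowPoly n u).degree < n :=
  Polynomial.mem_degreeLT.1 ((Polynomial.degreeLTEquiv ℂ n).symm u).2

theorem natDegree_lowPoly_succ_le (n : ℕ) (u : Fin (n + 1) → ℂ) :
    (lowPoly (n + 1) u).natDegree ≤ n :=
  Polynomial.natDegree_le_iff_coeff_eq_zero.2 fun i hi =>
    Polynomial.coeff_eq_zero_of_degree_lt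
      ((degree_lowPoly_lt (n + 1) u).trans_le (by exact_mod_cast hi))

theorem coeff_lowPoly (n : ℕ) (u : Fin n → ℂ) (i : Fin n) : (lowPoly n u).coeff i = u i :=
  congrFun ((Polynomial.degreeLTEquiv ℂ n).apply_symm_apply u) i

theorem coeff_lowPoly_of_le {n : ℕ} (u : Fin n → ℂ) {i : ℕ} (h : n ≤ i) :
    (lowPoly n u).coeff i = 0 :=
  Polynomial.coeff_eq_zero_of_degree_lt ((degree_lowPoly_lt n u).trans_le (by exact_mod_cast h))

variable {E : Type*} [NormedAddCommGroup E] [NormedSpace ℂ E]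

/-- A family of polynomials with coefficients analytic at a point. -/
def AnalyticFamily (p : E → Polynomial ℂ) (e : E) : Prop :=
  ∀ i, AnalyticAt ℂ (fun x => (p x).coeff i) e

variable {p q : E → Polynomial ℂ} {e : E}

theorem AnalyticFamily.const (p : Polynomial ℂ) : AnalyticFamily (fun _ => p) e :=
  fun _ => analyticAt_const

theorem AnalyticFamily.add (hp : AnalyticFamily p e) (hq : AnalyticFamily q e) :
    AnalyticFamily (fun x => p x + q x) e := fun i => by
  simpa only [Polynomial.coeff_add] using (hp i).fun_add (hq i)

theorem AnalyticFamily.sub (hp : AnalyticFamily p e) (hq : AnalyticFamily q e) :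
    AnalyticFamily (fun x => p x - q x) e := fun i => by
  simpa only [Polynomial.coeff_sub] using (hp i).fun_sub (hq i)

theorem AnalyticFamily.mul (hp : AnalyticFamily p e) (hq : AnalyticFamily q e) :
    AnalyticFamily (fun x => p x * q x) e := fun i => by
  simp only [Polynomial.coeff_mul]
  exact Finset.analyticAt_fun_sum _ fun k _ => (hp k.1).fun_mul (hq k.2)

theorem AnalyticFamily.C {c : E → ℂ} (hc : AnalyticAt ℂ c e) :
    AnalyticFamily (fun x => Polynomial.C (c x)) e := fun i => by
  simp only [Polynomial.coeff_C]
  split_ifs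
  · exact hc
  · exact analyticAt_const

theorem AnalyticFamily.pow (hp : AnalyticFamily p e) (n : ℕ) :
    AnalyticFamily (fun x => p x ^ n) e := by
  induction n with
  | zero => simpa using AnalyticFamily.const 1
  | succ n ih => simpa only [pow_succ] using ih.mul hp

theorem AnalyticFamily.sum {ι : Type*} (s : Finset ι) {p : ι → E → Polynomial ℂ}
    (hp : ∀ i ∈ s, AnalyticFamily (p i) e) : AnalyticFamily (fun x => ∑ i ∈ s, p i x) e := fun i => by
  simp only [Polynomial.finsetSum_coeff]
  exact Finset.analyticAt_fun_sum _ fun k hk => hp k hk i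

theorem AnalyticFamily.eval (hp : AnalyticFamily p e) {D : ℕ} (hD : ∀ x, (p x).natDegree ≤ D)
    {c : E → ℂ} (hc : AnalyticAt ℂ c e) : AnalyticAt ℂ (fun x => (p x).eval (c x)) e := by
  have : (fun x => (p x).eval (c x)) =
      fun x => ∑ i ∈ Finset.range (D + 1), (p x).coeff i * c x ^ i := by
    ext x
    exact Polynomial.eval_eq_sum_range' (Nat.lt_succ_of_le (hD x)) _
  rw [this]
  exact Finset.analyticAt_fun_sum _ fun k _ => (hp k).fun_mul (hc.fun_pow k)

theorem AnalyticFamily.comp {F : Type*} [NormedAddCommGroup F] [NormedSpace ℂ F] {f : F → E}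
    {x : F} (hp : AnalyticFamily p (f x)) (hf : AnalyticAt ℂ f x) :
    AnalyticFamily (fun z => p (f z)) x := fun i => AnalyticAt.fun_comp (hp i) hf

theorem AnalyticFamily.lowPoly {n : ℕ} {u : E → Fin n → ℂ} (hu : AnalyticAt ℂ u e) :
    AnalyticFamily (fun x => lowPoly n (u x)) e := fun i => by
  by_cases h : i < n
  · have : (fun x => (MilnorFibre.lowPoly n (u x)).coeff i) = fun x => u x ⟨i, h⟩ := by
      ext x; exact coeff_lowPoly n (u x) ⟨i, h⟩
    rw [this]
    exact analyticAt_pi_iff.1 hu _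
  · simp only [coeff_lowPoly_of_le _ (not_lt.1 h)]
    exact analyticAt_const

/-- The multiplication map near a pair of polynomials, in terms of coefficients. -/
noncomputable def factorMap (k m : ℕ) (a b : Polynomial ℂ)
    (w : (Fin k → ℂ) × (Fin (m + 1) → ℂ)) : Fin (k + m + 1) → ℂ := fun i =>
  ((a + lowPoly k w.1) * (b + lowPoly (m + 1) w.2)).coeff i

theorem analyticAt_factorMap (k m : ℕ) (a b : Polynomial ℂ)
    (w : (Fin k → ℂ) × (Fin (m + 1) → ℂ)) : AnalyticAt ℂ (factorMap k m a b) w := by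
  refine analyticAt_pi_iff.2 fun i => ?_
  exact (((AnalyticFamily.const a).add (AnalyticFamily.lowPoly analyticAt_fst)).mul
    ((AnalyticFamily.const b).add (AnalyticFamily.lowPoly analyticAt_snd))) i

theorem fderiv_factorMap (k m : ℕ) (a b : Polynomial ℂ) (w : (Fin k → ℂ) × (Fin (m + 1) → ℂ))
    (i : Fin (k + m + 1)) : fderiv ℂ (factorMap k m a b) 0 w i =
      (lowPoly k w.1 * b + a * lowPoly (m + 1) w.2).coeff i := by
  have h1 : HasFDerivAt (factorMap k m a b) (fderiv ℂ (factorMap k m a b) 0)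
      ((0 : ℂ) • w) := by
    rw [zero_smul]; exact (analyticAt_factorMap k m a b 0).differentiableAt.hasFDerivAt
  have h2 : HasDerivAt (fun t : ℂ => t • w) w 0 := by
    simpa using (hasDerivAt_id (0 : ℂ)).smul_const w
  have h3 := (hasDerivAt_pi.1 (h1.comp_hasDerivAt (0 : ℂ) h2)) i
  refine h3.unique ?_
  have : (fun t : ℂ => (factorMap k m a b ∘ fun t : ℂ => t • w) t i) = fun t =>
      (a * b).coeff i + t * (lowPoly k w.1 * b + a * lowPoly (m + 1) w.2).coeff i +
        t ^ 2 * (lowPoly k w.1 * lowPoly (m + 1) w.2).coeff i := by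
    ext t
    simp only [factorMap, Function.comp_apply, Prod.smul_fst, Prod.smul_snd, map_smul]
    rw [← smul_eq_mul t, ← smul_eq_mul (t ^ 2), ← Polynomial.coeff_smul, ← Polynomial.coeff_smul,
      ← Polynomial.coeff_add, ← Polynomial.coeff_add]
    congr 1
    simp only [Polynomial.smul_eq_C_mul, map_pow]
    ring
  rw [this]
  have h4 := (((hasDerivAt_id (0 : ℂ)).mul_const
    ((lowPoly k w.1 * b + a * lowPoly (m + 1) w.2).coeff i)).const_add ((a * b).coeff i)).fun_add
    (((hasDerivAt_id (0 : ℂ)).fun_pow 2).mul_const ((lowPoly k w.1 * lowPoly (m + 1) w.2).coeff i))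
  simpa using h4

theorem fderiv_factorMap_injective {k m : ℕ} {a b : Polynomial ℂ} (ha : a.Monic)
    (hak : a.natDegree = k) (hb : b.natDegree ≤ m) (hab : IsCoprime a b) :
    Function.Injective (fderiv ℂ (factorMap k m a b) 0) := by
  rw [injective_iff_map_eq_zero]
  intro w hw
  have hdeg : (lowPoly k w.1 * b + a * lowPoly (m + 1) w.2).natDegree ≤ k + m := by
    refine (Polynomial.natDegree_add_le_of_degree_le ?_ ?_)
    · refine Polynomial.natDegree_mul_le_of_le ?_ hb
      exact Polynomial.natDegree_le_of_degree_le (degree_lowPoly_lt _ _).le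
    · exact Polynomial.natDegree_mul_le_of_le hak.le (natDegree_lowPoly_succ_le m w.2)
  have h0 : lowPoly k w.1 * b + a * lowPoly (m + 1) w.2 = 0 := by
    ext i
    by_cases h : i < k + m + 1
    · rw [← fderiv_factorMap k m a b w ⟨i, h⟩, hw]; rfl
    · exact Polynomial.coeff_eq_zero_of_natDegree_lt (by omega)
  have h1 : a ∣ lowPoly k w.1 := by
    refine hab.dvd_of_dvd_mul_right ⟨-lowPoly (m + 1) w.2, ?_⟩
    linear_combination h0
  have h2 : lowPoly k w.1 = 0 := by
    refine Polynomial.eq_zero_of_dvd_of_degree_lt h1 ?_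
    rw [Polynomial.degree_eq_natDegree ha.ne_zero, hak]
    exact degree_lowPoly_lt k w.1
  rw [h2, zero_mul, zero_add] at h0
  have h3 : lowPoly (m + 1) w.2 = 0 := (mul_eq_zero.1 h0).resolve_left ha.ne_zero
  refine Prod.ext (lowPoly_injective _ ?_) (lowPoly_injective _ ?_)
  · rw [h2]; exact (map_zero _).symm
  · rw [h3]; exact (map_zero _).symm

/-- Coprime factorizations extend to analytic families of polynomials. -/
theorem exists_analytic_factorization {k m : ℕ} {p : E → Polynomial ℂ}
    (hp : ∀ x, (p x).natDegree ≤ k + m) (hpa : AnalyticFamily p e) {a b : Polynomial ℂ}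
    (ha : a.Monic) (hak : a.natDegree = k) (hb : b.natDegree ≤ m) (hab : IsCoprime a b)
    (h : p e = a * b) :
    ∃ A B : E → Polynomial ℂ, (∀ x, (A x).Monic ∧ (A x).natDegree = k) ∧
      (∀ x, (B x).natDegree ≤ m) ∧ AnalyticFamily A e ∧ AnalyticFamily B e ∧ A e = a ∧ B e = b ∧
      ∀ᶠ x in nhds e, p x = A x * B x := by
  have hF := (analyticAt_factorMap k m a b 0).contDiffAt (n := ⊤)
  let L := ContinuousLinearEquiv.ofBijective (fderiv ℂ (factorMap k m a b) 0)
    (LinearMap.ker_eq_bot.2 (fderiv_factorMap_injective ha hak hb hab)) (by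
      refine LinearMap.range_eq_top.2 ?_
      refine (LinearMap.injective_iff_surjective_of_finrank_eq_finrank ?_).1
        (fderiv_factorMap_injective ha hak hb hab)
      simp; ring)
  have hL : HasFDerivAt (factorMap k m a b) (L : _ →L[ℂ] _) 0 := by
    have := (analyticAt_factorMap k m a b 0).differentiableAt.hasFDerivAt
    convert! this
  have hn : (⊤ : WithTop ℕ∞) ≠ 0 := by simp
  have hinv := hF.to_localInverse hL hn
  have hS := hF.hasStrictFDerivAt' hL hn
  set G := hF.localInverse hL hn with hG
  let c : E → Fin (k + m + 1) → ℂ := fun x i => (p x).coeff i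
  have hc : AnalyticAt ℂ c e := analyticAt_pi_iff.2 fun i => hpa i
  have hce : c e = factorMap k m a b 0 := by
    ext i; simp [c, factorMap, h]
  have hGe : G (c e) = 0 := by rw [hce]; exact hF.localInverse_apply_image hL hn
  have hGa : AnalyticAt ℂ (fun x => G (c x)) e := by
    refine AnalyticAt.fun_comp ?_ hc
    rw [hce]; exact hinv.analyticAt
  refine ⟨fun x => a + lowPoly k (G (c x)).1, fun x => b + lowPoly (m + 1) (G (c x)).2, ?_, ?_,
    ?_, ?_, ?_, ?_, ?_⟩
  · intro x
    have : (lowPoly k (G (c x)).1).degree < a.degree := by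
      rw [Polynomial.degree_eq_natDegree ha.ne_zero, hak]; exact degree_lowPoly_lt _ _
    exact ⟨ha.add_of_left this, by rw [Polynomial.natDegree_add_eq_left_of_degree_lt this, hak]⟩
  · intro x
    exact Polynomial.natDegree_add_le_of_degree_le hb (natDegree_lowPoly_succ_le m _)
  · exact (AnalyticFamily.const a).add (AnalyticFamily.lowPoly (analyticAt_fst.fun_comp hGa))
  · exact (AnalyticFamily.const b).add (AnalyticFamily.lowPoly (analyticAt_snd.fun_comp hGa))
  · simp [hGe]
  · simp [hGe]
  · have h1 := hS.eventually_right_inverse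
    rw [← hce] at h1
    filter_upwards [hc.continuousAt.eventually h1] with x hx
    ext i
    by_cases hi : i < k + m + 1
    · exact (congrFun hx ⟨i, hi⟩).symm
    · rw [Polynomial.coeff_eq_zero_of_natDegree_lt (by have := hp x; omega), eq_comm]
      refine Polynomial.coeff_eq_zero_of_natDegree_lt (lt_of_le_of_lt (b := k + m)
        (Polynomial.natDegree_mul_le_of_le ?_ ?_) (by omega))
      · exact Polynomial.natDegree_add_le_of_degree_le hak.le
          (Polynomial.natDegree_le_of_degree_le (degree_lowPoly_lt _ _).le)
      · exact Polynomial.natDegree_add_le_of_degree_le hb (natDegree_lowPoly_succ_le m _)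

end AnalyticFamilies

/-! ### Puiseux factorization -/

section Puiseux

open Filter Topology

theorem AnalyticFamily.congr {E : Type*} [NormedAddCommGroup E] [NormedSpace ℂ E]
    {p q : E → Polynomial ℂ} {e : E} (hp : AnalyticFamily p e) (h : p =ᶠ[𝓝 e] q) :
    AnalyticFamily q e := fun i =>
  (hp i).congr (h.mono fun x hx => by simp only [hx])

theorem tendsto_pow_zero {K : ℕ} (hK : K ≠ 0) : Tendsto (fun t : ℂ => t ^ K) (𝓝 0) (𝓝 0) := by
  have := (continuous_pow K (M := ℂ)).tendsto 0
  rwa [zero_pow hK] at this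

theorem analyticAt_comp_pow {f : ℂ → ℂ} (hf : AnalyticAt ℂ f 0) {K : ℕ} (hK : K ≠ 0) :
    AnalyticAt ℂ (fun t => f (t ^ K)) 0 := by
  have h0 : AnalyticAt ℂ f ((fun t : ℂ => t ^ K) 0) := by simpa [hK] using hf
  exact AnalyticAt.fun_comp h0 (analyticAt_id.fun_pow K)

theorem analyticOrderAt_pow_id (K : ℕ) : analyticOrderAt (fun t : ℂ => t ^ K) 0 = K := by
  have := analyticOrderAt_centeredMonomial (𝕜 := ℂ) (z₀ := 0) (n := K)
  simpa [Pi.pow_def] using this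

theorem analyticOrderAt_comp_pow {f : ℂ → ℂ} (hf : AnalyticAt ℂ f 0) {K : ℕ} (hK : K ≠ 0) :
    analyticOrderAt (fun t => f (t ^ K)) 0 = analyticOrderAt f 0 * K := by
  have h0 : AnalyticAt ℂ f ((fun t : ℂ => t ^ K) 0) := by simpa [hK] using hf
  have h1 : AnalyticAt ℂ (fun t : ℂ => t ^ K) 0 := analyticAt_id.fun_pow K
  have := AnalyticAt.analyticOrderAt_comp (f := f) (g := fun t : ℂ => t ^ K) h0 h1
  simpa only [Function.comp_def, sub_zero, zero_pow hK, analyticOrderAt_pow_id] using this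

/-- A family of polynomials that splits into analytic linear factors after a ramified base
change. -/
def HasPuiseuxRoots (P : ℂ → Polynomial ℂ) : Prop :=
  ∃ K : ℕ, K ≠ 0 ∧ ∃ (ι : Type) (_ : Fintype ι) (ξ : ι → ℂ → ℂ), (∀ i, AnalyticAt ℂ (ξ i) 0) ∧
    ∀ᶠ t in 𝓝 0, P (t ^ K) = ∏ i, (Polynomial.X - Polynomial.C (ξ i t))

variable {P Q : ℂ → Polynomial ℂ}

theorem HasPuiseuxRoots.congr (hP : HasPuiseuxRoots P) (h : P =ᶠ[𝓝 0] Q) : HasPuiseuxRoots Q := by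
  obtain ⟨K, hK, ι, _, ξ, hξ, hP⟩ := hP
  refine ⟨K, hK, ι, inferInstance, ξ, hξ, ?_⟩
  filter_upwards [hP, (tendsto_pow_zero hK).eventually h] with t h1 h2
  rw [← h2, h1]

theorem HasPuiseuxRoots.mul (hP : HasPuiseuxRoots P) (hQ : HasPuiseuxRoots Q) :
    HasPuiseuxRoots fun t => P t * Q t := by
  obtain ⟨K, hK, ι, _, ξ, hξ, hP⟩ := hP
  obtain ⟨L, hL, κ, _, ζ, hζ, hQ⟩ := hQ
  refine ⟨K * L, mul_ne_zero hK hL, ι ⊕ κ, inferInstance,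
    Sum.elim (fun i t => ξ i (t ^ L)) (fun j t => ζ j (t ^ K)), ?_, ?_⟩
  · rintro (i | j)
    · exact analyticAt_comp_pow (hξ i) hL
    · exact analyticAt_comp_pow (hζ j) hK
  · filter_upwards [(tendsto_pow_zero hL).eventually hP, (tendsto_pow_zero hK).eventually hQ]
      with t h1 h2
    rw [Fintype.prod_sum_type]
    simp only [Sum.elim_inl, Sum.elim_inr]
    rw [← h1, ← h2, ← pow_mul, ← pow_mul, mul_comm L K]

theorem HasPuiseuxRoots.of_comp_pow {n : ℕ} (hn : n ≠ 0)
    (hP : HasPuiseuxRoots fun t => P (t ^ n)) : HasPuiseuxRoots P := by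
  obtain ⟨K, hK, ι, _, ξ, hξ, hP⟩ := hP
  exact ⟨K * n, mul_ne_zero hK hn, ι, inferInstance, ξ, hξ, hP.mono fun t h => by rw [pow_mul, ← h]⟩

theorem HasPuiseuxRoots.of_shift {c : ℂ → ℂ} (hc : AnalyticAt ℂ c 0)
    (hP : HasPuiseuxRoots fun t => (P t).comp (Polynomial.X + Polynomial.C (c t))) :
    HasPuiseuxRoots P := by
  obtain ⟨K, hK, ι, _, ξ, hξ, hP⟩ := hP
  refine ⟨K, hK, ι, inferInstance, fun i t => ξ i t + c (t ^ K),
    fun i => (hξ i).fun_add (analyticAt_comp_pow hc hK), hP.mono fun t h => ?_⟩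
  have h2 := congrArg (fun p => Polynomial.comp p (Polynomial.X - Polynomial.C (c (t ^ K)))) h
  simp only [Polynomial.comp_assoc, Polynomial.add_comp, Polynomial.X_comp, Polynomial.C_comp,
    sub_add_cancel, Polynomial.comp_X, Polynomial.prod_comp, Polynomial.sub_comp] at h2
  rw [h2]
  refine Finset.prod_congr rfl fun i _ => ?_
  rw [Polynomial.C_add]; ring

theorem HasPuiseuxRoots.scaleRoots (s : ℕ) (hP : HasPuiseuxRoots P) :
    HasPuiseuxRoots fun t => (P t).scaleRoots (t ^ s) := by
  obtain ⟨K, hK, ι, _, ξ, hξ, hP⟩ := hP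
  refine ⟨K, hK, ι, inferInstance, fun i t => (t ^ K) ^ s * ξ i t,
    fun i => (((analyticAt_id.fun_pow K).fun_pow s)).fun_mul (hξ i), hP.mono fun t h => ?_⟩
  have h2 : ∀ (r : ℂ) (S : Finset ι), (∏ i ∈ S, (Polynomial.X - Polynomial.C (ξ i t))).scaleRoots r
      = ∏ i ∈ S, (Polynomial.X - Polynomial.C (r * ξ i t)) := by
    classical
    intro r S
    induction S using Finset.induction_on with
    | empty => simp
    | insert a S ha ih =>
      rw [Finset.prod_insert ha, Finset.prod_insert ha, Polynomial.mul_scaleRoots_of_noZeroDivisors,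
        ih, Polynomial.X_sub_C_scaleRoots, mul_comm r]
  change (P (t ^ K)).scaleRoots _ = _
  rw [h, h2]

theorem exists_rootSplit {p : Polynomial ℂ} {k : ℕ} (hp : p.Monic) (hk : p.natDegree = k)
    (hk0 : k ≠ 0) (h1 : p.coeff (k - 1) = 0) (hX : p ≠ Polynomial.X ^ k) :
    ∃ (a b : Polynomial ℂ), a.Monic ∧ b.Monic ∧ a.natDegree < k ∧ b.natDegree < k ∧
      IsCoprime a b ∧ p = a * b := by
  have hd : p.degree ≠ 0 := by
    rw [Polynomial.degree_eq_natDegree hp.ne_zero, hk]; exact_mod_cast hk0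
  obtain ⟨r, hr⟩ := Complex.exists_root (f := p) (Polynomial.degree_pos_of_ne_zero_of_nonunit
    hp.ne_zero fun h => hd (Polynomial.isUnit_iff_degree_eq_zero.1 h))
  obtain ⟨b, hb, hbr⟩ := Polynomial.exists_eq_pow_rootMultiplicity_mul_and_not_dvd p hp.ne_zero r
  set n := p.rootMultiplicity r with hn
  have hn0 : 0 < n := (Polynomial.rootMultiplicity_pos hp.ne_zero).2 hr
  have ha : ((Polynomial.X - Polynomial.C r) ^ n).Monic := (Polynomial.monic_X_sub_C r).pow n
  have hbm : b.Monic := ha.of_mul_monic_left (hb ▸ hp)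
  have hdeg : n + b.natDegree = k := by
    rw [← hk, hb, ha.natDegree_mul hbm, Polynomial.natDegree_pow, Polynomial.natDegree_X_sub_C,
      mul_one]
  refine ⟨_, b, ha, hbm, ?_, by omega, ?_, hb⟩
  · rw [Polynomial.natDegree_pow, Polynomial.natDegree_X_sub_C, mul_one]
    rcases Nat.eq_zero_or_pos b.natDegree with h0 | h0
    · exfalso
      have hb1 : b = 1 := hbm.natDegree_eq_zero.1 h0
      have hnk : n = k := by omega
      rw [hb1, mul_one, hnk] at hb
      have h2 : p.nextCoeff = 0 := by
        rw [Polynomial.nextCoeff_of_natDegree_pos (by omega), hk, h1]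
      rw [hb, (Polynomial.monic_X_sub_C r).nextCoeff_pow, Polynomial.nextCoeff_X_sub_C] at h2
      have hr0 : r = 0 := by simpa [hk0] using h2
      rw [hr0] at hb
      exact hX (by simpa using hb)
    · omega
  · refine IsCoprime.pow_left ?_
    exact (Polynomial.irreducible_X_sub_C r).coprime_iff_not_dvd.2 hbr

/-- The Newton–Puiseux theorem: a monic polynomial with analytic coefficients splits after a
ramified base change. -/
theorem hasPuiseuxRoots (k : ℕ) : ∀ {P : ℂ → Polynomial ℂ},
    (∀ t, (P t).Monic ∧ (P t).natDegree = k) → AnalyticFamily P 0 → HasPuiseuxRoots P := by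
  induction k using Nat.strong_induction_on with
  | _ k ih =>
  intro P hP hPa
  rcases Nat.eq_zero_or_pos k with rfl | hk
  · exact ⟨1, one_ne_zero, Empty, inferInstance, fun i _ => i.elim, fun i => i.elim,
      Eventually.of_forall fun t => by simpa using (hP _).1.natDegree_eq_zero.1 (hP _).2⟩
  have split : ∀ {P : ℂ → Polynomial ℂ}, (∀ t, (P t).Monic ∧ (P t).natDegree = k) →
      AnalyticFamily P 0 → (P 0).coeff (k - 1) = 0 → P 0 ≠ Polynomial.X ^ k →
      HasPuiseuxRoots P := by
    intro P hP hPa h1 hX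
    obtain ⟨a, b, ha, hb, hak, hbk, hab, h⟩ := exists_rootSplit (hP 0).1 (hP 0).2 hk.ne' h1 hX
    have hadd : a.natDegree + b.natDegree = k := by
      rw [← (hP 0).2, h, ha.natDegree_mul hb]
    obtain ⟨A, B, hA, hB, hAa, hBa, -, -, hAB⟩ := exists_analytic_factorization
      (fun t => ((hP t).2.trans hadd.symm).le) hPa ha rfl le_rfl hab h
    classical
    let B' : ℂ → Polynomial ℂ := fun t => if P t = A t * B t then B t else
      Polynomial.X ^ b.natDegree
    have hBB' : B =ᶠ[𝓝 0] B' := hAB.mono fun t ht => by simp only [B', if_pos ht]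
    have hB' : ∀ t, (B' t).Monic ∧ (B' t).natDegree = b.natDegree := by
      intro t
      by_cases ht : P t = A t * B t
      · simp only [B', if_pos ht]
        have hm : (B t).Monic := (hA t).1.of_mul_monic_left (ht ▸ (hP t).1)
        refine ⟨hm, ?_⟩
        have := (hP t).2
        rw [ht, (hA t).1.natDegree_mul hm, (hA t).2] at this
        omega
      · simp only [B', if_neg ht]
        exact ⟨Polynomial.monic_X_pow _, Polynomial.natDegree_X_pow _⟩
    have := (ih _ hak hA hAa).mul (ih _ hbk hB' (hBa.congr hBB'))
    refine this.congr ?_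
    filter_upwards [hAB, hBB'] with t h1 h2
    rw [h1, h2]
  have reduced : ∀ {P : ℂ → Polynomial ℂ}, (∀ t, (P t).Monic ∧ (P t).natDegree = k) →
      AnalyticFamily P 0 → (∀ t, (P t).coeff (k - 1) = 0) → HasPuiseuxRoots P := by
    intro P hP hPa h1
    have hPk : ∀ t, (P t).coeff k = 1 := fun t => by
      have := (hP t).1.coeff_natDegree
      rwa [(hP t).2] at this
    by_cases hall : ∀ i : Fin k, ∀ᶠ t in 𝓝 0, (P t).coeff i = 0
    · refine ⟨1, one_ne_zero, Fin k, inferInstance, fun _ _ => 0, fun _ => analyticAt_const, ?_⟩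
      filter_upwards [eventually_all.2 hall] with t ht
      simp only [pow_one, map_zero, sub_zero, Finset.prod_const, Finset.card_univ, Fintype.card_fin]
      ext i
      rw [Polynomial.coeff_X_pow]
      rcases lt_trichotomy i k with h | rfl | h
      · rw [if_neg h.ne]; exact ht ⟨i, h⟩
      · rw [if_pos rfl, hPk]
      · rw [if_neg h.ne']
        exact Polynomial.coeff_eq_zero_of_natDegree_lt ((hP t).2.trans_lt h)
    · let ν : Fin k → ℕ∞ := fun i => analyticOrderAt (fun t => (P t).coeff i) 0
      let w : Fin k → ℕ∞ := fun i => ν i * ((k.factorial / (k - i) : ℕ) : ℕ∞)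
      have : Nonempty (Fin k) := ⟨⟨0, hk⟩⟩
      have hdvd : ∀ i : Fin k, (k.factorial / (k - i)) * (k - i) = k.factorial := fun i =>
        Nat.div_mul_cancel (Nat.dvd_factorial (by omega) (by omega))
      have hpos : ∀ i : Fin k, k.factorial / (k - i) ≠ 0 := fun i h0 => by
        have := hdvd i; rw [h0, zero_mul] at this; exact k.factorial_ne_zero this.symm
      obtain ⟨i₀, hi₀⟩ := Finite.exists_min w
      have htop : w i₀ ≠ ⊤ := by
        rw [not_forall] at hall
        obtain ⟨i, hi⟩ := hall
        have h1 : ν i ≠ ⊤ := fun h => hi (analyticOrderAt_eq_top.1 h)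
        exact ne_top_of_le_ne_top (WithTop.mul_ne_top h1 (ENat.natCast_ne_top _)) (hi₀ i)
      obtain ⟨s, hs⟩ := ENat.ne_top_iff_exists.1 htop
      have hord : ∀ i : Fin k, analyticOrderAt (fun t => (P (t ^ k.factorial)).coeff i) 0 =
          w i * ((k - i : ℕ) : ℕ∞) := fun i => by
        rw [analyticOrderAt_comp_pow (f := fun t => (P t).coeff i) (hPa i) k.factorial_ne_zero]
        simp only [w, ν]
        rw [mul_assoc, ← Nat.cast_mul, hdvd]
      have han : ∀ i : Fin k, AnalyticAt ℂ (fun t => (P (t ^ k.factorial)).coeff i) 0 := fun i =>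
        analyticAt_comp_pow (f := fun t => (P t).coeff i) (hPa i) k.factorial_ne_zero
      have hex : ∀ i : Fin k, ∃ b : ℂ → ℂ, AnalyticAt ℂ b 0 ∧
          (∀ᶠ t in 𝓝 0, (P (t ^ k.factorial)).coeff i = t ^ (s * (k - i)) * b t) := fun i => by
        have : ((s * (k - i) : ℕ) : ℕ∞) ≤
            analyticOrderAt (fun t => (P (t ^ k.factorial)).coeff i) 0 := by
          rw [hord, Nat.cast_mul, hs]
          gcongr
          exact hi₀ i
        simpa using (natCast_le_analyticOrderAt (han i)).1 this
      choose b hba hb using hex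
      let Q : ℂ → Polynomial ℂ := fun t => Polynomial.X ^ k + lowPoly k (fun i => b i t)
      have hlow : ∀ t, (lowPoly k fun i => b i t).degree < (Polynomial.X ^ k : Polynomial ℂ).degree :=
        fun t => by rw [Polynomial.degree_X_pow]; exact degree_lowPoly_lt _ _
      have hQ : ∀ t, (Q t).Monic ∧ (Q t).natDegree = k := fun t =>
        ⟨(Polynomial.monic_X_pow k).add_of_left (hlow t), by
          simp only [Q]
          rw [Polynomial.natDegree_add_eq_left_of_degree_lt (hlow t), Polynomial.natDegree_X_pow]⟩
      have hQc : ∀ t (i : Fin k), (Q t).coeff i = b i t := fun t i => by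
        simp only [Q]
        rw [Polynomial.coeff_add, coeff_lowPoly, Polynomial.coeff_X_pow, if_neg i.2.ne, zero_add]
      have hQa : AnalyticFamily Q 0 := (AnalyticFamily.const _).add
        (AnalyticFamily.lowPoly (analyticAt_pi_iff.2 hba))
      have hPQ : ∀ᶠ t in 𝓝 0, (Q t).scaleRoots (t ^ s) = P (t ^ k.factorial) := by
        filter_upwards [eventually_all.2 hb] with t ht
        ext i
        rw [Polynomial.coeff_scaleRoots, (hQ t).2]
        rcases lt_trichotomy i k with h | rfl | h
        · rw [hQc t ⟨i, h⟩, ht ⟨i, h⟩, ← pow_mul, mul_comm]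
        · rw [hPk, Nat.sub_self, pow_zero, mul_one]
          have := (hQ t).1.coeff_natDegree
          rwa [(hQ t).2] at this
        · rw [Polynomial.coeff_eq_zero_of_natDegree_lt ((hQ t).2.trans_lt h), zero_mul,
            Polynomial.coeff_eq_zero_of_natDegree_lt ((hP _).2.trans_lt h)]
      have hQ1 : (Q 0).coeff (k - 1) = 0 := by
        have hlt : k - 1 < k := by omega
        rw [hQc 0 ⟨k - 1, hlt⟩]
        have h2 : ∀ᶠ t in 𝓝[≠] (0 : ℂ), b ⟨k - 1, hlt⟩ t = 0 := by
          filter_upwards [(hb ⟨k - 1, hlt⟩).filter_mono nhdsWithin_le_nhds,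
            self_mem_nhdsWithin] with t ht ht0
          rw [h1] at ht
          exact (mul_eq_zero.1 ht.symm).resolve_left (pow_ne_zero _ ht0)
        exact ((hba ⟨k - 1, hlt⟩).continuousAt.tendsto.mono_left nhdsWithin_le_nhds).limUnder_eq.symm.trans
          ((tendsto_const_nhds.congr' (h2.mono fun t ht => ht.symm)).limUnder_eq)
      have hQX : Q 0 ≠ Polynomial.X ^ k := by
        intro h0
        have hb0 : b i₀ 0 = 0 := by
          rw [← hQc 0 i₀, h0, Polynomial.coeff_X_pow, if_neg i₀.2.ne]
        have h3 : analyticOrderAt (fun t => (P (t ^ k.factorial)).coeff i₀) 0 =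
            ((s * (k - i₀) : ℕ) : ℕ∞) + analyticOrderAt (b i₀) 0 := by
          rw [analyticOrderAt_congr (hb i₀)]
          refine (analyticOrderAt_mul (analyticAt_id.fun_pow _) (hba i₀)).trans ?_
          rw [analyticOrderAt_pow_id]
        rw [hord, ← hs, ← Nat.cast_mul] at h3
        have h4 : analyticOrderAt (b i₀) 0 = 0 := by
          have h5 : ((s * (k - i₀) : ℕ) : ℕ∞) ≠ ⊤ := ENat.natCast_ne_top _
          exact WithTop.add_left_cancel h5 (h3.symm.trans (add_zero (_ : ℕ∞)).symm)
        exact ((hba i₀).analyticOrderAt_eq_zero.1 h4) hb0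
      exact (((split hQ hQa hQ1 hQX).scaleRoots s).congr hPQ).of_comp_pow k.factorial_ne_zero
  let c : ℂ → ℂ := fun t => -(P t).coeff (k - 1) * (k : ℂ)⁻¹
  have hc : AnalyticAt ℂ c 0 := (hPa (k - 1)).fun_neg.fun_mul analyticAt_const
  have hmon : ∀ t, ((P t).comp (Polynomial.X + Polynomial.C (c t))).Monic ∧
      ((P t).comp (Polynomial.X + Polynomial.C (c t))).natDegree = k := fun t =>
    ⟨(hP t).1.comp_X_add_C _, by rw [Polynomial.natDegree_comp, Polynomial.natDegree_X_add_C,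
      mul_one, (hP t).2]⟩
  refine HasPuiseuxRoots.of_shift hc (reduced hmon ?_ ?_)
  · have : (fun t => (P t).comp (Polynomial.X + Polynomial.C (c t))) = fun t =>
        ∑ i ∈ Finset.range (k + 1), Polynomial.C ((P t).coeff i) *
          (Polynomial.X + Polynomial.C (c t)) ^ i := by
      ext1 t
      rw [Polynomial.comp, Polynomial.eval₂_eq_sum_range, (hP t).2]
    rw [this]
    exact AnalyticFamily.sum _ fun i _ => (AnalyticFamily.C (hPa i)).mul
      (((AnalyticFamily.const _).add (AnalyticFamily.C hc)).pow i)
  · intro t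
    have hdeg : (Polynomial.hasseDeriv (k - 1) (P t)).natDegree < 2 :=
      (Polynomial.natDegree_hasseDeriv_le _ _).trans_lt (by rw [(hP t).2]; omega)
    have hPk := (hP t).1.coeff_natDegree
    rw [(hP t).2] at hPk
    have hk1 : 1 + (k - 1) = k := by omega
    rw [← Polynomial.taylor_apply, Polynomial.taylor_coeff, Polynomial.eval_eq_sum_range' hdeg]
    simp only [Finset.sum_range_succ, Finset.sum_range_zero, Polynomial.hasseDeriv_coeff, hk1, hPk,
      zero_add, Nat.choose_self, Nat.cast_one, one_mul, pow_zero, mul_one, pow_one, c]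
    rw [← Nat.choose_symm (by omega), Nat.sub_sub_self (by omega), Nat.choose_one_right]
    have : (k : ℂ) ≠ 0 := by exact_mod_cast hk.ne'
    field_simp
    ring

end Puiseux

section Cokernel

open PowerSeries

theorem exists_equiv_quotient_X_pow (n : ℕ) :
    Nonempty ((PowerSeries ℂ ⧸ Ideal.span {(X : PowerSeries ℂ) ^ n}) ≃ₗ[ℂ] (Fin n → ℂ)) := by
  let φ : PowerSeries ℂ →ₗ[ℂ] (Fin n → ℂ) := LinearMap.pi fun i => coeff (R := ℂ) (i : ℕ)
  have hφ : Function.Surjective φ := by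
    intro v
    refine ⟨PowerSeries.mk fun i => if h : i < n then v ⟨i, h⟩ else 0, ?_⟩
    ext i
    simp [φ]
  have hk : LinearMap.ker φ = (Ideal.span {(X : PowerSeries ℂ) ^ n}).restrictScalars ℂ := by
    ext f
    rw [LinearMap.mem_ker, Submodule.restrictScalars_mem, Ideal.mem_span_singleton, X_pow_dvd_iff,
      funext_iff]
    exact ⟨fun h i hi => h ⟨i, hi⟩, fun h i => h i i.2⟩
  exact ⟨(Submodule.Quotient.restrictScalarsEquiv ℂ _).symm ≪≫ₗ
    Submodule.quotEquivOfEq _ _ hk.symm ≪≫ₗ φ.quotKerEquivOfSurjective hφ⟩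

theorem span_eq_span_X_pow {a : PowerSeries ℂ} (ha : a ≠ 0) :
    Ideal.span {a} = Ideal.span {(X : PowerSeries ℂ) ^ a.order.toNat} := by
  rw [Ideal.span_singleton_eq_span_singleton]
  refine ⟨(Unit_of_divided_by_X_pow_order a)⁻¹, ?_⟩
  rw [Units.mul_inv_eq_iff_eq_mul, Unit_of_divided_by_X_pow_order_nonzero ha,
    X_pow_order_mul_divXPowOrder]

theorem finite_quotient_span {a : PowerSeries ℂ} (ha : a ≠ 0) :
    Module.Finite ℂ (PowerSeries ℂ ⧸ Ideal.span {a}) := by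
  rw [span_eq_span_X_pow ha]
  obtain ⟨e⟩ := exists_equiv_quotient_X_pow a.order.toNat
  exact Module.Finite.equiv e.symm

theorem finrank_quotient_span {a : PowerSeries ℂ} (ha : a ≠ 0) :
    Module.finrank ℂ (PowerSeries ℂ ⧸ Ideal.span {a}) = a.order.toNat := by
  rw [span_eq_span_X_pow ha]
  obtain ⟨e⟩ := exists_equiv_quotient_X_pow a.order.toNat
  rw [e.finrank_eq, Module.finrank_fin_fun]

theorem toNat_order_mul {a b : PowerSeries ℂ} (ha : a ≠ 0) (hb : b ≠ 0) :
    (a * b).order.toNat = a.order.toNat + b.order.toNat := by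
  rw [order_mul, ENat.toNat_add (by simpa [order_eq_top]) (by simpa [order_eq_top])]

theorem toNat_order_prod {ι : Type*} (s : Finset ι) (a : ι → PowerSeries ℂ)
    (ha : ∀ i ∈ s, a i ≠ 0) : (∏ i ∈ s, a i).order.toNat = ∑ i ∈ s, (a i).order.toNat := by
  classical
  induction s using Finset.induction_on with
  | empty => simp
  | insert i s hi ih =>
    rw [Finset.prod_insert hi, Finset.sum_insert hi, toNat_order_mul, ih]
    · exact fun j hj => ha j (Finset.mem_insert_of_mem hj)
    · exact ha i (Finset.mem_insert_self _ _)
    · exact Finset.prod_ne_zero_iff.2 fun j hj => ha j (Finset.mem_insert_of_mem hj)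

theorem order_eq_of_associated {a b : PowerSeries ℂ} (h : Associated a b) : a.order = b.order := by
  obtain ⟨u, rfl⟩ := h
  rw [order_mul, order_zero_of_unit u.isUnit, add_zero]

variable {ι M M' : Type*} [Fintype ι] [DecidableEq ι] [AddCommGroup M] [AddCommGroup M']
  [Module (PowerSeries ℂ) M] [Module (PowerSeries ℂ) M'] [Module ℂ M']
  [IsScalarTower ℂ (PowerSeries ℂ) M']

theorem finrank_quotient_range (b : Module.Basis ι (PowerSeries ℂ) M)
    (b' : Module.Basis ι (PowerSeries ℂ) M') (φ : M →ₗ[PowerSeries ℂ] M')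
    (hφ : (LinearMap.toMatrix b b' φ).det ≠ 0) :
    Module.finrank ℂ (M' ⧸ LinearMap.range φ) = (LinearMap.toMatrix b b' φ).det.order.toNat := by
  have hinj : Function.Injective φ := by
    rw [← LinearMap.ker_eq_bot, LinearMap.ker_eq_bot']
    intro x hx
    have h1 : (LinearMap.toMatrix b b' φ).mulVec (b.repr x) = 0 := by
      rw [LinearMap.toMatrix_mulVec_repr, hx, map_zero]; rfl
    have := Matrix.eq_zero_of_mulVec_eq_zero hφ h1
    exact b.repr.map_eq_zero_iff.1 (DFunLike.coe_injective this)
  let e := LinearEquiv.ofInjective φ hinj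
  have hr : Module.finrank (PowerSeries ℂ) (LinearMap.range φ) = Module.finrank (PowerSeries ℂ) M' := by
    rw [← e.finrank_eq, Module.finrank_eq_card_basis b, Module.finrank_eq_card_basis b']
  have hc0 := Submodule.smithNormalFormCoeffs_ne_zero b' hr
  have := fun i => finite_quotient_span (hc0 i)
  rw [Submodule.finrank_quotient_eq_sum ℂ b' hr]
  simp_rw [finrank_quotient_span (hc0 _)]
  rw [← toNat_order_prod _ _ fun i _ => hc0 i]
  congr 1
  apply order_eq_of_associated
  set t := Submodule.smithNormalFormTopBasis b' hr
  set s := Submodule.smithNormalFormBotBasis b' hr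
  have h2 : LinearMap.toMatrix (s.map e.symm) t φ =
      Matrix.diagonal (Submodule.smithNormalFormCoeffs b' hr) := by
    ext i j
    rw [LinearMap.toMatrix_apply, Matrix.diagonal_apply]
    have : φ ((s.map e.symm) j) = s j := by
      have : e ((s.map e.symm) j) = s j := by simp
      rw [← this]; rfl
    rw [this, Submodule.smithNormalFormBotBasis_def]
    rw [map_smul, Module.Basis.repr_self]
    simp only [Finsupp.smul_apply, Finsupp.single_apply, smul_eq_mul]
    rcases eq_or_ne i j with rfl | h
    · simp
    · rw [if_neg h, if_neg h.symm, mul_zero]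
  rw [← Matrix.det_diagonal, ← h2,
    ← basis_toMatrix_mul_linearMap_toMatrix_mul_basis_toMatrix (b := s.map e.symm) (b' := b) (c := t) (c' := b'),
    Matrix.det_mul, Matrix.det_mul]
  have u1 : IsUnit (t.toMatrix b').det := t.isUnit_det b'
  have u2 : IsUnit (b.toMatrix (s.map e.symm)).det := b.isUnit_det _
  exact (associated_mul_unit_left _ _ u2).trans (associated_unit_mul_left _ _ u1)

end Cokernel

section Resultant

open Polynomial

theorem nonempty_quotient_sylvesterMap_equiv {A : Type*} [CommRing A] [IsDomain A] {P u : A[X]}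
    (hP : P.Monic) {m n : ℕ} (hm : m = P.natDegree) (hn : n = u.natDegree) :
    Nonempty ((degreeLT A (m + n) ⧸ LinearMap.range (sylvesterMap P u hm.ge hn.ge)) ≃ₗ[A]
      A[X] ⧸ Ideal.span {P, u}) := by
  set φ := sylvesterMap P u hm.ge hn.ge
  let J : Ideal A[X] := Ideal.span {P, u}
  let ψ : degreeLT A (m + n) →ₗ[A] A[X] ⧸ J :=
    (Ideal.Quotient.mkₐ A J).toLinearMap ∘ₗ (degreeLT A (m + n)).subtype
  have hmem : ∀ f : A[X], f ∈ J ↔ ∃ a b, a * P + b * u = f := fun f => Ideal.mem_span_pair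
  have hsurj : Function.Surjective ψ := by
    intro q
    obtain ⟨f, rfl⟩ := Ideal.Quotient.mk_surjective q
    refine ⟨⟨f %ₘ P, ?_⟩, ?_⟩
    · rw [mem_degreeLT]
      refine (degree_modByMonic_lt f hP).trans_le ?_
      rw [degree_eq_natDegree hP.ne_zero, ← hm]
      exact_mod_cast Nat.le_add_right _ _
    · change Ideal.Quotient.mk J (f %ₘ P) = Ideal.Quotient.mk J f
      rw [Ideal.Quotient.eq, hmem]
      refine ⟨-(f /ₘ P), 0, ?_⟩
      linear_combination -(modByMonic_add_div f P)
  have hker : LinearMap.ker ψ = LinearMap.range φ := by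
    ext ⟨f, hf⟩
    rw [LinearMap.mem_ker]
    have h0 : ψ ⟨f, hf⟩ = Ideal.Quotient.mk J f := rfl
    rw [h0, Ideal.Quotient.eq_zero_iff_mem, hmem]
    constructor
    · rintro ⟨a, b, hab⟩
      have hb : (b %ₘ P).degree < m := by
        rw [hm, ← degree_eq_natDegree hP.ne_zero]; exact degree_modByMonic_lt b hP
      have hf' : f = P * (a + (b /ₘ P) * u) + u * (b %ₘ P) := by
        linear_combination -hab - u * (modByMonic_add_div b P)
      have hub : (u * (b %ₘ P)).degree < (m + n : ℕ) := by
        by_cases hu : u = 0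
        · rw [hu, zero_mul, degree_zero]; exact WithBot.bot_lt_coe _
        · rw [degree_mul, degree_eq_natDegree hu, ← hn, add_comm, Nat.cast_add]
          exact WithBot.add_lt_add_right WithBot.coe_ne_bot hb
      have ha : (a + (b /ₘ P) * u).degree < n := by
        have h1 : (P * (a + (b /ₘ P) * u)).degree < (m + n : ℕ) := by
          rw [show P * (a + (b /ₘ P) * u) = f - u * (b %ₘ P) by rw [hf']; ring]
          exact (degree_sub_le _ _).trans_lt (max_lt (mem_degreeLT.1 hf) hub)
        rw [degree_mul, degree_eq_natDegree hP.ne_zero, ← hm, Nat.cast_add] at h1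
        exact lt_of_add_lt_add_left h1
      refine ⟨(⟨b %ₘ P, mem_degreeLT.2 hb⟩, ⟨_, mem_degreeLT.2 ha⟩), ?_⟩
      apply Subtype.ext
      rw [sylvesterMap_apply_coe]
      exact hf'.symm
    · rintro ⟨⟨a, b⟩, hab⟩
      have := congrArg Subtype.val hab
      rw [sylvesterMap_apply_coe] at this
      have h3 : P * b.1 + u * a.1 = f := this
      exact ⟨b, a, by rw [← h3]; ring⟩
  exact ⟨Submodule.quotEquivOfEq _ _ hker.symm ≪≫ₗ ψ.quotKerEquivOfSurjective hsurj⟩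

theorem finrank_quotient_pair {P u : (PowerSeries ℂ)[X]} (hP : P.Monic) (h : P.resultant u ≠ 0) :
    Module.finrank ℂ ((PowerSeries ℂ)[X] ⧸ Ideal.span {P, u}) = (P.resultant u).order.toNat := by
  obtain ⟨e⟩ := nonempty_quotient_sylvesterMap_equiv hP rfl (rfl : u.natDegree = u.natDegree)
  rw [← (e.restrictScalars ℂ).finrank_eq]
  have hdet := congrArg Matrix.det (toMatrix_sylvesterMap' P u le_rfl le_rfl)
  have key := finrank_quotient_range _ _ (sylvesterMap P u le_rfl le_rfl) (hdet.trans_ne h)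
  rw [hdet] at key
  exact key

end Resultant

section Weierstrass

open Polynomial

theorem exists_quotient_pair_equiv {A : Type*} [CommRing A] {I : Ideal A} [IsAdicComplete I A]
    {P u : A[X]} (hP : P.IsDistinguishedAt I) :
    ∃ e : (A[X] ⧸ Ideal.span {P, u}) ≃+*
      PowerSeries A ⧸ Ideal.span {(P : PowerSeries A), (u : PowerSeries A)},
      ∀ f : A[X], e (Ideal.Quotient.mk _ f) = Ideal.Quotient.mk _ (f : PowerSeries A) := by
  have hmemS : ∀ f : PowerSeries A, f ∈ Ideal.span {(P : PowerSeries A), (u : PowerSeries A)} ↔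
    ∃ a b, a * P + b * u = f := fun f => Ideal.mem_span_pair
  set J := Ideal.span {(P : PowerSeries A), (u : PowerSeries A)}
  have hred : ∀ f : PowerSeries A, ∃ (r : A[X]) (q : PowerSeries A), f = q * P + r := by
    intro f
    obtain ⟨r, hr⟩ := hP.algEquivQuotient.surjective (Ideal.Quotient.mk _ f)
    obtain ⟨r, rfl⟩ := Ideal.Quotient.mk_surjective r
    have h1 : Ideal.Quotient.mk (Ideal.span {(P : PowerSeries A)}) (r : PowerSeries A) =
      Ideal.Quotient.mk _ f := hr
    rw [eq_comm, Ideal.Quotient.eq, Ideal.mem_span_singleton'] at h1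
    obtain ⟨q, hq⟩ := h1
    exact ⟨r, q, by rw [hq]; ring⟩
  have hdvd : ∀ f : A[X], (P : PowerSeries A) ∣ f → P ∣ f := by
    intro f hf
    rw [← Ideal.mem_span_singleton, ← Ideal.Quotient.eq_zero_iff_mem] at hf ⊢
    apply hP.algEquivQuotient.injective
    rw [map_zero]
    exact hf
  let ψ : A[X] →+* PowerSeries A ⧸ J :=
    (Ideal.Quotient.mk J).comp Polynomial.coeToPowerSeries.ringHom
  have hψ : ∀ f : A[X], ψ f = Ideal.Quotient.mk J (f : PowerSeries A) := fun f => rfl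
  have hsurj : Function.Surjective ψ := by
    intro q
    obtain ⟨f, rfl⟩ := Ideal.Quotient.mk_surjective q
    obtain ⟨r, q, rfl⟩ := hred f
    refine ⟨r, ?_⟩
    rw [hψ, Ideal.Quotient.eq, hmemS]
    exact ⟨-q, 0, by ring⟩
  have hker : RingHom.ker ψ = Ideal.span {P, u} := by
    ext f
    rw [RingHom.mem_ker, hψ, Ideal.Quotient.eq_zero_iff_mem, hmemS, Ideal.mem_span_pair]
    constructor
    · rintro ⟨a, b, h⟩
      obtain ⟨r, q, rfl⟩ := hred b
      obtain ⟨s, hs⟩ := hdvd (f - r * u) ⟨a + q * u, by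
        rw [Polynomial.coe_sub, Polynomial.coe_mul, ← h]; ring⟩
      exact ⟨s, r, by linear_combination -hs⟩
    · rintro ⟨a, b, rfl⟩
      exact ⟨a, b, by simp⟩
  exact ⟨(Ideal.quotEquivOfEq hker.symm).trans (RingHom.quotientKerEquivOfSurjective hsurj), fun f => rfl⟩

theorem finrank_quotient_powerSeries {P u : (PowerSeries ℂ)[X]}
    (hP : P.IsDistinguishedAt (Ideal.span {(PowerSeries.X : PowerSeries ℂ)}))
    (h : P.resultant u ≠ 0) {p q : PowerSeries (PowerSeries ℂ)}
    (hp : Associated p P) (hq : q = u) :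
    Module.finrank ℂ (PowerSeries (PowerSeries ℂ) ⧸ Ideal.span {p, q}) =
      (P.resultant u).order.toNat := by
  obtain ⟨e, he⟩ := exists_quotient_pair_equiv (u := u) hP
  have hs : Ideal.span {p, q} = Ideal.span {(P : PowerSeries (PowerSeries ℂ)),
      (u : PowerSeries (PowerSeries ℂ))} := by
    rw [Ideal.span_insert, Ideal.span_insert, Ideal.span_singleton_eq_span_singleton.2 hp, hq]
  rw [hs, ← finrank_quotient_pair hP.monic h]
  let e' : ((PowerSeries ℂ)[X] ⧸ Ideal.span {P, u}) ≃ₗ[ℂ] PowerSeries (PowerSeries ℂ) ⧸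
      Ideal.span {(P : PowerSeries (PowerSeries ℂ)), (u : PowerSeries (PowerSeries ℂ))} :=
    { e with
      map_smul' := by
        intro c q
        obtain ⟨f, rfl⟩ := Ideal.Quotient.mk_surjective q
        have h1 : ((c • f : (PowerSeries ℂ)[X]) : PowerSeries (PowerSeries ℂ)) = c • (f : PowerSeries (PowerSeries ℂ)) := by
          rw [Algebra.smul_def, Algebra.smul_def, Polynomial.coe_mul, MvPowerSeries.algebraMap_apply,
            Polynomial.algebraMap_apply, Polynomial.coe_C]
          rfl
        change e (Ideal.Quotient.mk _ (c • f)) = c • e (Ideal.Quotient.mk _ f)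
        rw [he, he, h1]
        rfl }
  exact e'.finrank_eq.symm

end Weierstrass

section Coordinates

local notation "x₀" => (MvPowerSeries.X 0 : MvPowerSeries (Fin 2) ℂ)
local notation "x₁" => (MvPowerSeries.X 1 : MvPowerSeries (Fin 2) ℂ)

theorem hasSubst_shear (a : ℂ) : MvPowerSeries.HasSubst ![x₀, MvPowerSeries.C a * x₀ + x₁] :=
  MvPowerSeries.hasSubst_of_constantCoeff_zero (by intro i; fin_cases i <;> simp)

/-- The linear substitution `(x₀, x₁) ↦ (x₀, a x₀ + x₁)` on formal power series. -/
noncomputable def shear (a : ℂ) : MvPowerSeries (Fin 2) ℂ →ₐ[ℂ] MvPowerSeries (Fin 2) ℂ :=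
  MvPowerSeries.substAlgHom (hasSubst_shear a)

theorem shear_X_zero (a : ℂ) : shear a x₀ = x₀ := by
  rw [shear, MvPowerSeries.substAlgHom_X]; rfl

theorem shear_X_one (a : ℂ) : shear a x₁ = MvPowerSeries.C a * x₀ + x₁ := by
  rw [shear, MvPowerSeries.substAlgHom_X]; rfl

theorem shear_shear (a : ℂ) (f) : shear a (shear (-a) f) = f := by
  unfold shear
  rw [MvPowerSeries.substAlgHom_comp_substAlgHom_apply (hasSubst_shear (-a)) (hasSubst_shear a)]
  have h : (fun s => MvPowerSeries.substAlgHom (hasSubst_shear a)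
      (![x₀, MvPowerSeries.C (-a) * x₀ + x₁] s)) = MvPowerSeries.X := by
    funext s
    have hC : ∀ r : ℂ, (MvPowerSeries.C r : MvPowerSeries (Fin 2) ℂ) = algebraMap ℂ _ r :=
      fun _ => rfl
    have h0 := shear_X_zero a
    have h1 := shear_X_one a
    unfold shear at h0 h1
    fin_cases s
    · simpa using h0
    · simp only [hC, map_neg] at h1 ⊢
      change MvPowerSeries.substAlgHom (hasSubst_shear a) (-(algebraMap ℂ _ a) * x₀ + x₁) = x₁
      rw [map_add, map_mul, map_neg, AlgHom.commutes, h0]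
      exact (congrArg _ h1).trans (by ring)
  rw [MvPowerSeries.substAlgHom_apply, h, MvPowerSeries.subst_self, id]

/-- The linear substitution `(x₀, x₁) ↦ (x₀, a x₀ + x₁)` as an automorphism. -/
noncomputable def shearEquiv (a : ℂ) : MvPowerSeries (Fin 2) ℂ ≃ₐ[ℂ] MvPowerSeries (Fin 2) ℂ :=
  AlgEquiv.ofAlgHom (shear a) (shear (-a)) (AlgHom.ext (shear_shear a))
    (AlgHom.ext fun f => by simpa using shear_shear (-a) f)

/-- Power series in `x₀, x₁` as power series in `x₀` over power series in `x₁`. -/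
noncomputable def toIterated : MvPowerSeries (Fin 2) ℂ ≃ₐ[ℂ] PowerSeries (PowerSeries ℂ) :=
  (MvPowerSeries.renameEquiv ℂ
    ((finSuccEquiv' (0 : Fin 2)).trans (Equiv.optionCongr (Equiv.equivPUnit.{1,1} (Fin 1))))).trans
    (MvPowerSeries.optionEquivLeft Unit ℂ)

/-- Power series in `x₀, x₁` as power series in `x` over power series in `y`,
where `x₀ = x` and `x₁ = a x + y`. -/
noncomputable def coordEquiv (a : ℂ) : MvPowerSeries (Fin 2) ℂ ≃ₐ[ℂ] PowerSeries (PowerSeries ℂ) :=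
  (shearEquiv a).trans toIterated

theorem toIterated_X_zero : toIterated x₀ = PowerSeries.X := by
  rw [toIterated, AlgEquiv.trans_apply]
  exact (congrArg _ (MvPowerSeries.rename_X _ _)).trans (MvPowerSeries.optionEquivLeft_X_none)

theorem toIterated_X_one : toIterated x₁ = PowerSeries.C PowerSeries.X := by
  rw [toIterated, AlgEquiv.trans_apply]
  exact (congrArg _ (MvPowerSeries.rename_X _ _)).trans (MvPowerSeries.optionEquivLeft_X_some _)

theorem coordEquiv_X_zero (a : ℂ) : coordEquiv a x₀ = PowerSeries.X := by
  rw [← toIterated_X_zero]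
  exact congrArg toIterated (shear_X_zero a)

theorem coordEquiv_C (a r : ℂ) : coordEquiv a (MvPowerSeries.C r) =
    PowerSeries.C (PowerSeries.C r) :=
  ((coordEquiv a).commutes r).trans (MvPowerSeries.algebraMap_apply (R := ℂ) (A := PowerSeries ℂ))

theorem coordEquiv_X_one (a : ℂ) : coordEquiv a x₁ =
    PowerSeries.C (PowerSeries.C a) * PowerSeries.X + PowerSeries.C PowerSeries.X := by
  have h : coordEquiv a x₁ = toIterated (MvPowerSeries.C a * x₀ + x₁) :=
    congrArg toIterated (shear_X_one a)
  rw [h, map_add, map_mul, toIterated_X_zero, toIterated_X_one]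
  congr 2
  exact (toIterated.commutes a).trans
    (MvPowerSeries.algebraMap_apply (R := ℂ) (A := PowerSeries ℂ))

/-- Polynomials in `x₀, x₁` as polynomials in `x` over power series in `y`,
where `x₀ = x` and `x₁ = a x + y`. -/
noncomputable def coordPoly (a : ℂ) : MvPolynomial (Fin 2) ℂ →ₐ[ℂ] Polynomial (PowerSeries ℂ) :=
  MvPolynomial.aeval ![Polynomial.X,
    Polynomial.C (PowerSeries.C a) * Polynomial.X + Polynomial.C PowerSeries.X]

theorem coordEquiv_coe (a : ℂ) (h : MvPolynomial (Fin 2) ℂ) :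
    coordEquiv a (h : MvPowerSeries (Fin 2) ℂ) = (coordPoly a h : PowerSeries (PowerSeries ℂ)) := by
  induction h using MvPolynomial.induction_on with
  | C r =>
    rw [MvPolynomial.coe_C, coordEquiv_C]
    have : coordPoly a (MvPolynomial.C r) = Polynomial.C (PowerSeries.C r) :=
      (coordPoly a).commutes r
    rw [this, Polynomial.coe_C]
  | add p q hp hq => rw [MvPolynomial.coe_add, map_add, hp, hq, map_add, Polynomial.coe_add]
  | mul_X p i hp =>
    rw [MvPolynomial.coe_mul, map_mul, hp, map_mul, Polynomial.coe_mul, MvPolynomial.coe_X]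
    congr 1
    fin_cases i
    · simpa [coordPoly] using coordEquiv_X_zero a
    · simpa [coordPoly] using coordEquiv_X_one a

theorem finrank_quotient_coordEquiv (a : ℂ) (p q : MvPowerSeries (Fin 2) ℂ) :
    Module.finrank ℂ (MvPowerSeries (Fin 2) ℂ ⧸ Ideal.span {p, q}) =
      Module.finrank ℂ (PowerSeries (PowerSeries ℂ) ⧸
        Ideal.span {coordEquiv a p, coordEquiv a q}) := by
  have h : Ideal.span {coordEquiv a p, coordEquiv a q} =
      (Ideal.span {p, q}).map (coordEquiv a : MvPowerSeries (Fin 2) ℂ →+* _) := by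
    rw [Ideal.map_span, Set.image_pair]; rfl
  exact (Ideal.quotientEquivAlg _ _ (coordEquiv a) h).toLinearEquiv.finrank_eq

end Coordinates

section Germs

open Filter Topology

/-- Functions on `ℂ` that are analytic at the origin. -/
def Germ : Subring (ℂ → ℂ) where
  carrier := {f | AnalyticAt ℂ f 0}
  mul_mem' hf hg := hf.mul hg
  one_mem' := analyticAt_const
  add_mem' hf hg := hf.add hg
  zero_mem' := analyticAt_const
  neg_mem' hf := hf.neg

/-- Evaluation of a germ at a point. -/
def germEval (t : ℂ) : Germ →+* ℂ := (Pi.evalRingHom (fun _ => ℂ) t).comp Germ.subtype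

theorem germEval_apply (t : ℂ) (f : Germ) : germEval t f = f.1 t := rfl

/-- The Taylor series at the origin. -/
noncomputable def taylor : Germ →+* PowerSeries ℂ where
  toFun f := PowerSeries.mk fun n => iteratedDeriv n f.1 0 / n.factorial
  map_one' := by
    ext n
    rw [PowerSeries.coeff_mk, PowerSeries.coeff_one]
    change iteratedDeriv n (fun _ => (1 : ℂ)) 0 / _ = _
    rw [iteratedDeriv_const]
    split_ifs with h <;> simp [h]
  map_zero' := by
    ext n
    rw [PowerSeries.coeff_mk]
    change iteratedDeriv n (fun _ => (0 : ℂ)) 0 / _ = _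
    rw [iteratedDeriv_const]
    simp
  map_add' f g := by
    ext n
    simp only [PowerSeries.coeff_mk, map_add]
    change iteratedDeriv n (f.1 + g.1) 0 / _ = _
    rw [iteratedDeriv_add f.2.contDiffAt g.2.contDiffAt, add_div]
  map_mul' f g := by
    ext n
    rw [PowerSeries.coeff_mk, PowerSeries.coeff_mul]
    change iteratedDeriv n (f.1 * g.1) 0 / _ = _
    rw [iteratedDeriv_mul f.2.contDiffAt g.2.contDiffAt, Finset.sum_div,
      Finset.Nat.sum_antidiagonal_eq_sum_range_succ_mk]
    refine Finset.sum_congr rfl fun i hi => ?_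
    simp only [PowerSeries.coeff_mk]
    have hi' : i ≤ n := Nat.lt_succ_iff.1 (Finset.mem_range.1 hi)
    rw [Nat.cast_choose ℂ hi']
    have h1 := Nat.factorial_ne_zero
    field_simp [h1]

theorem coeff_taylor (f : Germ) (n : ℕ) :
    PowerSeries.coeff n (taylor f) = iteratedDeriv n f.1 0 / n.factorial :=
  PowerSeries.coeff_mk n (fun n => iteratedDeriv n f.1 0 / n.factorial)

theorem taylor_congr {f g : Germ} (h : f.1 =ᶠ[𝓝 0] g.1) : taylor f = taylor g := by
  ext n
  rw [coeff_taylor, coeff_taylor, h.iteratedDeriv_eq]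

theorem constantCoeff_taylor (f : Germ) : PowerSeries.constantCoeff (taylor f) = f.1 0 := by
  rw [← PowerSeries.coeff_zero_eq_constantCoeff_apply, coeff_taylor]
  simp

/-- A constant germ. -/
def constGerm : ℂ →+* Germ where
  toFun c := ⟨fun _ => c, analyticAt_const⟩
  map_one' := rfl
  map_zero' := rfl
  map_add' _ _ := rfl
  map_mul' _ _ := rfl

theorem taylor_constGerm (c : ℂ) : taylor (constGerm c) = PowerSeries.C c := by
  ext n
  rw [coeff_taylor, PowerSeries.coeff_C]
  change iteratedDeriv n (fun _ => c) 0 / _ = _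
  rw [iteratedDeriv_const]
  split_ifs with h <;> simp [h]

/-- The coordinate germ. -/
def idGerm : Germ := ⟨fun t => t, analyticAt_id⟩

theorem taylor_idGerm : taylor idGerm = PowerSeries.X := by
  ext n
  rw [coeff_taylor, PowerSeries.coeff_X]
  change iteratedDeriv n (fun t => t) 0 / _ = _
  rw [iteratedDeriv_fun_id_zero]
  split_ifs with h <;> simp [h]

theorem order_taylor (f : Germ) : (taylor f).order = analyticOrderAt f.1 0 := by
  by_cases h : analyticOrderAt f.1 0 = ⊤
  · rw [h, PowerSeries.order_eq_top, ← map_zero taylor]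
    exact taylor_congr (analyticOrderAt_eq_top.1 h)
  · obtain ⟨g, hg, hg0, hfg⟩ := (f.2.analyticOrderAt_ne_top).1 h
    have h1 : taylor f = taylor (idGerm ^ analyticOrderNatAt f.1 0 * ⟨g, hg⟩) := by
      refine taylor_congr (hfg.mono fun z hz => ?_)
      rw [hz]
      simp [idGerm]
    rw [h1, map_mul, map_pow, taylor_idGerm, PowerSeries.order_mul, PowerSeries.order_X_pow]
    have h2 : (taylor ⟨g, hg⟩).order = 0 := by
      apply PowerSeries.order_zero_of_unit
      rw [PowerSeries.isUnit_iff_constantCoeff, constantCoeff_taylor]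
      exact hg0.isUnit
    rw [h2, add_zero, Nat.cast_analyticOrderNatAt h]

end Germs

section Factor

open Filter Topology

/-- `h = P * Q` with `P` a Weierstrass polynomial and `Q` a unit at the origin. -/
structure IsWeierstrass (h P Q : Polynomial Germ) : Prop where
  monic : P.Monic
  map_zero : P.map (germEval 0) = Polynomial.X ^ P.natDegree
  unit : germEval 0 (Q.coeff 0) ≠ 0
  eventually_eq : ∀ᶠ t in 𝓝 0, h.map (germEval t) = P.map (germEval t) * Q.map (germEval t)

theorem map_taylor_eq {p q : Polynomial Germ}
    (h : ∀ᶠ t in 𝓝 0, p.map (germEval t) = q.map (germEval t)) : p.map taylor = q.map taylor := by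
  ext1 n
  rw [Polynomial.coeff_map, Polynomial.coeff_map]
  refine taylor_congr (h.mono fun t ht => ?_)
  have h1 := congrArg (Polynomial.coeff · n) ht
  simp only [Polynomial.coeff_map] at h1
  exact h1

theorem IsWeierstrass.map_taylor {h P Q : Polynomial Germ} (H : IsWeierstrass h P Q) :
    h.map taylor = P.map taylor * Q.map taylor := by
  rw [← Polynomial.map_mul]
  exact map_taylor_eq (H.eventually_eq.mono fun t ht => by rw [ht, Polynomial.map_mul])

theorem IsWeierstrass.isDistinguishedAt {h P Q : Polynomial Germ} (H : IsWeierstrass h P Q) :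
    (P.map taylor).IsDistinguishedAt (Ideal.span {(PowerSeries.X : PowerSeries ℂ)}) where
  monic := H.monic.map _
  mem := by
    intro n hn
    rw [H.monic.natDegree_map] at hn
    rw [Polynomial.coeff_map, Ideal.mem_span_singleton, PowerSeries.X_dvd_iff, constantCoeff_taylor]
    have := congrArg (Polynomial.coeff · n) H.map_zero
    simp only [Polynomial.coeff_map, Polynomial.coeff_X_pow, hn.ne, if_false] at this
    exact this

/-- Lift a family of polynomials with analytic coefficients. -/
theorem exists_lift_family {A : ℂ → Polynomial ℂ} {n : ℕ} (hA : ∀ t, (A t).natDegree ≤ n)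
    (hAa : AnalyticFamily A 0) :
    ∃ P : Polynomial Germ, P.natDegree ≤ n ∧ ∀ t, P.map (germEval t) = A t := by
  refine ⟨∑ i ∈ Finset.range (n + 1), Polynomial.monomial i ⟨_, hAa i⟩, ?_, fun t => ?_⟩
  · refine Polynomial.natDegree_sum_le_of_forall_le _ _ fun i hi => ?_
    exact (Polynomial.natDegree_monomial_le _).trans (Nat.lt_succ_iff.1 (Finset.mem_range.1 hi))
  · rw [Polynomial.map_sum]
    conv_rhs => rw [(A t).as_sum_range' (n + 1) (Nat.lt_succ_iff.2 (hA t))]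
    exact Finset.sum_congr rfl fun i _ => by rw [Polynomial.map_monomial]; rfl

theorem analyticFamily_map (h : Polynomial Germ) : AnalyticFamily (fun t => h.map (germEval t)) 0 := by
  intro i
  simp only [Polynomial.coeff_map]
  exact (h.coeff i).2

theorem exists_isWeierstrass {h : Polynomial Germ} (h0 : h.map (germEval 0) ≠ 0) :
    ∃ P Q, IsWeierstrass h P Q ∧ P.natDegree = (h.map (germEval 0)).rootMultiplicity 0 := by
  set k := (h.map (germEval 0)).rootMultiplicity 0 with hk
  obtain ⟨b, hb, hb0⟩ := Polynomial.exists_eq_pow_rootMultiplicity_mul_and_not_dvd _ h0 0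
  rw [Polynomial.C_0, sub_zero, ← hk] at hb
  rw [Polynomial.C_0, sub_zero, Polynomial.X_dvd_iff] at hb0
  have hcop : IsCoprime (Polynomial.X ^ k) b := by
    apply IsCoprime.pow_left
    refine (Polynomial.irreducible_X.coprime_iff_not_dvd).2 ?_
    rwa [Polynomial.X_dvd_iff]
  obtain ⟨A, B, hA, hB, hAa, hBa, hA0, hB0, hAB⟩ :=
    exists_analytic_factorization (k := k) (m := max h.natDegree b.natDegree) (p := fun t => h.map (germEval t))
      (e := 0) (fun t => Polynomial.natDegree_map_le.trans ((le_max_left _ _).trans (Nat.le_add_left _ _)))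
      (analyticFamily_map h) (Polynomial.monic_X_pow k) (Polynomial.natDegree_X_pow k)
      (le_max_right _ _) hcop hb
  obtain ⟨P, hP, hPA⟩ := exists_lift_family (fun t => (hA t).2.le) hAa
  obtain ⟨Q, hQ, hQB⟩ := exists_lift_family hB hBa
  have hPk : P.coeff k = 1 := by
    apply Subtype.ext
    funext t
    have := congrArg (Polynomial.coeff · k) (hPA t)
    rw [Polynomial.coeff_map] at this
    refine Eq.trans this ?_
    conv_lhs => rw [← (hA t).2]
    exact (hA t).1
  have hd : P.natDegree = k :=
    le_antisymm hP (Polynomial.le_natDegree_of_ne_zero (by rw [hPk]; exact one_ne_zero))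
  refine ⟨P, Q, ⟨?_, ?_, ?_, ?_⟩, hd⟩
  · rw [Polynomial.Monic, Polynomial.leadingCoeff, hd, hPk]
  · rw [hPA, hA0, hd]
  · have := congrArg (Polynomial.coeff · 0) (hQB 0)
    rw [Polynomial.coeff_map] at this
    rw [this, hB0]
    exact hb0
  · exact hAB.mono fun t ht => by rw [hPA, hQB]; exact ht

end Factor

section MonicResultant

open Polynomial

variable {A B : Type*} [CommRing A] [CommRing B] {P u v w : A[X]}

theorem resultant_eq_of_natDegree_le (hP : P.Monic) {n : ℕ} (hn : u.natDegree ≤ n) :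
    P.resultant u P.natDegree n = P.resultant u := by
  obtain ⟨k, rfl⟩ := Nat.exists_eq_add_of_le hn
  rw [resultant_add_right_deg _ _ _ _ _ le_rfl, hP.coeff_natDegree, one_pow, one_mul]

theorem resultant_mul_of_monic (hP : P.Monic) :
    P.resultant (u * v) = P.resultant u * P.resultant v := by
  rw [← resultant_eq_of_natDegree_le hP natDegree_mul_le, resultant_mul_right _ _ _ _ le_rfl]

theorem resultant_one_of_monic (hP : P.Monic) : P.resultant 1 = 1 := by
  rw [resultant_one_right, hP.coeff_natDegree, one_pow]

theorem resultant_add_mul_of_monic (hP : P.Monic) : P.resultant (u + P * w) = P.resultant u := by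
  set n := max (u + P * w).natDegree (max u.natDegree (w.natDegree + P.natDegree))
  rw [← resultant_eq_of_natDegree_le hP (n := n) (le_max_left _ _),
    ← resultant_eq_of_natDegree_le hP (n := n) (u := u)
      ((le_max_left _ _).trans (le_max_right _ _)),
    resultant_add_mul_right _ _ _ _ _ ((le_max_right _ _).trans (le_max_right _ _)) le_rfl]

theorem resultant_map_of_monic [Nontrivial B] (hP : P.Monic) (φ : A →+* B) :
    (P.map φ).resultant (u.map φ) = φ (P.resultant u) := by
  rw [← resultant_map_map, ← resultant_eq_of_natDegree_le (hP.map φ) natDegree_map_le,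
    hP.natDegree_map]

theorem resultant_prod_X_sub_C [Nontrivial A] {ι : Type*} (s : Finset ι) (ξ : ι → A) :
    (∏ i ∈ s, (Polynomial.X - Polynomial.C (ξ i))).resultant u = ∏ i ∈ s, u.eval (ξ i) := by
  rw [resultant_prod_left s _ _ _ (by simp) le_rfl]
  exact Finset.prod_congr rfl fun i _ => by
    rw [natDegree_X_sub_C, resultant_X_sub_C_left _ _ _ le_rfl]

theorem resultant_symm_associated : Associated (P.resultant u) (u.resultant P) := by
  rw [resultant_comm]
  exact associated_unit_mul_left _ _ ((isUnit_one.neg).pow _)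

end MonicResultant

section Distinguished

open Polynomial

variable {P u : (PowerSeries ℂ)[X]}

theorem IsDistinguished.map_constantCoeff
    (hP : P.IsDistinguishedAt (Ideal.span {(PowerSeries.X : PowerSeries ℂ)})) :
    P.map (PowerSeries.constantCoeff (R := ℂ)) = Polynomial.X ^ P.natDegree := by
  ext n
  rw [Polynomial.coeff_map, Polynomial.coeff_X_pow]
  split_ifs with h
  · rw [h, hP.monic.coeff_natDegree, map_one]
  · rcases lt_or_gt_of_ne h with h | h
    · have := hP.mem h
      rwa [Ideal.mem_span_singleton, PowerSeries.X_dvd_iff] at this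
    · rw [coeff_eq_zero_of_natDegree_lt h, map_zero]

theorem isUnit_resultant
    (hP : P.IsDistinguishedAt (Ideal.span {(PowerSeries.X : PowerSeries ℂ)}))
    (hu : PowerSeries.constantCoeff (u.coeff 0) ≠ 0) : IsUnit (P.resultant u) := by
  rw [PowerSeries.isUnit_iff_constantCoeff, ← resultant_map_of_monic hP.monic,
    IsDistinguished.map_constantCoeff hP]
  have : (Polynomial.X ^ P.natDegree : ℂ[X]) =
      ∏ i ∈ Finset.range P.natDegree, (Polynomial.X - Polynomial.C 0) := by simp
  rw [this, resultant_prod_X_sub_C, Finset.prod_const, ← coeff_zero_eq_eval_zero,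
    Polynomial.coeff_map]
  exact (hu.isUnit).pow _

theorem isDistinguished_irreducible
    (hP : P.IsDistinguishedAt (Ideal.span {(PowerSeries.X : PowerSeries ℂ)}))
    (h : Irreducible (P : PowerSeries (PowerSeries ℂ))) : Irreducible P := by
  rw [hP.monic.irreducible_iff_natDegree]
  refine ⟨fun h1 => h.not_isUnit (by rw [h1]; simp), fun R S hR hS hRS => ?_⟩
  have key : ∀ {R : (PowerSeries ℂ)[X]}, R.Monic → R ∣ P →
      IsUnit (R : PowerSeries (PowerSeries ℂ)) → R.natDegree = 0 := by
    intro R hR hd hu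
    have h1 := Polynomial.map_dvd (PowerSeries.constantCoeff (R := ℂ)) hd
    rw [IsDistinguished.map_constantCoeff hP] at h1
    obtain ⟨k, hk, h2⟩ := (dvd_prime_pow Polynomial.prime_X _).1 h1
    have h3 := eq_of_monic_of_associated (hR.map _) (monic_X_pow k) h2
    rw [PowerSeries.isUnit_iff_constantCoeff, PowerSeries.isUnit_iff_constantCoeff,
      ← PowerSeries.coeff_zero_eq_constantCoeff_apply (φ := (R : PowerSeries (PowerSeries ℂ))),
      Polynomial.coeff_coe, ← Polynomial.coeff_map, h3, Polynomial.coeff_X_pow] at hu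
    rw [← hR.natDegree_map (PowerSeries.constantCoeff (R := ℂ)), h3, natDegree_X_pow]
    by_contra hk0
    rw [if_neg (Ne.symm hk0)] at hu
    exact not_isUnit_zero hu
  have h1 := h.isUnit_or_isUnit (a := (R : PowerSeries (PowerSeries ℂ))) (b := S)
    (by rw [← hRS, Polynomial.coe_mul])
  exact h1.imp (key hR (Dvd.intro _ hRS)) (key hS (Dvd.intro_left _ hRS))

theorem resultant_ne_zero_of_irreducible {A : Type*} [CommRing A] [IsDomain A]
    [IsIntegrallyClosed A] {P u : A[X]} (hm : P.Monic) (hP : Irreducible P) (hu : ¬ P ∣ u) :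
    P.resultant u ≠ 0 := by
  intro h
  have h1 : (P.map (algebraMap A (FractionRing A))).resultant
      (u.map (algebraMap A (FractionRing A))) = 0 := by
    rw [resultant_map_of_monic hm, h, map_zero]
  have hirr : Irreducible (P.map (algebraMap A (FractionRing A))) :=
    (hm.irreducible_iff_irreducible_map_fraction_map).1 hP
  refine resultant_ne_zero _ _ (hirr.coprime_iff_not_dvd.2 fun hd => hu ?_) h1
  obtain ⟨q, hq⟩ := hd
  have h2 := modByMonic_add_div u P
  by_contra hnd
  have hr : u %ₘ P ≠ 0 := fun h0 => hnd ((modByMonic_eq_zero_iff_dvd hm).1 h0)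
  have h3 : P.map (algebraMap A (FractionRing A)) ∣ (u %ₘ P).map (algebraMap A (FractionRing A)) := by
    rw [map_modByMonic _ hm]
    rw [hq, (modByMonic_eq_zero_iff_dvd (hm.map _)).2 (dvd_mul_right _ _)]
    exact dvd_zero _
  have h4 := degree_le_of_dvd h3 (by
    rwa [Polynomial.map_ne_zero_iff (IsFractionRing.injective A (FractionRing A))])
  rw [degree_map_eq_of_injective (IsFractionRing.injective A (FractionRing A)),
    degree_map_eq_of_injective (IsFractionRing.injective A (FractionRing A))] at h4
  exact absurd (degree_modByMonic_lt u hm) (not_lt.2 h4)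

end Distinguished

section Puiseux

open Filter Topology

/-- The vanishing order of the resultant with a monic polynomial. -/
noncomputable def ordRes (P u : Polynomial Germ) : ℕ∞ := (P.resultant u).1 |> (analyticOrderAt · 0)

theorem ordRes_eq {P : Polynomial Germ} (hP : P.Monic) (u : Polynomial Germ) :
    ordRes P u = ((P.map taylor).resultant (u.map taylor)).order := by
  rw [resultant_map_of_monic hP, order_taylor]; rfl

theorem analyticOrderAt_finset_prod {ι : Type*} (s : Finset ι) {f : ι → ℂ → ℂ} {z : ℂ}
    (hf : ∀ i ∈ s, AnalyticAt ℂ (f i) z) :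
    analyticOrderAt (∏ i ∈ s, f i) z = ∑ i ∈ s, analyticOrderAt (f i) z := by
  classical
  induction s using Finset.induction_on with
  | empty =>
    rw [Finset.prod_empty, Finset.sum_empty]
    exact analyticOrderAt_eq_zero.2 (Or.inr one_ne_zero)
  | insert i s hi ih =>
    rw [Finset.prod_insert hi, Finset.sum_insert hi,
      analyticOrderAt_mul (hf i (by simp))
        (Finset.analyticAt_prod _ fun j hj => hf j (by simp [hj])),
      ih fun j hj => hf j (by simp [hj])]

theorem analyticAt_eval_pow (u : Polynomial Germ) {K : ℕ} (hK : K ≠ 0) {ξ : ℂ → ℂ}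
    (hξ : AnalyticAt ℂ ξ 0) :
    AnalyticAt ℂ (fun t => (u.map (germEval (t ^ K))).eval (ξ t)) 0 := by
  refine AnalyticFamily.eval (D := u.natDegree) (fun i => ?_)
    (fun t => Polynomial.natDegree_map_le) hξ
  simp only [Polynomial.coeff_map]
  exact analyticAt_comp_pow (u.coeff i).2 hK

theorem ordRes_mul_eq_sum {P : Polynomial Germ} (hP : P.Monic) (u : Polynomial Germ) {K : ℕ}
    (hK : K ≠ 0) {ι : Type*} [Fintype ι] {ξ : ι → ℂ → ℂ} (hξ : ∀ i, AnalyticAt ℂ (ξ i) 0)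
    (h : ∀ᶠ t in 𝓝 0, P.map (germEval (t ^ K)) = ∏ i, (Polynomial.X - Polynomial.C (ξ i t))) :
    ordRes P u * K =
      ∑ i, analyticOrderAt (fun t => (u.map (germEval (t ^ K))).eval (ξ i t)) 0 := by
  rw [ordRes, ← analyticOrderAt_comp_pow (P.resultant u).2 hK]
  have h1 : (fun t => (P.resultant u).1 (t ^ K)) =ᶠ[𝓝 0]
      ∏ i, fun t => (u.map (germEval (t ^ K))).eval (ξ i t) := by
    refine h.mono fun t ht => ?_
    change germEval (t ^ K) (P.resultant u) = _
    rw [← resultant_map_of_monic hP, ht, resultant_prod_X_sub_C,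
      Finset.prod_apply]
  rw [analyticOrderAt_congr h1, analyticOrderAt_finset_prod]
  exact fun i _ => analyticAt_eval_pow u hK (hξ i)

theorem IsWeierstrass.ordRes_symm {h P Q h' P' Q' : Polynomial Germ} (H : IsWeierstrass h P Q)
    (H' : IsWeierstrass h' P' Q') : ordRes P h' = ordRes P' h := by
  have key : ∀ {h P Q h' P' Q' : Polynomial Germ}, IsWeierstrass h P Q → IsWeierstrass h' P' Q' →
      ordRes P h' = ((P.map taylor).resultant (P'.map taylor)).order := by
    intro h P Q h' P' Q' H H'
    rw [ordRes_eq H.monic, H'.map_taylor, resultant_mul_of_monic (H.monic.map _),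
      PowerSeries.order_mul, PowerSeries.order_zero_of_unit (isUnit_resultant (u := Q'.map taylor)
        H.isDistinguishedAt ?_), add_zero]
    rw [Polynomial.coeff_map, constantCoeff_taylor]
    exact H'.unit
  rw [key H H', key H' H]
  exact order_eq_of_associated resultant_symm_associated

end Puiseux

section Derivations

variable {A : Type*} [CommRing A] [Algebra ℂ A] (D : Derivation ℂ A A)

theorem derivation_prod {ι : Type*} [DecidableEq ι] (s : Finset ι) (f : ι → A) :
    D (∏ i ∈ s, f i) = ∑ i ∈ s, D (f i) * ∏ j ∈ s.erase i, f j := by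
  induction s using Finset.induction_on with
  | empty => simp
  | insert i s hi ih =>
    rw [Finset.prod_insert hi, D.leibniz, ih, Finset.sum_insert hi, Finset.erase_insert hi,
      smul_eq_mul, smul_eq_mul, Finset.mul_sum, add_comm, mul_comm (∏ j ∈ s, f j)]
    refine congrArg _ (Finset.sum_congr rfl fun j hj => ?_)
    have hij : i ≠ j := fun h => hi (h ▸ hj)
    rw [Finset.erase_insert_of_ne hij, Finset.prod_insert (by simp [hi])]
    ring

theorem derivation_prod_pow {ι : Type*} [Fintype ι] [DecidableEq ι] (f : ι → A) (c : ι → ℕ)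
    (hc : ∀ i, 1 ≤ c i) :
    D (∏ i, f i ^ c i) = (∏ i, f i ^ (c i - 1)) *
      ∑ i, (c i : A) * D (f i) * ∏ j ∈ ({i}ᶜ : Finset ι), f j := by
  rw [derivation_prod, Finset.mul_sum]
  refine Finset.sum_congr rfl fun i _ => ?_
  have h1 : (Finset.univ.erase i : Finset ι) = {i}ᶜ := by ext; simp
  have h2 : ∀ f : ι → A, ∏ j, f j = f i * ∏ j ∈ ({i}ᶜ : Finset ι), f j := fun f =>
    (Fintype.prod_eq_mul_prod_compl i f)
  rw [D.leibniz_pow, h1, h2 (fun i => f i ^ (c i - 1)), nsmul_eq_mul, smul_eq_mul]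
  have h3 : ∏ j ∈ ({i}ᶜ : Finset ι), f j ^ c j =
      (∏ j ∈ ({i}ᶜ : Finset ι), f j ^ (c j - 1)) * ∏ j ∈ ({i}ᶜ : Finset ι), f j := by
    rw [← Finset.prod_mul_distrib]
    refine Finset.prod_congr rfl fun j _ => ?_
    rw [← pow_succ, Nat.sub_add_cancel (hc j)]
  rw [h3]
  ring

end Derivations

section GermPoly

open Filter Topology

/-- Polynomials in `x₀, x₁` as polynomials in `x` over germs in `y`,
where `x₀ = x` and `x₁ = a x + y`. -/
noncomputable def germPoly (a : ℂ) : MvPolynomial (Fin 2) ℂ →+* Polynomial Germ :=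
  MvPolynomial.eval₂Hom (Polynomial.C.comp constGerm) ![Polynomial.X,
    Polynomial.C (constGerm a) * Polynomial.X + Polynomial.C idGerm]

theorem germPoly_C (a r : ℂ) : germPoly a (MvPolynomial.C r) = Polynomial.C (constGerm r) :=
  MvPolynomial.eval₂Hom_C _ _ _

theorem germPoly_X_zero (a : ℂ) : germPoly a (MvPolynomial.X 0) = Polynomial.X :=
  MvPolynomial.eval₂Hom_X' _ _ _

theorem germPoly_X_one (a : ℂ) : germPoly a (MvPolynomial.X 1) =
    Polynomial.C (constGerm a) * Polynomial.X + Polynomial.C idGerm :=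
  MvPolynomial.eval₂Hom_X' _ _ _

theorem map_taylor_germPoly (a : ℂ) (h : MvPolynomial (Fin 2) ℂ) :
    (germPoly a h).map taylor = coordPoly a h := by
  have : (Polynomial.mapRingHom taylor).comp (germPoly a) = (coordPoly a : _ →+* _) := by
    apply MvPolynomial.ringHom_ext
    · intro r
      simp only [RingHom.comp_apply, germPoly_C, Polynomial.coe_mapRingHom, Polynomial.map_C,
        taylor_constGerm]
      exact ((coordPoly a).commutes r).symm
    · intro i
      fin_cases i
      · simp [germPoly_X_zero, coordPoly]
      · simp [germPoly_X_one, coordPoly, taylor_constGerm, taylor_idGerm]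
  exact congrArg (fun φ : MvPolynomial (Fin 2) ℂ →+* Polynomial (PowerSeries ℂ) => φ h) this

theorem eval_germPoly (a : ℂ) (h : MvPolynomial (Fin 2) ℂ) (x y : ℂ) :
    ((germPoly a h).map (germEval y)).eval x = MvPolynomial.eval ![x, a * x + y] h := by
  have : ((Polynomial.evalRingHom x).comp (Polynomial.mapRingHom (germEval y))).comp (germPoly a) =
      MvPolynomial.eval ![x, a * x + y] := by
    apply MvPolynomial.ringHom_ext
    · intro r
      simp [germPoly_C, germEval_apply, constGerm]
    · intro i
      fin_cases i
      · simp [germPoly_X_zero]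
      · simp [germPoly_X_one, germEval_apply, constGerm, idGerm]
  exact congrArg (fun φ : MvPolynomial (Fin 2) ℂ →+* ℂ => φ h) this

/-- The derivative in the direction `(1, a)`. -/
noncomputable def dirDeriv (a : ℂ) :
    Derivation ℂ (MvPolynomial (Fin 2) ℂ) (MvPolynomial (Fin 2) ℂ) :=
  pderiv 0 + a • pderiv 1

theorem dirDeriv_apply (a : ℂ) (h : MvPolynomial (Fin 2) ℂ) :
    dirDeriv a h = pderiv 0 h + MvPolynomial.C a * pderiv 1 h := by
  rw [dirDeriv, Derivation.add_apply, Derivation.smul_apply, MvPolynomial.smul_eq_C_mul]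

theorem germPoly_dirDeriv (a : ℂ) (h : MvPolynomial (Fin 2) ℂ) :
    germPoly a (dirDeriv a h) = (germPoly a h).derivative := by
  have hX : ∀ i, germPoly a (dirDeriv a (MvPolynomial.X i)) =
      (germPoly a (MvPolynomial.X i)).derivative := by
    intro i
    fin_cases i
    · simp [germPoly_X_zero, dirDeriv_apply, pderiv_X]
    · simp [germPoly_X_one, dirDeriv_apply, pderiv_X, germPoly_C]
  induction h using MvPolynomial.induction_on with
  | C r => simp [germPoly_C]
  | add p q hp hq => rw [map_add, map_add, map_add, hp, hq, Polynomial.derivative_add]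
  | mul_X p i hp =>
    rw [Derivation.leibniz, smul_eq_mul, smul_eq_mul, map_add, map_mul, map_mul, hX, hp, map_mul,
      Polynomial.derivative_mul]
    ring

theorem map_germEval_dirDeriv (a : ℂ) (h : MvPolynomial (Fin 2) ℂ) (y : ℂ) :
    (germPoly a (dirDeriv a h)).map (germEval y) = ((germPoly a h).map (germEval y)).derivative := by
  rw [germPoly_dirDeriv, Polynomial.derivative_map]

theorem constantCoeff_comp_taylor :
    (PowerSeries.constantCoeff (R := ℂ)).comp taylor = germEval 0 :=
  RingHom.ext constantCoeff_taylor

variable {a : ℂ} {h u : MvPolynomial (Fin 2) ℂ} {P Q : Polynomial Germ}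

theorem IsWeierstrass.associated_coordEquiv (H : IsWeierstrass (germPoly a h) P Q) :
    Associated (coordEquiv a (h : MvPowerSeries (Fin 2) ℂ))
      ((P.map taylor : Polynomial (PowerSeries ℂ)) : PowerSeries (PowerSeries ℂ)) := by
  rw [coordEquiv_coe, ← map_taylor_germPoly, H.map_taylor, Polynomial.coe_mul]
  refine associated_mul_unit_left _ _ ?_
  rw [PowerSeries.isUnit_iff_constantCoeff, PowerSeries.isUnit_iff_constantCoeff,
    ← PowerSeries.coeff_zero_eq_constantCoeff_apply
      (φ := ((Q.map taylor : Polynomial (PowerSeries ℂ)) : PowerSeries (PowerSeries ℂ))),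
    Polynomial.coeff_coe, Polynomial.coeff_map, constantCoeff_taylor]
  exact H.unit.isUnit

theorem IsWeierstrass.finrank_eq (H : IsWeierstrass (germPoly a h) P Q)
    (hu : ordRes P (germPoly a u) ≠ ⊤) :
    Module.finrank ℂ (MvPowerSeries (Fin 2) ℂ ⧸
      Ideal.span {(h : MvPowerSeries (Fin 2) ℂ), (u : MvPowerSeries (Fin 2) ℂ)}) =
      (ordRes P (germPoly a u)).toNat := by
  rw [ordRes_eq H.monic] at hu ⊢
  rw [finrank_quotient_coordEquiv a]
  refine finrank_quotient_powerSeries H.isDistinguishedAt ?_ H.associated_coordEquiv ?_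
  · rwa [Ne, ← PowerSeries.order_eq_top]
  · rw [coordEquiv_coe, map_taylor_germPoly]

theorem IsWeierstrass.ordRes_ne_top (H : IsWeierstrass (germPoly a h) P Q)
    (hirr : Irreducible (h : MvPowerSeries (Fin 2) ℂ)) {u : Polynomial Germ}
    (hd : ¬ P.map taylor ∣ u.map taylor) : ordRes P u ≠ ⊤ := by
  rw [ordRes_eq H.monic, Ne, PowerSeries.order_eq_top]
  refine resultant_ne_zero_of_irreducible (H.monic.map _)
    (isDistinguished_irreducible H.isDistinguishedAt ?_) hd
  rw [← H.associated_coordEquiv.irreducible_iff]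
  exact (MulEquiv.irreducible_iff (coordEquiv a)).2 hirr

theorem IsWeierstrass.dvd_of_dvd (H : IsWeierstrass (germPoly a h) P Q)
    (hd : P.map taylor ∣ (germPoly a u).map taylor) :
    (h : MvPowerSeries (Fin 2) ℂ) ∣ (u : MvPowerSeries (Fin 2) ℂ) := by
  rw [← map_dvd_iff (coordEquiv a), H.associated_coordEquiv.dvd_iff_dvd_left, coordEquiv_coe,
    ← map_taylor_germPoly]
  exact map_dvd Polynomial.coeToPowerSeries.ringHom hd

theorem ordRes_mul (hP : P.Monic) (u v : Polynomial Germ) :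
    ordRes P (u * v) = ordRes P u + ordRes P v := by
  rw [ordRes_eq hP, ordRes_eq hP, ordRes_eq hP, Polynomial.map_mul,
    resultant_mul_of_monic (hP.map _), PowerSeries.order_mul]

theorem ordRes_one (hP : P.Monic) : ordRes P 1 = 0 := by
  rw [ordRes_eq hP, Polynomial.map_one, resultant_one_of_monic (hP.map _), PowerSeries.order_one]

theorem ordRes_prod (hP : P.Monic) {ι : Type*} (s : Finset ι) (u : ι → Polynomial Germ) :
    ordRes P (∏ i ∈ s, u i) = ∑ i ∈ s, ordRes P (u i) := by
  classical
  induction s using Finset.induction_on with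
  | empty => simpa using ordRes_one hP
  | insert i s hi ih => rw [Finset.prod_insert hi, Finset.sum_insert hi, ordRes_mul hP, ih]

theorem ordRes_pow (hP : P.Monic) (u : Polynomial Germ) (n : ℕ) :
    ordRes P (u ^ n) = n * ordRes P u := by
  have := ordRes_prod hP (Finset.range n) fun _ => u
  simpa using this

theorem ordRes_add_mul {h : Polynomial Germ} (H : IsWeierstrass h P Q) (u w : Polynomial Germ) :
    ordRes P (u + h * w) = ordRes P u := by
  rw [ordRes_eq H.monic, ordRes_eq H.monic, Polynomial.map_add, Polynomial.map_mul, H.map_taylor,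
    mul_assoc, resultant_add_mul_of_monic (H.monic.map _)]

theorem ordRes_C {h : Polynomial Germ} (H : IsWeierstrass h P Q) {r : ℂ} (hr : r ≠ 0) :
    ordRes P (Polynomial.C (constGerm r)) = 0 := by
  rw [ordRes_eq H.monic]
  refine PowerSeries.order_zero_of_unit (isUnit_resultant H.isDistinguishedAt ?_)
  rw [Polynomial.map_C, Polynomial.coeff_C_zero, constantCoeff_taylor]
  exact hr

end GermPoly

section Teissier

open Filter Topology

variable {a : ℂ} {h : MvPolynomial (Fin 2) ℂ} {P Q : Polynomial Germ}

theorem map_germEval_zero_isRoot (hval : MvPolynomial.eval (0 : Fin 2 → ℂ) h = 0) :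
    ((germPoly a h).map (germEval 0)).IsRoot 0 := by
  rw [Polynomial.IsRoot.def, eval_germPoly]
  have : ![(0 : ℂ), a * 0 + 0] = 0 := by
    ext i
    fin_cases i <;> simp
  rw [this, hval]

theorem derivative_ne_zero_of_root {p : Polynomial ℂ} (hp : p ≠ 0) {x : ℂ} (hx : p.IsRoot x) :
    p.derivative ≠ 0 := by
  intro h
  have := Polynomial.derivative_eq_zero.1 h
  rw [Polynomial.eq_C_of_natDegree_eq_zero this] at hx hp
  rw [Polynomial.IsRoot.def, Polynomial.eval_C] at hx
  rw [hx] at hp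
  simp at hp

theorem IsWeierstrass.not_dvd_dirDeriv (H : IsWeierstrass (germPoly a h) P Q)
    (hval : MvPolynomial.eval (0 : Fin 2 → ℂ) h = 0)
    (h0 : (germPoly a h).map (germEval 0) ≠ 0)
    (hd : P.natDegree = ((germPoly a h).map (germEval 0)).rootMultiplicity 0) :
    ¬ P.map taylor ∣ (germPoly a (dirDeriv a h)).map taylor := by
  intro hdvd
  have h1 := Polynomial.map_dvd (PowerSeries.constantCoeff (R := ℂ)) hdvd
  rw [Polynomial.map_map, Polynomial.map_map, constantCoeff_comp_taylor, H.map_zero,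
    map_germEval_dirDeriv] at h1
  have hroot := map_germEval_zero_isRoot (a := a) hval
  have h2 : P.natDegree ≤ _ := (Polynomial.le_rootMultiplicity_iff
    (derivative_ne_zero_of_root h0 hroot) (a := 0)).2 (by simpa using h1)
  rw [Polynomial.derivative_rootMultiplicity_of_root hroot, ← hd] at h2
  have h3 := (Polynomial.rootMultiplicity_pos h0).2 hroot
  omega

/-- Roots of a family of Weierstrass polynomials vanish at the origin. -/
theorem root_zero {ι : Type*} [Fintype ι] {K : ℕ} (hK : K ≠ 0) {ξ : ι → ℂ → ℂ}
    {h : Polynomial Germ} (H : IsWeierstrass h P Q)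
    (hξ : ∀ᶠ t in 𝓝 0, P.map (germEval (t ^ K)) =
      ∏ i, (Polynomial.X - Polynomial.C (ξ i t))) (i : ι) : ξ i 0 = 0 := by
  have h1 := hξ.self_of_nhds
  rw [zero_pow hK, H.map_zero] at h1
  have h2 := congrArg (Polynomial.eval (ξ i 0)) h1
  rw [Polynomial.eval_prod, Finset.prod_eq_zero (Finset.mem_univ i) (by simp), Polynomial.eval_pow,
    Polynomial.eval_X] at h2
  by_contra hne
  exact pow_ne_zero _ hne h2

theorem hasDerivAt_eval (h : MvPolynomial (Fin 2) ℂ) {x y : ℂ → ℂ} {x' y' t : ℂ}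
    (hx : HasDerivAt x x' t) (hy : HasDerivAt y y' t) :
    HasDerivAt (fun s => MvPolynomial.eval ![x s, y s] h)
      (MvPolynomial.eval ![x t, y t] (pderiv 0 h) * x' +
        MvPolynomial.eval ![x t, y t] (pderiv 1 h) * y') t := by
  induction h using MvPolynomial.induction_on with
  | C r => simpa using hasDerivAt_const t r
  | add p q hp hq =>
    simp only [map_add]
    convert! hp.fun_add hq using 1
    ring
  | mul_X p i hp =>
    fin_cases i
    · simp only [map_mul, Fin.zero_eta, MvPolynomial.eval_X, Matrix.cons_val_zero,
        Derivation.leibniz, pderiv_X, smul_eq_mul, map_add]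
      convert! hp.fun_mul hx using 1
      simp
      ring
    · simp only [map_mul, Fin.mk_one, MvPolynomial.eval_X, Matrix.cons_val_one,
        Derivation.leibniz, pderiv_X, smul_eq_mul, map_add]
      convert! hp.fun_mul hy using 1
      simp
      ring

theorem hasDerivAt_eval_shear (h : MvPolynomial (Fin 2) ℂ) {x : ℂ → ℂ} {y : ℂ → ℂ} {x' y' t : ℂ}
    (hx : HasDerivAt x x' t) (hy : HasDerivAt y y' t) :
    HasDerivAt (fun s => MvPolynomial.eval ![x s, a * x s + y s] h)
      (MvPolynomial.eval ![x t, a * x t + y t] (dirDeriv a h) * x' +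
        MvPolynomial.eval ![x t, a * x t + y t] (pderiv 1 h) * y') t := by
  convert! hasDerivAt_eval h hx ((hx.const_mul a).fun_add hy) using 1
  rw [dirDeriv_apply, map_add, map_mul, MvPolynomial.eval_C]
  ring

/-- Teissier's lemma on the order along a polar branch. -/
theorem analyticOrderAt_polar {K : ℕ} (hK : K ≠ 0) {ξ : ℂ → ℂ} (hξ : AnalyticAt ℂ ξ 0)
    (hξ0 : ξ 0 = 0) (hval : MvPolynomial.eval (0 : Fin 2 → ℂ) h = 0)
    (hpol : ∀ᶠ t in 𝓝 0, MvPolynomial.eval ![ξ t, a * ξ t + t ^ K] (dirDeriv a h) = 0) :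
    analyticOrderAt (fun t => MvPolynomial.eval ![ξ t, a * ξ t + t ^ K] h) 0 =
      analyticOrderAt (fun t => MvPolynomial.eval ![ξ t, a * ξ t + t ^ K] (pderiv 1 h)) 0 + K := by
  have han : ∀ u : MvPolynomial (Fin 2) ℂ,
      AnalyticAt ℂ (fun t => MvPolynomial.eval ![ξ t, a * ξ t + t ^ K] u) 0 := by
    intro u
    simpa only [eval_germPoly] using analyticAt_eval_pow (germPoly a u) hK hξ
  have h1 := (han h).analyticOrderAt_deriv_add_one
  have h2 : MvPolynomial.eval ![ξ 0, a * ξ 0 + 0 ^ K] h = 0 := by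
    have : ![(0 : ℂ), a * 0 + 0] = 0 := by
      ext i
      fin_cases i <;> simp
    rw [hξ0, zero_pow hK, this, hval]
  rw [h2] at h1
  simp only [sub_zero] at h1
  rw [← h1]
  have h3 : deriv (fun t => MvPolynomial.eval ![ξ t, a * ξ t + t ^ K] h) =ᶠ[𝓝 0]
      (fun t => MvPolynomial.eval ![ξ t, a * ξ t + t ^ K] (pderiv 1 h)) *
        fun t => (K : ℂ) * t ^ (K - 1) := by
    filter_upwards [hpol, hξ.eventually_analyticAt] with t ht hat
    rw [(hasDerivAt_eval_shear h hat.differentiableAt.hasDerivAt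
      (hasDerivAt_pow K t)).deriv, ht, zero_mul, zero_add, Pi.mul_apply]
  have h4 : AnalyticAt ℂ (fun t : ℂ => (K : ℂ) * t ^ (K - 1)) 0 :=
    analyticAt_const.fun_mul (analyticAt_id.fun_pow _)
  rw [analyticOrderAt_congr h3, analyticOrderAt_mul (han _) h4, add_assoc]
  have h5 : analyticOrderAt (fun t : ℂ => (K : ℂ) * t ^ (K - 1)) 0 = (K - 1 : ℕ) := by
    rw [h4.analyticOrderAt_eq_natCast]
    exact ⟨fun _ => K, analyticAt_const, by simpa using hK, by simp [mul_comm]⟩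
  rw [h5]
  congr 1
  exact_mod_cast Nat.sub_add_cancel (Nat.pos_of_ne_zero hK)

theorem span_dirDeriv (a : ℂ) (h : MvPolynomial (Fin 2) ℂ) :
    Ideal.span {((dirDeriv a h : MvPolynomial (Fin 2) ℂ) : MvPowerSeries (Fin 2) ℂ),
      ((pderiv 1 h : MvPolynomial (Fin 2) ℂ) : MvPowerSeries (Fin 2) ℂ)} =
    Ideal.span {((pderiv 0 h : MvPolynomial (Fin 2) ℂ) : MvPowerSeries (Fin 2) ℂ),
      ((pderiv 1 h : MvPolynomial (Fin 2) ℂ) : MvPowerSeries (Fin 2) ℂ)} := by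
  rw [dirDeriv_apply, MvPolynomial.coe_add, MvPolynomial.coe_mul]
  exact Ideal.span_pair_add_mul_right ..

theorem exists_isWeierstrass_dirDeriv (hval : MvPolynomial.eval (0 : Fin 2 → ℂ) h = 0)
    (h0 : (germPoly a h).map (germEval 0) ≠ 0) :
    ∃ P Q, IsWeierstrass (germPoly a (dirDeriv a h)) P Q ∧
      P.natDegree + 1 = ((germPoly a h).map (germEval 0)).rootMultiplicity 0 := by
  have hroot := map_germEval_zero_isRoot (a := a) hval
  have hd0 := derivative_ne_zero_of_root h0 hroot
  rw [← map_germEval_dirDeriv] at hd0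
  obtain ⟨P, Q, H, hd⟩ := exists_isWeierstrass hd0
  refine ⟨P, Q, H, ?_⟩
  rw [hd, map_germEval_dirDeriv, Polynomial.derivative_rootMultiplicity_of_root hroot]
  have h3 := (Polynomial.rootMultiplicity_pos h0).2 hroot
  omega

theorem exists_puiseux_roots {h : Polynomial Germ} (H : IsWeierstrass h P Q) :
    ∃ K ≠ 0, ∃ (ι : Type) (_ : Fintype ι) (ξ : ι → ℂ → ℂ), Fintype.card ι = P.natDegree ∧
      (∀ i, AnalyticAt ℂ (ξ i) 0) ∧ (∀ i, ξ i 0 = 0) ∧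
      (∀ᶠ t in 𝓝 0, P.map (germEval (t ^ K)) =
        ∏ i, (Polynomial.X - Polynomial.C (ξ i t))) ∧
      ∀ i, ∀ᶠ t in 𝓝 0, (h.map (germEval (t ^ K))).eval (ξ i t) = 0 := by
  obtain ⟨K, hK, ι, hι, ξ, hξ, hP⟩ := hasPuiseuxRoots (P := fun t => P.map (germEval t)) P.natDegree
    (fun t => ⟨H.monic.map _, H.monic.natDegree_map _⟩) (analyticFamily_map P)
  refine ⟨K, hK, ι, hι, ξ, ?_, hξ, root_zero hK H hP, hP, fun i => ?_⟩
  · have := congrArg Polynomial.natDegree hP.self_of_nhds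
    rw [H.monic.natDegree_map, Polynomial.natDegree_prod_of_monic _ _
      fun i _ => Polynomial.monic_X_sub_C _] at this
    simpa using this.symm
  · filter_upwards [hP, (tendsto_pow_zero hK).eventually H.eventually_eq] with t h1 h2
    rw [h2, h1, Polynomial.eval_mul, Polynomial.eval_prod, Finset.prod_eq_zero (Finset.mem_univ i),
      zero_mul]
    simp

theorem IsWeierstrass.ordRes_dirDeriv (H : IsWeierstrass (germPoly a h) P Q)
    (hirr : Irreducible (h : MvPowerSeries (Fin 2) ℂ))
    (hval : MvPolynomial.eval (0 : Fin 2 → ℂ) h = 0)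
    (h0 : (germPoly a h).map (germEval 0) ≠ 0)
    (hd : P.natDegree = ((germPoly a h).map (germEval 0)).rootMultiplicity 0) :
    ordRes P (germPoly a (dirDeriv a h)) + 1 = milnorNumber h + P.natDegree := by
  have hfin := H.ordRes_ne_top hirr (H.not_dvd_dirDeriv hval h0 hd)
  obtain ⟨P', Q', H', hd'⟩ := exists_isWeierstrass_dirDeriv hval h0
  rw [H.ordRes_symm H'] at hfin ⊢
  obtain ⟨K, hK, ι, hι, ξ, hcard, hξ, hξ0, hP, hroot⟩ := exists_puiseux_roots H'
  have h1 := ordRes_mul_eq_sum H'.monic (germPoly a h) hK hξ hP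
  have h2 := ordRes_mul_eq_sum H'.monic (germPoly a (pderiv 1 h)) hK hξ hP
  simp only [eval_germPoly] at h1 h2 hroot
  have h3 : ordRes P' (germPoly a h) * K =
      (ordRes P' (germPoly a (pderiv 1 h)) + P'.natDegree) * K := by
    rw [h1, Finset.sum_congr rfl fun i _ =>
      analyticOrderAt_polar hK (hξ i) (hξ0 i) hval (hroot i), Finset.sum_add_distrib, ← h2,
      add_mul, Finset.sum_const, Finset.card_univ, hcard, nsmul_eq_mul]
  have h4 : ordRes P' (germPoly a h) = ordRes P' (germPoly a (pderiv 1 h)) + P'.natDegree := by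
    refine (ENat.mul_left_strictMono (a := (K : ℕ∞)) (by exact_mod_cast hK)
      (ENat.natCast_ne_top K)).injective ?_
    simpa only [mul_comm] using h3
  have h5 : ordRes P' (germPoly a (pderiv 1 h)) ≠ ⊤ := fun h => hfin (by rw [h4, h, top_add])
  have h6 := H'.finrank_eq h5
  rw [span_dirDeriv] at h6
  rw [h4, milnorNumber, h6, ENat.natCast_toNat h5, hd, ← hd']
  push_cast
  rw [add_assoc]

end Teissier

section Polar

open Filter Topology

variable {m : ℕ} {a : ℂ} {g : Fin (m + 1) → MvPolynomial (Fin 2) ℂ} {c : Fin (m + 1) → ℕ}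

/-- The reduced polar of `∏ i, g i ^ c i` in the direction `(1, a)`. -/
noncomputable def polar (a : ℂ) (g : Fin (m + 1) → MvPolynomial (Fin 2) ℂ) (c : Fin (m + 1) → ℕ) :
    MvPolynomial (Fin 2) ℂ :=
  ∑ i, (c i : MvPolynomial (Fin 2) ℂ) * dirDeriv a (g i) *
    ∏ j ∈ ({i}ᶜ : Finset (Fin (m + 1))), g j

theorem dirDeriv_prod_pow (a : ℂ) (g : Fin (m + 1) → MvPolynomial (Fin 2) ℂ)
    (hc : ∀ i, 1 ≤ c i) :
    dirDeriv a (∏ i, g i ^ c i) = (∏ i, g i ^ (c i - 1)) * polar a g c :=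
  derivation_prod_pow _ g c hc

/-- The multiplicity at the origin of the restriction of `h` to the line `x₁ = a x₀`. -/
noncomputable def lineMult (a : ℂ) (h : MvPolynomial (Fin 2) ℂ) : ℕ :=
  ((germPoly a h).map (germEval 0)).rootMultiplicity 0

theorem lineMult_prod_pow (hnz : ∀ i, (germPoly a (g i)).map (germEval 0) ≠ 0)
    (c : Fin (m + 1) → ℕ) :
    (germPoly a (∏ i, g i ^ c i)).map (germEval 0) ≠ 0 ∧
      lineMult a (∏ i, g i ^ c i) = ∑ i, c i * lineMult a (g i) := by
  have key : ∀ s : Finset (Fin (m + 1)), (germPoly a (∏ i ∈ s, g i ^ c i)).map (germEval 0) ≠ 0 ∧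
      lineMult a (∏ i ∈ s, g i ^ c i) = ∑ i ∈ s, c i * lineMult a (g i) := by
    intro s
    induction s using Finset.induction_on with
    | empty => simp [lineMult]
    | insert i s hi ih =>
      have h1 : ((germPoly a (g i)).map (germEval 0)) ^ c i *
          (germPoly a (∏ i ∈ s, g i ^ c i)).map (germEval 0) ≠ 0 :=
        mul_ne_zero (pow_ne_zero _ (hnz i)) ih.1
      rw [Finset.prod_insert hi, Finset.sum_insert hi, lineMult, map_mul, map_pow,
        Polynomial.map_mul, Polynomial.map_pow]
      refine ⟨h1, ?_⟩
      rw [Polynomial.rootMultiplicity_mul h1, ← ih.2, lineMult, lineMult]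
      congr 1
      rw [← Polynomial.count_roots, ← Polynomial.count_roots, Polynomial.roots_pow,
        Multiset.count_nsmul]
  exact key _

theorem lineMult_pos {h : MvPolynomial (Fin 2) ℂ}
    (hval : MvPolynomial.eval (0 : Fin 2 → ℂ) h = 0)
    (h0 : (germPoly a h).map (germEval 0) ≠ 0) : 0 < lineMult a h :=
  (Polynomial.rootMultiplicity_pos h0).2 (map_germEval_zero_isRoot hval)

theorem lineMult_polar (hc : ∀ i, 1 ≤ c i)
    (hval : ∀ i, MvPolynomial.eval (0 : Fin 2 → ℂ) (g i) = 0)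
    (hnz : ∀ i, (germPoly a (g i)).map (germEval 0) ≠ 0) :
    (germPoly a (polar a g c)).map (germEval 0) ≠ 0 ∧
      lineMult a (polar a g c) + 1 = ∑ i, lineMult a (g i) := by
  have h1 := lineMult_prod_pow hnz c
  have h2 := lineMult_prod_pow hnz fun i => c i - 1
  have hval' : MvPolynomial.eval (0 : Fin 2 → ℂ) (∏ i, g i ^ c i) = 0 := by
    rw [map_prod]
    exact Finset.prod_eq_zero (Finset.mem_univ 0)
      (by rw [map_pow, hval, zero_pow (Nat.one_le_iff_ne_zero.1 (hc 0))])
  have hroot := map_germEval_zero_isRoot (a := a) hval'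
  have h3 := derivative_ne_zero_of_root h1.1 hroot
  have h4 := Polynomial.derivative_rootMultiplicity_of_root hroot
  rw [← map_germEval_dirDeriv, dirDeriv_prod_pow a g hc, map_mul, Polynomial.map_mul] at h3 h4
  rw [Polynomial.rootMultiplicity_mul h3] at h4
  refine ⟨right_ne_zero_of_mul h3, ?_⟩
  have h5 := h1.2
  have h6 := h2.2
  have h7 := lineMult_pos hval' h1.1
  have h8 : ∑ i, c i * lineMult a (g i) =
      ∑ i, (c i - 1) * lineMult a (g i) + ∑ i, lineMult a (g i) := by
    rw [← Finset.sum_add_distrib]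
    refine Finset.sum_congr rfl fun i _ => ?_
    obtain ⟨k, hk⟩ := Nat.exists_eq_add_of_le' (hc i)
    rw [hk, Nat.add_sub_cancel]
    ring
  unfold lineMult at *
  omega

theorem ordRes_germPoly_ne_top {i j : Fin (m + 1)} (hij : i ≠ j)
    (hirr : ∀ i, Irreducible ((↑(g i) : MvPowerSeries (Fin 2) ℂ)))
    (hcop : ∀ i j, i ≠ j →
      ¬ Associated ((↑(g i) : MvPowerSeries (Fin 2) ℂ)) (↑(g j) : MvPowerSeries (Fin 2) ℂ))
    {P Q : Polynomial Germ} (H : IsWeierstrass (germPoly a (g i)) P Q) :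
    ordRes P (germPoly a (g j)) ≠ ⊤ :=
  H.ordRes_ne_top (hirr i) fun hd =>
    hcop i j hij ((hirr i).associated_of_dvd (hirr j) (H.dvd_of_dvd hd))

theorem ordRes_polar (hc : ∀ i, 1 ≤ c i)
    (hval : ∀ i, MvPolynomial.eval (0 : Fin 2 → ℂ) (g i) = 0)
    (hirr : ∀ i, Irreducible ((↑(g i) : MvPowerSeries (Fin 2) ℂ)))
    (hcop : ∀ i j, i ≠ j →
      ¬ Associated ((↑(g i) : MvPowerSeries (Fin 2) ℂ)) (↑(g j) : MvPowerSeries (Fin 2) ℂ))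
    (hnz : ∀ i, (germPoly a (g i)).map (germEval 0) ≠ 0) {P' Q' : Polynomial Germ}
    (H' : IsWeierstrass (germPoly a (polar a g c)) P' Q') (i : Fin (m + 1)) :
    ordRes P' (germPoly a (g i)) + 1 = ((milnorNumber (g i) + lineMult a (g i) +
      interMult (g i) (∏ j ∈ ({i}ᶜ : Finset (Fin (m + 1))), g j) : ℕ) : ℕ∞) := by
  obtain ⟨P, Q, H, hd⟩ := exists_isWeierstrass (hnz i)
  have h1 := H.ordRes_dirDeriv (hirr i) (hval i) (hnz i) hd
  have h2 : ordRes P (germPoly a (∏ j ∈ ({i}ᶜ : Finset (Fin (m + 1))), g j)) ≠ ⊤ := by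
    rw [map_prod, ordRes_prod H.monic]
    refine ENat.sum_ne_top.2 fun j hj => ?_
    exact ordRes_germPoly_ne_top (fun h => by simp [h] at hj) hirr hcop H
  have h3 : (interMult (g i) (∏ j ∈ ({i}ᶜ : Finset (Fin (m + 1))), g j) : ℕ∞) =
      ordRes P (germPoly a (∏ j ∈ ({i}ᶜ : Finset (Fin (m + 1))), g j)) := by
    rw [interMult, H.finrank_eq h2, ENat.natCast_toNat h2]
  have h4 : ∃ w, polar a g c = (c i : MvPolynomial (Fin 2) ℂ) * dirDeriv a (g i) *
      (∏ j ∈ ({i}ᶜ : Finset (Fin (m + 1))), g j) + g i * w := by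
    have : ∀ j ∈ ({i}ᶜ : Finset (Fin (m + 1))), g i ∣ (c j : MvPolynomial (Fin 2) ℂ) *
        dirDeriv a (g j) * ∏ k ∈ ({j}ᶜ : Finset (Fin (m + 1))), g k := by
      intro j hj
      refine Dvd.dvd.mul_left (Finset.dvd_prod_of_mem _ ?_) _
      simp only [Finset.mem_compl, Finset.mem_singleton] at hj ⊢
      exact Ne.symm hj
    obtain ⟨w, hw⟩ := Finset.dvd_sum this
    exact ⟨w, by rw [← hw, polar, Fintype.sum_eq_add_sum_compl i]⟩
  obtain ⟨w, hw⟩ := h4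
  rw [H'.ordRes_symm H, hw, map_add, map_mul (germPoly a) (g i), ordRes_add_mul H, map_mul, map_mul,
    ordRes_mul H.monic, ordRes_mul H.monic, ← h3, map_natCast]
  have h5 : ((c i : ℕ) : Polynomial Germ) = Polynomial.C (constGerm (c i : ℂ)) := by
    rw [map_natCast, map_natCast]
  rw [h5, ordRes_C H (by exact_mod_cast Nat.one_le_iff_ne_zero.1 (hc i)), zero_add,
    add_right_comm, h1, hd, lineMult]
  push_cast
  rfl

/-- Orders of `∏ i, g i ^ c i` along the Puiseux roots of its polar. -/
theorem exists_polar_roots (hc : ∀ i, 1 ≤ c i)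
    (hval : ∀ i, MvPolynomial.eval (0 : Fin 2 → ℂ) (g i) = 0)
    (hirr : ∀ i, Irreducible ((↑(g i) : MvPowerSeries (Fin 2) ℂ)))
    (hcop : ∀ i j, i ≠ j →
      ¬ Associated ((↑(g i) : MvPowerSeries (Fin 2) ℂ)) (↑(g j) : MvPowerSeries (Fin 2) ℂ))
    (hnz : ∀ i, (germPoly a (g i)).map (germEval 0) ≠ 0) :
    ∃ P Q, IsWeierstrass (germPoly a (polar a g c)) P Q ∧ ∃ K : ℕ, K ≠ 0 ∧ ∃ (ι : Type) (_ : Fintype ι)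
      (ξ : ι → ℂ → ℂ), (∀ i, AnalyticAt ℂ (ξ i) 0) ∧ (∀ i, ξ i 0 = 0) ∧
      (∀ᶠ t in 𝓝 0, P.map (germEval (t ^ K)) =
        ∏ i, (Polynomial.X - Polynomial.C (ξ i t))) ∧
      ∃ n : ι → ℕ, (∀ i, analyticOrderAt (fun t =>
          MvPolynomial.eval ![ξ i t, a * ξ i t + t ^ K] (∏ i, g i ^ c i)) 0 = n i) ∧
        ((∑ i, n i : ℕ) : ℤ) = K * ∑ i, (c i : ℤ) * ((milnorNumber (g i) : ℤ) + lineMult a (g i) +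
          interMult (g i) (∏ j ∈ ({i}ᶜ : Finset (Fin (m + 1))), g j) - 1) := by
  obtain ⟨P, Q, H, -⟩ := exists_isWeierstrass (lineMult_polar hc hval hnz).1
  obtain ⟨K, hK, ι, hι, ξ, hcard, hξ, hξ0, hP, -⟩ := exists_puiseux_roots H
  have h1 := ordRes_mul_eq_sum H.monic (germPoly a (∏ i, g i ^ c i)) hK hξ hP
  simp only [eval_germPoly] at h1
  have h2 : ordRes P (germPoly a (∏ i, g i ^ c i)) = ((∑ i, c i * (milnorNumber (g i) +
      lineMult a (g i) + interMult (g i) (∏ j ∈ ({i}ᶜ : Finset (Fin (m + 1))), g j) - 1) : ℕ)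
        : ℕ∞) := by
    rw [map_prod, ordRes_prod H.monic, Nat.cast_sum]
    refine Finset.sum_congr rfl fun i _ => ?_
    rw [map_pow, ordRes_pow H.monic, Nat.cast_mul]
    congr 1
    refine WithTop.add_right_cancel (z := 1) WithTop.one_ne_top ?_
    refine (ordRes_polar hc hval hirr hcop hnz H i).trans ?_
    have := lineMult_pos (hval i) (hnz i)
    have h3 : 1 ≤ milnorNumber (g i) + lineMult a (g i) +
      interMult (g i) (∏ j ∈ ({i}ᶜ : Finset (Fin (m + 1))), g j) := by omega
    conv_lhs => rw [← Nat.sub_add_cancel h3]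
    rfl
  rw [h2] at h1
  have h3 : ∀ i, analyticOrderAt (fun t =>
      MvPolynomial.eval ![ξ i t, a * ξ i t + t ^ K] (∏ i, g i ^ c i)) 0 ≠ ⊤ := by
    have : ∑ i, analyticOrderAt (fun t =>
      MvPolynomial.eval ![ξ i t, a * ξ i t + t ^ K] (∏ i, g i ^ c i)) 0 ≠ ⊤ := by
      rw [← h1]
      exact WithTop.mul_ne_top (ENat.natCast_ne_top _) (ENat.natCast_ne_top _)
    exact fun i => ENat.sum_ne_top.1 this i (Finset.mem_univ i)
  refine ⟨P, Q, H, K, hK, ι, hι, ξ, hξ, hξ0, hP, fun i => (analyticOrderAt (fun t =>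
      MvPolynomial.eval ![ξ i t, a * ξ i t + t ^ K] (∏ i, g i ^ c i)) 0).toNat,
      fun i => (ENat.natCast_toNat (h3 i)).symm, ?_⟩
  have h4 : (((∑ i, (analyticOrderAt (fun t =>
      MvPolynomial.eval ![ξ i t, a * ξ i t + t ^ K] (∏ i, g i ^ c i)) 0).toNat : ℕ)) : ℕ∞) =
      (((∑ i, c i * (milnorNumber (g i) + lineMult a (g i) +
        interMult (g i) (∏ j ∈ ({i}ᶜ : Finset (Fin (m + 1))), g j) - 1)) * K : ℕ) : ℕ∞) := by
    rw [Nat.cast_mul, h1, Nat.cast_sum]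
    exact Finset.sum_congr rfl fun i _ => ENat.natCast_toNat (h3 i)
  rw [Nat.cast_inj.1 h4, mul_comm]
  push_cast
  congr 1
  refine Finset.sum_congr rfl fun i _ => ?_
  have := lineMult_pos (hval i) (hnz i)
  rw [Nat.cast_sub (by omega)]
  push_cast
  ring

end Polar

/-! ### Roots of families of monic polynomials -/

section Roots

open Filter Topology

variable {E : Type*} [NormedAddCommGroup E] [NormedSpace ℂ E]
  {p : E → Polynomial ℂ} {e : E} {d : ℕ}

theorem continuousAt_eval (hd : ∀ y, (p y).natDegree = d) (hp : AnalyticFamily p e) (x : ℂ) :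
    ContinuousAt (fun z : E × ℂ => (p z.1).eval z.2) (e, x) :=
  ((hp.comp (f := Prod.fst) (x := (e, x)) analyticAt_fst).eval (fun y => (hd y.1).le)
    analyticAt_snd).continuousAt

/-- The roots of a monic polynomial close to a given one are close to the roots of the latter. -/
theorem eventually_exists_root_near (hm : ∀ y, (p y).Monic) (hd : ∀ y, (p y).natDegree = d)
    (hp : AnalyticFamily p e) {ρ : ℝ} (hρ : 0 < ρ) :
    ∀ᶠ y in 𝓝 e, ∀ x, (p y).eval x = 0 → ∃ x₀, (p e).eval x₀ = 0 ∧ dist x x₀ < ρ := by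
  set M : NNReal := (Finset.range d).sup (fun i => ‖(p e).coeff i‖₊) + 1 with hM
  have hlt : ∀ i ∈ Finset.range d, ‖(p e).coeff i‖₊ < M := fun i hi =>
    (Finset.le_sup (f := fun i => ‖(p e).coeff i‖₊) hi).trans_lt (lt_add_one _)
  have hbd : ∀ᶠ y in 𝓝 e, ∀ x, (p y).eval x = 0 → ‖x‖ ≤ M + 1 := by
    have := (Filter.eventually_all_finset (Finset.range d)).2 fun i hi =>
      (hp i).continuousAt.nnnorm.eventually_lt_const (hlt i hi)
    filter_upwards [this] with y hy x hx
    have h1 := Polynomial.IsRoot.norm_lt_cauchyBound (hm y).ne_zero hx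
    have h2 : Polynomial.cauchyBound (p y) ≤ M + 1 := by
      rw [Polynomial.cauchyBound, (hm y).leadingCoeff, nnnorm_one, div_one, hd y]
      gcongr
      exact Finset.sup_le fun i hi => (hy i hi).le
    exact_mod_cast (h1.trans_le h2).le
  have hK : IsCompact (Metric.closedBall (0 : ℂ) (M + 1) ∩
      {x | ∀ x₀, (p e).eval x₀ = 0 → ρ ≤ dist x x₀}) := by
    refine (isCompact_closedBall _ _).inter_right ?_
    simp only [Set.ofPred_forall]
    exact isClosed_iInter fun x₀ => isClosed_iInter fun _ =>
      isClosed_le continuous_const (continuous_id.dist continuous_const)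
  have := hK.eventually_forall_of_forall_eventually (x₀ := e)
    (P := fun y x => (p y).eval x ≠ 0) fun x hx =>
      (continuousAt_eval hd hp x).eventually_ne fun h => by
        have := hx.2 x h
        rw [dist_self] at this
        linarith
  filter_upwards [this, hbd] with y hy hb x hx
  by_contra! h
  exact hy x ⟨by simpa using hb x hx, h⟩ hx

theorem eq_prod_X_sub_C_of_injective {ι : Type*} [Fintype ι] {q : Polynomial ℂ} (hm : q.Monic)
    (hd : q.natDegree = Fintype.card ι) {ξ : ι → ℂ} (hξ : Function.Injective ξ)
    (h : ∀ k, q.eval (ξ k) = 0) : q = ∏ k, (Polynomial.X - Polynomial.C (ξ k)) := by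
  refine Polynomial.eq_of_monic_of_dvd_of_natDegree_le (Polynomial.monic_prod_X_sub_C _ _) hm
    (Finset.prod_dvd_of_coprime ?_ fun k _ => Polynomial.dvd_iff_isRoot.2 (h k)) ?_
  · exact fun i _ j _ hij => Polynomial.pairwise_coprime_X_sub_C hξ hij
  · rw [Polynomial.natDegree_prod_of_monic _ _ fun k _ => Polynomial.monic_X_sub_C _]
    simp [hd]

/-- A simple root varies analytically. -/
theorem exists_analytic_roots (hm : ∀ y, (p y).Monic) (hd : ∀ y, (p y).natDegree = d)
    (hp : AnalyticFamily p e) (hs : (p e).roots.toFinset.card = d) :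
    ∃ ξ : Fin d → E → ℂ, (∀ k, AnalyticAt ℂ (ξ k) e) ∧
      ∀ᶠ y in 𝓝 e, Function.Injective (fun k => ξ k y) ∧
        p y = ∏ k, (Polynomial.X - Polynomial.C (ξ k y)) := by
  classical
  let σ := (Finset.equivFinOfCardEq hs).symm
  have hσ : Function.Injective fun k => (σ k : ℂ) := Subtype.val_injective.comp σ.injective
  have hroot : ∀ k, (p e).eval (σ k : ℂ) = 0 := fun k =>
    Polynomial.isRoot_of_mem_roots (Multiset.mem_toFinset.1 (σ k).2)
  have hpe := eq_prod_X_sub_C_of_injective (hm e) (by simp [hd]) hσ hroot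
  have key : ∀ k, ∃ ξ : E → ℂ, AnalyticAt ℂ ξ e ∧ ξ e = σ k ∧
      ∀ᶠ y in 𝓝 e, (p y).eval (ξ y) = 0 := fun k => by
    obtain ⟨A, B, hA, -, hAa, -, hAe, -, hAB⟩ := exists_analytic_factorization (k := 1)
      (m := d - 1) (p := p) (e := e) (fun y => by rw [hd]; omega) hp
      (Polynomial.monic_X_sub_C (σ k : ℂ)) (Polynomial.natDegree_X_sub_C _)
      (b := ∏ j ∈ Finset.univ.erase k, (Polynomial.X - Polynomial.C (σ j : ℂ)))
      (by
        rw [Polynomial.natDegree_prod_of_monic _ _ fun k _ => Polynomial.monic_X_sub_C _]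
        simp)
      (IsCoprime.prod_right fun j hj => Polynomial.pairwise_coprime_X_sub_C hσ
        (Finset.ne_of_mem_erase hj).symm)
      (by rw [Finset.mul_prod_erase _ (fun k => Polynomial.X - Polynomial.C (σ k : ℂ))
        (Finset.mem_univ k)]; exact hpe)
    have hX : ∀ y, A y = Polynomial.X + Polynomial.C ((A y).coeff 0) := fun y =>
      (hA y).1.eq_X_add_C (hA y).2
    refine ⟨fun y => -(A y).coeff 0, (hAa 0).fun_neg, by simp [hAe], ?_⟩
    filter_upwards [hAB] with y hy
    rw [hy, hX y]
    simp
  choose ξ hξ hξe hξp using key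
  refine ⟨ξ, hξ, ?_⟩
  have hinj : ∀ᶠ y in 𝓝 e, ∀ i j, i ≠ j → ξ i y ≠ ξ j y := by
    simp only [Filter.eventually_all]
    intro i j hij
    have : ContinuousAt (fun y => ξ i y - ξ j y) e :=
      (hξ i).continuousAt.sub (hξ j).continuousAt
    filter_upwards [this.eventually_ne (y := 0)
      (by rw [hξe, hξe]; exact sub_ne_zero.2 (hσ.ne hij))] with y hy
    exact sub_ne_zero.1 hy
  filter_upwards [hinj, Filter.eventually_all.2 hξp] with y hy hr
  have hi : Function.Injective fun k => ξ k y := fun i j h => by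
    by_contra hij
    exact hy i j hij h
  exact ⟨hi, eq_prod_X_sub_C_of_injective (hm y) (by simp [hd]) hi hr⟩

end Roots

/-! ### The covering defined by a family of separable polynomials -/

section Covering

open Filter Topology

variable {p : ℂ → Polynomial ℂ} {W : Set ℂ} {d : ℕ}

/-- The points `(x, y)` with `y ∈ W` and `x` a root of `p y`. -/
def rootLocus (p : ℂ → Polynomial ℂ) (W : Set ℂ) : Set (ℂ × ℂ) :=
  {z | z.2 ∈ W ∧ (p z.2).eval z.1 = 0}

/-- The projection from the root locus to the parameter space. -/
def rootLocusProj (p : ℂ → Polynomial ℂ) (W : Set ℂ) (z : rootLocus p W) : W := ⟨z.1.2, z.2.1⟩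

theorem continuous_rootLocusProj : Continuous (rootLocusProj p W) := by
  unfold rootLocusProj
  fun_prop

theorem isEvenlyCovered_rootLocusProj {V : Set W} (hV : IsOpen V) {ξ : Fin d → ℂ → ℂ}
    (hξ : ∀ k, ∀ y ∈ V, ContinuousAt (ξ k) y) (hinj : ∀ y ∈ V, Function.Injective (fun k => ξ k y))
    (hp : ∀ y ∈ V, p y = ∏ k, (Polynomial.X - Polynomial.C (ξ k y))) {y : W} (hy : y ∈ V) :
    IsEvenlyCovered (rootLocusProj p W) y (Fin d) := by
  have hroot : ∀ y ∈ V, ∀ x, (p y).eval x = 0 ↔ ∃ k, ξ k y = x := fun y hy x => by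
    rw [hp y hy, Polynomial.eval_prod, Finset.prod_eq_zero_iff]
    simp [sub_eq_zero, eq_comm]
  have hk : ∀ z : rootLocusProj p W ⁻¹' V, ∃ k, ξ k z.1.1.2 = z.1.1.1 := fun z =>
    (hroot _ z.2 _).1 z.1.2.2
  choose k hk using hk
  have hkc : Continuous k := by
    rw [continuous_iff_continuousAt]
    intro z
    rw [ContinuousAt, nhds_discrete (Fin d), tendsto_pure]
    have : ∀ j, ∀ᶠ w in 𝓝 z, j ≠ k z → ξ j w.1.1.2 ≠ w.1.1.1 := fun j => by
      by_cases hj : j = k z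
      · simp [hj]
      have h1 : ContinuousAt (fun w : rootLocusProj p W ⁻¹' V => ξ j w.1.1.2 - w.1.1.1) z :=
        ((hξ j ⟨z.1.1.2, z.1.2.1⟩ z.2).comp (f := fun w : rootLocusProj p W ⁻¹' V => w.1.1.2)
          (by fun_prop)).sub (by fun_prop)
      have h2 : ξ j z.1.1.2 - z.1.1.1 ≠ 0 :=
        sub_ne_zero.2 fun h => hj (hinj _ z.2 (h.trans (hk z).symm))
      filter_upwards [h1.eventually_ne h2] with w hw _
      exact sub_ne_zero.1 hw
    filter_upwards [Filter.eventually_all.2 this] with w hw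
    by_contra h
    exact hw _ h (hk w)
  let H : rootLocusProj p W ⁻¹' V ≃ₜ V × Fin d :=
    { toFun := fun z => (⟨rootLocusProj p W z, z.2⟩, k z)
      invFun := fun v => ⟨⟨(ξ v.2 v.1, v.1), v.1.1.2, (hroot _ v.1.2 _).2 ⟨_, rfl⟩⟩, v.1.2⟩
      left_inv := fun z => by
        ext
        · exact hk z
        · rfl
      right_inv := fun v => by
        refine Prod.ext rfl (hinj v.1 v.1.2 ?_)
        exact hk _
      continuous_toFun := by
        have := continuous_rootLocusProj (p := p) (W := W)
        fun_prop
      continuous_invFun := by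
        have : Continuous fun v : V × Fin d => ξ v.2 v.1 := by
          rw [continuous_prod_of_discrete_right]
          exact fun k => continuous_iff_continuousAt.2 fun v =>
            (hξ k v v.2).comp (f := fun v : V => ((v : W) : ℂ)) (by fun_prop)
        exact ((this.prodMk (by fun_prop)).subtype_mk _).subtype_mk _ }
  exact ⟨inferInstance, V, hy, hV, hV.preimage continuous_rootLocusProj, H, fun z => rfl⟩

theorem isCoveringMap_rootLocusProj (hm : ∀ y, (p y).Monic) (hd : ∀ y, (p y).natDegree = d)
    (hp : ∀ y ∈ W, AnalyticFamily p y)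
    (hs : ∀ y ∈ W, (p y).roots.toFinset.card = d) : IsCoveringMap (rootLocusProj p W) := by
  intro y
  obtain ⟨ξ, hξ, hξp⟩ := exists_analytic_roots hm hd (hp y y.2) (hs y y.2)
  have := (Filter.eventually_all.2 fun k => (hξ k).eventually_analyticAt).and hξp
  obtain ⟨t, ht, hto, hyt⟩ := eventually_nhds_iff.1 this
  exact (isEvenlyCovered_rootLocusProj (V := Subtype.val ⁻¹' t) (hto.preimage continuous_subtype_val)
    (fun k v hv => ((ht v hv).1 k).continuousAt) (fun v hv => (ht v hv).2.1)
    (fun v hv => (ht v hv).2.2) hyt).to_isEvenlyCovered_preimage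

end Covering

/-! ### Radial contraction of a root locus -/

section Contraction

open Filter Topology

/-- The point at time `s` of the segment from `y` to `b`. -/
noncomputable def segmentPoint (b y : ℂ) (s : ℝ) : ℂ := y + s * (b - y)

theorem segmentPoint_sub (b y : ℂ) (s : ℝ) : segmentPoint b y s - b = (1 - s : ℝ) * (y - b) := by
  simp only [segmentPoint]
  push_cast
  ring

theorem norm_segmentPoint_sub (b y : ℂ) {s : ℝ} (hs : s ≤ 1) :
    ‖segmentPoint b y s - b‖ = (1 - s) * ‖y - b‖ := by
  rw [segmentPoint_sub, norm_mul, Complex.norm_real, Real.norm_of_nonneg (by linarith)]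

theorem segmentPoint_zero (b y : ℂ) : segmentPoint b y 0 = y := by simp [segmentPoint]

theorem segmentPoint_one (b y : ℂ) : segmentPoint b y 1 = b := by simp [segmentPoint]

theorem segmentPoint_mem {B : Set ℂ} (hB : Convex ℝ B) {b y : ℂ} (hb : b ∈ B) (hy : y ∈ B) {s : ℝ}
    (h0 : 0 ≤ s) (h1 : s ≤ 1) : segmentPoint b y s ∈ B := by
  have := hB.add_smul_sub_mem hy hb ⟨h0, h1⟩
  simpa [segmentPoint] using this

theorem segmentPoint_ne {b y : ℂ} (h : y ≠ b) {s : ℝ} (h1 : s < 1) : segmentPoint b y s ≠ b := by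
  rw [← sub_ne_zero, segmentPoint_sub]
  exact mul_ne_zero (by exact_mod_cast (sub_pos.2 h1).ne') (sub_ne_zero.2 h)

variable {p : ℂ → Polynomial ℂ} {B : Set ℂ} {b : ℂ} {d : ℕ}

theorem exists_radial_lift (hm : ∀ y, (p y).Monic) (hd : ∀ y, (p y).natDegree = d)
    (hB : Convex ℝ B) (hb : b ∈ B) (hp : ∀ y ∈ B, AnalyticFamily p y)
    (hs : ∀ y ∈ B, y ≠ b → (p y).roots.toFinset.card = d) :
    ∃ φ : ℂ × ℂ → ℝ → ℂ,
      ContinuousOn (fun q : (ℂ × ℂ) × ℝ => φ q.1 q.2) (rootLocus p (B \ {b}) ×ˢ Set.Ico 0 1) ∧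
      (∀ z ∈ rootLocus p (B \ {b}), φ z 0 = z.1) ∧
      ∀ z ∈ rootLocus p (B \ {b}), ∀ s ∈ Set.Ico (0 : ℝ) 1,
        (p (segmentPoint b z.2 s)).eval (φ z s) = 0 := by
  classical
  set W := B \ {b}
  have cov := isCoveringMap_rootLocusProj (W := W) hm hd (fun y hy => hp y hy.1)
    fun y hy => hs y hy.1 hy.2
  have hmem : ∀ y ∈ W, ∀ s ∈ Set.Ico (0 : ℝ) 1, segmentPoint b y s ∈ W := fun y hy s hs =>
    ⟨segmentPoint_mem hB hb hy.1 hs.1 hs.2.le, segmentPoint_ne hy.2 hs.2⟩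
  have hus : ∀ u : unitInterval, ∀ s ∈ Set.Ico (0 : ℝ) 1, u * s ∈ Set.Ico (0 : ℝ) 1 :=
    fun u s hs => ⟨mul_nonneg u.2.1 hs.1, (mul_le_of_le_one_left hs.1 u.2.2).trans_lt hs.2⟩
  let H : C(unitInterval × (rootLocus p W × Set.Ico (0 : ℝ) 1), W) :=
    ⟨fun q => ⟨segmentPoint b q.2.1.1.2 (q.1 * q.2.2), hmem _ q.2.1.2.1 _ (hus _ _ q.2.2.2)⟩, by
      unfold segmentPoint
      fun_prop⟩
  let f : C(rootLocus p W × Set.Ico (0 : ℝ) 1, rootLocus p W) := ⟨Prod.fst, continuous_fst⟩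
  have H0 : ∀ a, H (0, a) = rootLocusProj p W (f a) := fun a =>
    Subtype.ext (by simp [H, f, rootLocusProj, segmentPoint_zero])
  let L := cov.liftHomotopy H f H0
  have hL : ∀ q, rootLocusProj p W (L q) = H q := fun q =>
    congrFun (cov.liftHomotopy_lifts H f H0) q
  have hL2 : ∀ q, (L q).1.2 = H q := fun q => congrArg Subtype.val (hL q)
  refine ⟨fun z s => if h : z ∈ rootLocus p W ∧ s ∈ Set.Ico (0 : ℝ) 1 then
    (L (1, ⟨z, h.1⟩, ⟨s, h.2⟩)).1.1 else 0, ?_, fun z hz => ?_, fun z hz s hs => ?_⟩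
  · rw [continuousOn_iff_continuous_domRestrict]
    have : Continuous fun q : ↥(rootLocus p W ×ˢ Set.Ico (0 : ℝ) 1) =>
        (L (1, ⟨q.1.1, q.2.1⟩, ⟨q.1.2, q.2.2⟩)).1.1 := by fun_prop
    refine this.congr fun q => ?_
    simp only [Set.domRestrict_apply]
    rw [dif_pos ⟨q.2.1, q.2.2⟩]
  · have h : z ∈ rootLocus p W ∧ (0 : ℝ) ∈ Set.Ico (0 : ℝ) 1 := ⟨hz, by simp⟩
    simp only [dif_pos h]
    let a : rootLocus p W × Set.Ico (0 : ℝ) 1 := (⟨z, hz⟩, ⟨0, by simp⟩)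
    have h1 : L (1, a) = cov.liftPath (.const unitInterval ⟨z.2, hz.1⟩) ⟨z, hz⟩ rfl 1 := by
      simp only [L, IsCoveringMap.liftHomotopy_apply]
      congr 2
      ext u
      simp [H, a, segmentPoint_zero]
    have h2 := cov.liftPath_const (x := ⟨z.2, hz.1⟩) (e := (⟨z, hz⟩ : rootLocus p W)) rfl
    change (L (1, a)).1.1 = z.1
    rw [h1]
    exact congrArg (fun g : C(unitInterval, rootLocus p W) => (g 1).1.1) h2
  · simp only [dif_pos (show z ∈ rootLocus p W ∧ s ∈ Set.Ico (0 : ℝ) 1 from ⟨hz, hs⟩)]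
    have h := (L (1, ⟨z, hz⟩, ⟨s, hs⟩)).2.2
    rw [hL2] at h
    simpa [H] using h

theorem exists_separation (s : Finset ℂ) :
    ∃ ρ > (0 : ℝ), ∀ x ∈ s, ∀ x' ∈ s, dist x x' < 2 * ρ → x = x' := by
  have : ∀ x ∈ s, ∀ x' ∈ s, ∀ᶠ ρ in 𝓝[>] (0 : ℝ), dist x x' < 2 * ρ → x = x' := by
    intro x _ x' _
    by_cases h : x = x'
    · simp [h]
    · have : Tendsto (fun ρ : ℝ => 2 * ρ) (𝓝[>] 0) (𝓝 0) := by
        have : ContinuousAt (fun ρ : ℝ => 2 * ρ) 0 := by fun_prop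
        simpa [ContinuousAt] using this.tendsto.mono_left nhdsWithin_le_nhds
      filter_upwards [this.eventually_lt_const (dist_pos.2 h)] with ρ h1 h2
      exact absurd (h1.trans h2) (lt_irrefl _)
  have h2 := (Filter.eventually_all_finset s).2 fun x hx =>
    (Filter.eventually_all_finset s).2 (this x hx)
  obtain ⟨ρ, h, hρ⟩ := (h2.and self_mem_nhdsWithin).exists
  exact ⟨ρ, hρ, h⟩

theorem exists_time_lt (c : ℝ) {τ : ℝ} (hτ : 0 < τ) :
    ∃ s, s ∈ Set.Ico (0 : ℝ) 1 ∧ (1 - s) * c < τ := by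
  have : Tendsto (fun s : ℝ => (1 - s) * c) (𝓝[<] 1) (𝓝 0) := by
    have : ContinuousAt (fun s : ℝ => (1 - s) * c) 1 := by fun_prop
    simpa [ContinuousAt] using this.tendsto.mono_left nhdsWithin_le_nhds
  obtain ⟨s, h, hs⟩ := ((this.eventually_lt_const hτ).and
    (Ioo_mem_nhdsLT (zero_lt_one' ℝ))).exists
  exact ⟨s, ⟨hs.1.le, hs.2⟩, h⟩

/-- Along the segments towards `b`, roots converge uniformly to roots over `b`. -/
theorem exists_uniform_limit (hm : ∀ y, (p y).Monic) (hd : ∀ y, (p y).natDegree = d)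
    (hp : AnalyticFamily p b) {φ : ℂ × ℂ → ℝ → ℂ}
    (hφ : ContinuousOn (fun q : (ℂ × ℂ) × ℝ => φ q.1 q.2) (rootLocus p (B \ {b}) ×ˢ Set.Ico 0 1))
    (hr : ∀ z ∈ rootLocus p (B \ {b}), ∀ s ∈ Set.Ico (0 : ℝ) 1,
        (p (segmentPoint b z.2 s)).eval (φ z s) = 0) :
    ∃ Λ : ℂ × ℂ → ℂ, (∀ z ∈ rootLocus p (B \ {b}), (p b).eval (Λ z) = 0) ∧
      ∀ ρ > 0, ∃ τ > 0, ∀ z ∈ rootLocus p (B \ {b}), ∀ s ∈ Set.Ico (0 : ℝ) 1,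
        (1 - s) * ‖z.2 - b‖ < τ → dist (φ z s) (Λ z) < ρ := by
  classical
  set W := B \ {b}
  obtain ⟨ρ₀, hρ₀, hsep⟩ := exists_separation (p b).roots.toFinset
  have hroot : ∀ x, x ∈ (p b).roots.toFinset ↔ (p b).eval x = 0 := fun x => by
    rw [Multiset.mem_toFinset, Polynomial.mem_roots (hm b).ne_zero, Polynomial.IsRoot.def]
  have key : ∀ ρ > 0, ρ ≤ ρ₀ → ∃ τ > 0, ∀ z ∈ rootLocus p W, ∃ x₀, (p b).eval x₀ = 0 ∧
      ∀ s ∈ Set.Ico (0 : ℝ) 1, (1 - s) * ‖z.2 - b‖ < τ → dist (φ z s) x₀ < ρ := by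
    intro ρ hρ hρρ
    obtain ⟨τ, hτ, hn⟩ := Metric.eventually_nhds_iff.1 (eventually_exists_root_near hm hd hp hρ)
    refine ⟨τ, hτ, fun z hz => ?_⟩
    have hnear : ∀ s ∈ Set.Ico (0 : ℝ) 1, (1 - s) * ‖z.2 - b‖ < τ →
        ∃ x₀, (p b).eval x₀ = 0 ∧ dist (φ z s) x₀ < ρ := fun s hs h =>
      hn (by rwa [dist_eq_norm, norm_segmentPoint_sub b _ hs.2.le]) _ (hr z hz s hs)
    let S := {s ∈ Set.Ico (0 : ℝ) 1 | (1 - s) * ‖z.2 - b‖ < τ}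
    have hS : _root_.IsPreconnected S := by
      refine Set.OrdConnected.isPreconnected ⟨fun s hs s' hs' r hr =>
        ⟨⟨hs.1.1.trans hr.1, hr.2.trans_lt hs'.1.2⟩, lt_of_le_of_lt ?_ hs.2⟩⟩
      gcongr
      exact hr.1
    obtain ⟨s₁, hs₁⟩ : S.Nonempty := exists_time_lt _ hτ
    obtain ⟨x₀, hx₀, hd₀⟩ := hnear s₁ hs₁.1 hs₁.2
    refine ⟨x₀, hx₀, fun s hs h => ?_⟩
    have hc : ContinuousOn (φ z) S := hφ.comp (f := fun s : ℝ => (z, s))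
      (by fun_prop) fun s hs => ⟨hz, hs.1⟩
    have hne : (φ z '' S ∩ Metric.ball x₀ ρ).Nonempty := ⟨φ z s₁, ⟨s₁, hs₁, rfl⟩, hd₀⟩
    have := (hS.image (φ z) hc).subset_left_of_subset_union (u := Metric.ball x₀ ρ)
      (v := ⋃ x ∈ {x | (p b).eval x = 0 ∧ x ≠ x₀}, Metric.ball x ρ) Metric.isOpen_ball
      (isOpen_biUnion fun _ _ => Metric.isOpen_ball) ?_ ?_ hne
    · exact this ⟨s, ⟨hs, h⟩, rfl⟩
    · refine Set.disjoint_iUnion₂_right.2 fun x hx => Metric.ball_disjoint_ball ?_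
      by_contra! hlt
      exact hx.2 (hsep _ ((hroot x).2 hx.1) _ ((hroot _).2 hx₀) (by rw [dist_comm]; linarith))
    · rintro _ ⟨s, hs, rfl⟩
      obtain ⟨x, hx, hxd⟩ := hnear s hs.1 hs.2
      by_cases h : x = x₀
      · left
        rw [← h]
        exact hxd
      · right
        exact Set.mem_biUnion (show x ∈ {x | (p b).eval x = 0 ∧ x ≠ x₀} from ⟨hx, h⟩) hxd
  obtain ⟨τ₀, hτ₀, h₀⟩ := key ρ₀ hρ₀ le_rfl
  choose! Λ hΛ hΛ' using h₀
  refine ⟨Λ, hΛ, fun ρ hρ => ?_⟩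
  obtain ⟨τ, hτ, h⟩ := key (min ρ ρ₀) (lt_min hρ hρ₀) (min_le_right _ _)
  refine ⟨min τ τ₀, lt_min hτ hτ₀, fun z hz s hs hlt => ?_⟩
  obtain ⟨x₀, hx₀, hx₀'⟩ := h z hz
  have h1 := hx₀' s hs (hlt.trans_le (min_le_left _ _))
  have h2 := hΛ' z hz s hs (hlt.trans_le (min_le_right _ _))
  have : x₀ = Λ z := hsep _ ((hroot _).2 hx₀) _ ((hroot _).2 (hΛ z hz)) (by
    have := dist_triangle_left x₀ (Λ z) (φ z s)
    have := h1.trans_le (min_le_right _ _)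
    linarith)
  rw [← this]
  exact h1.trans_le (min_le_left _ _)

end Contraction

section Contraction

open Filter Topology

variable {p : ℂ → Polynomial ℂ} {B : Set ℂ} {b : ℂ} {d : ℕ}

/-- The contraction along segments towards `b`, extended to time one by limits. -/
noncomputable def contraction (b : ℂ) (φ : ℂ × ℂ → ℝ → ℂ) (Λ : ℂ × ℂ → ℂ) (q : (ℂ × ℂ) × ℝ) : ℂ :=
  open Classical in if q.1.2 = b then q.1.1 else if q.2 < 1 then φ q.1 q.2 else Λ q.1

variable {φ : ℂ × ℂ → ℝ → ℂ} {Λ : ℂ × ℂ → ℂ}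

theorem contraction_of_eq {z : ℂ × ℂ} (h : z.2 = b) (s : ℝ) : contraction b φ Λ (z, s) = z.1 := by
  simp [contraction, h]

theorem contraction_of_lt {z : ℂ × ℂ} (h : z.2 ≠ b) {s : ℝ} (hs : s < 1) :
    contraction b φ Λ (z, s) = φ z s := by
  simp [contraction, h, hs]

theorem contraction_one {z : ℂ × ℂ} (h : z.2 ≠ b) : contraction b φ Λ (z, 1) = Λ z := by
  simp [contraction, h]

theorem continuousOn_contraction (hm : ∀ y, (p y).Monic)
    (hφ : ContinuousOn (fun q : (ℂ × ℂ) × ℝ => φ q.1 q.2) (rootLocus p (B \ {b}) ×ˢ Set.Ico 0 1))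
    (h0 : ∀ z ∈ rootLocus p (B \ {b}), φ z 0 = z.1)
    (hΛ : ∀ z ∈ rootLocus p (B \ {b}), (p b).eval (Λ z) = 0)
    (hlim : ∀ ρ > 0, ∃ τ > 0, ∀ z ∈ rootLocus p (B \ {b}), ∀ s ∈ Set.Ico (0 : ℝ) 1,
        (1 - s) * ‖z.2 - b‖ < τ → dist (φ z s) (Λ z) < ρ) :
    ContinuousOn (contraction b φ Λ) (rootLocus p B ×ˢ Set.Icc 0 1) := by
  classical
  obtain ⟨ρ₀, hρ₀, hsep⟩ := exists_separation (p b).roots.toFinset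
  have hroot : ∀ x, x ∈ (p b).roots.toFinset ↔ (p b).eval x = 0 := fun x => by
    rw [Multiset.mem_toFinset, Polynomial.mem_roots (hm b).ne_zero, Polynomial.IsRoot.def]
  have hmem : ∀ z ∈ rootLocus p B, z.2 ≠ b → z ∈ rootLocus p (B \ {b}) := fun z hz h =>
    ⟨⟨hz.1, h⟩, hz.2⟩
  have hlim' : ∀ ρ > 0, ∃ τ > 0, ∀ z ∈ rootLocus p (B \ {b}), ∀ s ∈ Set.Icc (0 : ℝ) 1,
      (1 - s) * ‖z.2 - b‖ < τ → dist (contraction b φ Λ (z, s)) (Λ z) < ρ := fun ρ hρ => by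
    obtain ⟨τ, hτ, h⟩ := hlim ρ hρ
    refine ⟨τ, hτ, fun z hz s hs hlt => ?_⟩
    rcases hs.2.lt_or_eq with h1 | rfl
    · rw [contraction_of_lt hz.1.2 h1]
      exact h z hz s ⟨hs.1, h1⟩ hlt
    · rwa [contraction_one hz.1.2, dist_self]
  rintro ⟨z₀, s₀⟩ ⟨hz₀, hs₀⟩
  dsimp only at hz₀ hs₀
  have hev : ∀ᶠ q : (ℂ × ℂ) × ℝ in 𝓝[rootLocus p B ×ˢ Set.Icc 0 1] (z₀, s₀),
      q.1 ∈ rootLocus p B ∧ q.2 ∈ Set.Icc (0 : ℝ) 1 := self_mem_nhdsWithin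
  have hcont : ∀ {g : (ℂ × ℂ) × ℝ → ℝ} {c : ℝ}, Continuous g → g (z₀, s₀) < c →
      ∀ᶠ q : (ℂ × ℂ) × ℝ in 𝓝[rootLocus p B ×ˢ Set.Icc 0 1] (z₀, s₀), g q < c := fun hg h =>
    nhdsWithin_le_nhds (hg.continuousAt.eventually_lt_const h)
  by_cases hb : z₀.2 = b
  · rw [ContinuousWithinAt, Metric.tendsto_nhds]
    intro ρ hρ
    rw [contraction_of_eq hb]
    obtain ⟨τ, hτ, h⟩ := hlim' (min ρ ρ₀) (lt_min hρ hρ₀)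
    filter_upwards [hev,
      hcont (g := fun q => ‖q.1.2 - b‖) (c := τ) (by fun_prop) (by simpa [hb] using hτ),
      hcont (g := fun q => dist q.1.1 z₀.1) (c := min ρ ρ₀) (by fun_prop)
        (by simpa using lt_min hρ hρ₀)] with q hq h1 h2
    rcases eq_or_ne q.1.2 b with hqb | hqb
    · rw [contraction_of_eq hqb]
      exact h2.trans_le (min_le_left _ _)
    · have hqW := hmem _ hq.1 hqb
      have h3 : ∀ s ∈ Set.Icc (0 : ℝ) 1, (1 - s) * ‖q.1.2 - b‖ < τ := fun s hs =>
        (mul_le_of_le_one_left (norm_nonneg _) (by linarith [hs.1])).trans_lt h1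
      have h4 := h q.1 hqW 0 (by simp) (h3 0 (by simp))
      rw [contraction_of_lt hqb one_pos, h0 _ hqW] at h4
      have h5 : Λ q.1 = z₀.1 := hsep _ ((hroot _).2 (hΛ _ hqW)) _
        ((hroot _).2 (by simpa [hb] using hz₀.2)) (by
          have := dist_triangle_left (Λ q.1) z₀.1 q.1.1
          have := h4.trans_le (min_le_right _ _)
          have := h2.trans_le (min_le_right _ _)
          linarith)
      rw [← h5]
      exact (h q.1 hqW q.2 hq.2 (h3 _ hq.2)).trans_le (min_le_left _ _)
  have hz₀W := hmem _ hz₀ hb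
  have hevb : ∀ᶠ q : (ℂ × ℂ) × ℝ in 𝓝[rootLocus p B ×ˢ Set.Icc 0 1] (z₀, s₀), q.1.2 ≠ b :=
    nhdsWithin_le_nhds ((show Continuous fun q : (ℂ × ℂ) × ℝ => q.1.2 by fun_prop).continuousAt.eventually_ne hb)
  have hφ' : ∀ s ∈ Set.Ico (0 : ℝ) 1, Tendsto (fun q : (ℂ × ℂ) × ℝ => φ q.1 q.2)
      (𝓝[rootLocus p (B \ {b}) ×ˢ Set.Ico 0 1] (z₀, s)) (𝓝 (φ z₀ s)) := fun s hs =>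
    hφ (z₀, s) ⟨hz₀W, hs⟩
  rcases hs₀.2.lt_or_eq with h1 | rfl
  · rw [ContinuousWithinAt, contraction_of_lt hb h1]
    have hevs := hcont (g := fun q => q.2) (c := 1) (by fun_prop) h1
    have ht : Tendsto id (𝓝[rootLocus p B ×ˢ Set.Icc 0 1] (z₀, s₀))
        (𝓝[rootLocus p (B \ {b}) ×ˢ Set.Ico 0 1] (z₀, s₀)) := by
      refine tendsto_nhdsWithin_iff.2 ⟨nhdsWithin_le_nhds, ?_⟩
      filter_upwards [hev, hevb, hevs] with q hq h2 h3
      exact ⟨hmem _ hq.1 h2, hq.2.1, h3⟩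
    refine ((hφ' s₀ ⟨hs₀.1, h1⟩).comp ht).congr' ?_
    filter_upwards [hevb, hevs] with q h2 h3
    exact (contraction_of_lt h2 h3).symm
  · rw [ContinuousWithinAt, contraction_one hb, Metric.tendsto_nhds]
    intro ρ hρ
    obtain ⟨τ, hτ, h⟩ := hlim' (min ρ ρ₀) (lt_min hρ hρ₀)
    obtain ⟨s₁, hs₁, hlt⟩ := exists_time_lt ‖z₀.2 - b‖ hτ
    have hd := h z₀ hz₀W s₁ ⟨hs₁.1, hs₁.2.le⟩ hlt
    rw [contraction_of_lt hb hs₁.2] at hd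
    have ht : Tendsto (fun q : (ℂ × ℂ) × ℝ => (q.1, s₁))
        (𝓝[rootLocus p B ×ˢ Set.Icc 0 1] (z₀, 1))
        (𝓝[rootLocus p (B \ {b}) ×ˢ Set.Ico 0 1] (z₀, s₁)) := by
      refine tendsto_nhdsWithin_iff.2 ⟨?_, ?_⟩
      · have : ContinuousAt (fun q : (ℂ × ℂ) × ℝ => (q.1, s₁)) (z₀, 1) := by fun_prop
        exact this.tendsto.mono_left nhdsWithin_le_nhds
      · filter_upwards [hev, hevb] with q hq h2
        exact ⟨hmem _ hq.1 h2, hs₁⟩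
    have hnear : ∀ᶠ q : (ℂ × ℂ) × ℝ in 𝓝[rootLocus p B ×ˢ Set.Icc 0 1] (z₀, 1),
        dist (φ q.1 s₁) (Λ z₀) < min ρ ρ₀ :=
      (((hφ' s₁ hs₁).comp ht).dist tendsto_const_nhds).eventually_lt_const hd
    filter_upwards [hev, hevb, hnear,
      hcont (g := fun q => (1 - s₁) * ‖q.1.2 - b‖) (by fun_prop) hlt,
      hcont (g := fun q => (1 - q.2) * ‖q.1.2 - b‖) (c := τ) (by fun_prop) (by simpa using hτ)]
      with q hq h2 h3 h4 h5
    have hqW := hmem _ hq.1 h2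
    have h6 := h q.1 hqW s₁ ⟨hs₁.1, hs₁.2.le⟩ h4
    rw [contraction_of_lt h2 hs₁.2] at h6
    have h7 : Λ q.1 = Λ z₀ := hsep _ ((hroot _).2 (hΛ _ hqW)) _ ((hroot _).2 (hΛ _ hz₀W)) (by
      have := dist_triangle_left (Λ q.1) (Λ z₀) (φ q.1 s₁)
      have := h3.trans_le (min_le_right _ _)
      have := h6.trans_le (min_le_right _ _)
      linarith)
    rw [← h7]
    exact (h q.1 hqW q.2 hq.2 h5).trans_le (min_le_left _ _)

/-- A root locus over a convex set contracts to the roots over its only branch point. -/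
theorem nonempty_homotopyEquiv_roots (hm : ∀ y, (p y).Monic) (hd : ∀ y, (p y).natDegree = d)
    (hB : Convex ℝ B) (hb : b ∈ B) (hp : ∀ y ∈ B, AnalyticFamily p y)
    (hs : ∀ y ∈ B, y ≠ b → (p y).roots.toFinset.card = d) {K : Set (ℂ × ℂ)}
    (hKb : ∀ x, (p b).eval x = 0 → (x, b) ∈ K)
    (hK : ∀ y ∈ B, y ≠ b → ∀ s ∈ Set.Ico (0 : ℝ) 1, ∀ x : ℝ → ℂ, ContinuousOn x (Set.Icc 0 s) →
      (∀ r ∈ Set.Icc 0 s, (p (segmentPoint b y r)).eval (x r) = 0) → (x 0, y) ∈ K →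
      (x s, segmentPoint b y s) ∈ K) :
    Nonempty (ContinuousMap.HomotopyEquiv ↥(rootLocus p B ∩ K) {x | (p b).eval x = 0}) := by
  obtain ⟨φ, hφ, h0, hr⟩ := exists_radial_lift hm hd hB hb hp hs
  obtain ⟨Λ, hΛ, hlim⟩ := exists_uniform_limit hm hd (hp b hb) hφ hr
  have hc := continuousOn_contraction hm hφ h0 hΛ hlim
  set Φ := contraction b φ Λ with hΦ
  have hmem : ∀ z ∈ rootLocus p B, z.2 ≠ b → z ∈ rootLocus p (B \ {b}) := fun z hz h =>
    ⟨⟨hz.1, h⟩, hz.2⟩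
  have hΦ0 : ∀ z ∈ rootLocus p B, Φ (z, 0) = z.1 := fun z hz => by
    rcases eq_or_ne z.2 b with h | h
    · exact contraction_of_eq h _
    · rw [hΦ, contraction_of_lt h one_pos, h0 _ (hmem z hz h)]
  have hΦ1 : ∀ z ∈ rootLocus p B, (p b).eval (Φ (z, 1)) = 0 := fun z hz => by
    rcases eq_or_ne z.2 b with h | h
    · rw [hΦ, contraction_of_eq h, ← h]
      exact hz.2
    · rw [hΦ, contraction_one h]
      exact hΛ _ (hmem z hz h)
  have hΦK : ∀ z ∈ rootLocus p B ∩ K, ∀ s ∈ Set.Icc (0 : ℝ) 1,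
      (Φ (z, s), segmentPoint b z.2 s) ∈ rootLocus p B ∩ K := fun z hz s hs => by
    have hB' := segmentPoint_mem hB hb hz.1.1 hs.1 hs.2
    rcases eq_or_ne z.2 b with h | h
    · have h' : segmentPoint b z.2 s = z.2 := by simp [segmentPoint, h]
      rw [h', hΦ, contraction_of_eq h]
      exact hz
    rcases hs.2.lt_or_eq with h1 | rfl
    · have hW := hmem z hz.1 h
      rw [hΦ, contraction_of_lt h h1]
      refine ⟨⟨hB', hr z hW s ⟨hs.1, h1⟩⟩, hK z.2 hz.1.1 h s ⟨hs.1, h1⟩ (φ z) ?_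
        (fun r hr' => hr z hW r ⟨hr'.1, hr'.2.trans_lt h1⟩) (by rw [h0 z hW]; exact hz.2)⟩
      exact hφ.comp (f := fun r : ℝ => (z, r)) (by fun_prop)
        fun r hr' => ⟨hW, hr'.1, hr'.2.trans_lt h1⟩
    · have := hΦ1 z hz.1
      rw [segmentPoint_one]
      exact ⟨⟨hb, this⟩, hKb _ this⟩
  have hc' : Continuous fun q : unitInterval × ↥(rootLocus p B ∩ K) => Φ (q.2, q.1) :=
    hc.comp_continuous (f := fun q : unitInterval × ↥(rootLocus p B ∩ K) => ((q.2 : ℂ × ℂ), (q.1 : ℝ)))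
      (by fun_prop) fun q => ⟨q.2.2.1, q.1.2⟩
  let f : C(↥(rootLocus p B ∩ K), {x | (p b).eval x = 0}) :=
    ⟨fun z => ⟨Φ (z, 1), hΦ1 z z.2.1⟩, (hc'.comp (f := fun z => (1, z)) (by fun_prop)).subtype_mk _⟩
  let g : C({x | (p b).eval x = 0}, ↥(rootLocus p B ∩ K)) :=
    ⟨fun x => ⟨(x, b), ⟨hb, x.2⟩, hKb _ x.2⟩, by fun_prop⟩
  let F : C(unitInterval × ↥(rootLocus p B ∩ K), ↥(rootLocus p B ∩ K)) :=
    ⟨fun q => ⟨(Φ (q.2, q.1), segmentPoint b q.2.1.2 q.1), hΦK q.2 q.2.2 q.1 q.1.2⟩, by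
      refine (hc'.prodMk ?_).subtype_mk _
      unfold segmentPoint
      fun_prop⟩
  have hfg : (g.comp f).Homotopic (ContinuousMap.id _) := by
    refine ContinuousMap.Homotopic.symm ⟨⟨F, fun z => ?_, fun z => ?_⟩⟩
    · refine Subtype.ext (Prod.ext ?_ ?_)
      · exact hΦ0 z z.2.1
      · exact segmentPoint_zero _ _
    · refine Subtype.ext (Prod.ext ?_ ?_)
      · rfl
      · exact segmentPoint_one _ _
  have hgf : f.comp g = ContinuousMap.id _ := by
    ext x
    exact contraction_of_eq rfl _
  exact ⟨⟨f, g, hfg, by rw [hgf]⟩⟩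

end Contraction

section BranchedCover

open Filter Topology

variable {p : ℂ → Polynomial ℂ} {d : ℕ}

/-- The subspace of a subspace given by a smaller set is homeomorphic to the smaller set. -/
def preimageValHomeomorph {X : Type*} [TopologicalSpace X] {S T : Set X} (h : T ⊆ S) :
    ↥(Subtype.val ⁻¹' T : Set S) ≃ₜ T where
  toFun z := ⟨z.1.1, z.2⟩
  invFun z := ⟨⟨z.1, h z.2⟩, z.2⟩
  left_inv _ := rfl
  right_inv _ := rfl

theorem exists_Ioo_disjoint (s : Finset ℝ) {a b : ℝ} (h : a < b) :
    ∃ l u, a ≤ l ∧ l < u ∧ u ≤ b ∧ ∀ x ∈ s, x ∉ Set.Ioo l u := by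
  induction s using Finset.induction_on with
  | empty => exact ⟨a, b, le_rfl, h, le_rfl, by simp⟩
  | insert c s _ ih =>
    obtain ⟨l, u, h1, h2, h3, h4⟩ := ih
    rcases le_or_gt c l with hc | hc
    · refine ⟨l, u, h1, h2, h3, fun x hx => ?_⟩
      rcases Finset.mem_insert.1 hx with rfl | hx
      · exact fun h => absurd h.1 hc.not_gt
      · exact h4 x hx
    · refine ⟨l, min c u, h1, lt_min hc h2, (min_le_right _ _).trans h3, fun x hx => ?_⟩
      rcases Finset.mem_insert.1 hx with rfl | hx
      · exact fun h => absurd h.2 (min_le_left _ _).not_gt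
      · exact fun h => h4 x hx ⟨h.1, h.2.trans_le (min_le_right _ _)⟩

/-- A family of monic polynomials over a set `D`, separable away from finitely many points of a
smaller set `D'`, together with a set `K` of points preserved by moving roots towards `D'`. -/
structure BranchData (p : ℂ → Polynomial ℂ) (d : ℕ) (D D' : Set ℂ) (br : Finset ℂ)
    (K : Set (ℂ × ℂ)) : Prop where
  monic : ∀ y, (p y).Monic
  natDegree : ∀ y, (p y).natDegree = d
  analytic : ∀ y ∈ D, AnalyticFamily p y
  convex : Convex ℝ D'
  br_subset : ∀ y ∈ br, y ∈ D'
  card : ∀ y ∈ D, y ∉ br → (p y).roots.toFinset.card = d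
  mem : ∀ y ∈ D', ∀ x, (p y).eval x = 0 → (x, y) ∈ K
  move : ∀ b ∈ D', ∀ y ∈ D, y ≠ b → ∀ s ∈ Set.Ico (0 : ℝ) 1, ∀ x : ℝ → ℂ,
    ContinuousOn x (Set.Icc 0 s) → (∀ r ∈ Set.Icc 0 s, (p (segmentPoint b y r)).eval (x r) = 0) →
    (x 0, y) ∈ K → (x s, segmentPoint b y s) ∈ K

namespace BranchData

variable {D D' : Set ℂ} {br : Finset ℂ} {K : Set (ℂ × ℂ)} (h : BranchData p d D D' br K)
include h

theorem goodSpace_of_center {B : Set ℂ} (hB : Convex ℝ B) (hBD : B ⊆ D) {b : ℂ} (hb : b ∈ B)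
    (hbD : b ∈ D') (hbr : ∀ y ∈ br, y ∈ B → y = b) :
    GoodSpace ↥(rootLocus p B ∩ K) (p b).roots.toFinset.card ∧
      Limits.IsZero ((singComplex ↥(rootLocus p B ∩ K)).homology 1) := by
  obtain ⟨e⟩ := nonempty_homotopyEquiv_roots (K := K) h.monic h.natDegree hB hb
    (fun y hy => h.analytic y (hBD hy))
    (fun y hy hyb => h.card y (hBD hy) fun hy' => hyb (hbr y hy' hy)) (h.mem b hbD)
    (fun y hy => h.move b hbD y (hBD hy))
  have hset : {x | (p b).eval x = 0} = ((p b).roots.toFinset : Set ℂ) := by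
    ext x
    simp [(h.monic b).ne_zero]
  have hfin : Finite {x | (p b).eval x = 0} := by
    rw [hset]
    exact Finset.finite_toSet _
  have hcard : Nat.card {x | (p b).eval x = 0} = (p b).roots.toFinset.card := by
    rw [hset, Nat.card_coe_set_eq, Set.ncard_coe_finset]
  have := Finite.instDiscreteTopology (X := {x | (p b).eval x = 0})
  refine ⟨?_, ?_⟩
  · rw [← hcard]
    exact (goodSpace_of_finite).of_homotopyEquiv e.symm
  · exact isZero_homology_of_homotopyEquiv e.symm (isZero_homology_of_discrete one_ne_zero)

theorem goodSpace_aux (n : ℕ) : ∀ B : Set ℂ, IsOpen B → Convex ℝ B → B ⊆ D → (B ∩ D').Nonempty →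
    ∀ s : Finset ℂ, (∀ y, y ∈ s ↔ y ∈ br ∧ y ∈ B) → s.card ≤ n →
    GoodSpace ↥(rootLocus p B ∩ K) (d - ∑ b ∈ s, ((d : ℤ) - (p b).roots.toFinset.card)) := by
  induction n with
  | zero =>
    intro B _ hB hBD ⟨b, hbB, hbD⟩ s hs hsn
    obtain rfl : s = ∅ := by simpa using hsn
    have hb : b ∉ br := fun hb => by simpa using (hs b).2 ⟨hb, hbB⟩
    have := (h.goodSpace_of_center hB hBD hbB hbD fun y hy hyB => by
      simpa using (hs y).2 ⟨hy, hyB⟩).1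
    rw [h.card b (hBD hbB) hb] at this
    simpa using this
  | succ n ih =>
    intro B hBo hB hBD hne s hs hsn
    by_cases h1 : ∀ b₁ ∈ s, ∀ b₂ ∈ s, b₁ = b₂
    · rcases s.eq_empty_or_nonempty with rfl | ⟨b, hb⟩
      · exact ih B hBo hB hBD hne ∅ hs (by simp)
      · obtain rfl : s = {b} := Finset.eq_singleton_iff_unique_mem.2 ⟨hb, fun y hy => h1 _ hy _ hb⟩
        have hb' := (hs b).1 hb
        have := (h.goodSpace_of_center hB hBD hb'.2 (h.br_subset b hb'.1) fun y hy hyB =>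
          h1 _ ((hs y).2 ⟨hy, hyB⟩) _ hb).1
        simpa using this
    push Not at h1
    obtain ⟨b₁, hb₁, b₂, hb₂, hbb⟩ := h1
    let L : ℂ →L[ℝ] ℝ := Complex.reCLM.comp
      ((ContinuousLinearMap.mul ℝ ℂ) ((starRingEnd ℂ) (b₂ - b₁)))
    have hL : L b₁ < L b₂ := by
      rw [← sub_pos, ← map_sub]
      simp only [L, ContinuousLinearMap.comp_apply, ContinuousLinearMap.mul_apply']
      rw [mul_comm, Complex.mul_conj]
      simpa using Complex.normSq_pos.2 (sub_ne_zero.2 hbb.symm)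
    obtain ⟨l, u, hl, hlu, hu, hI⟩ := exists_Ioo_disjoint (br.image L) hL
    set B₁ := B ∩ {z | L z < u} with hB₁
    set B₂ := B ∩ {z | l < L z} with hB₂
    have hb₁' := (hs b₁).1 hb₁
    have hb₂' := (hs b₂).1 hb₂
    have o₁ : IsOpen {z | L z < u} := isOpen_lt L.continuous continuous_const
    have o₂ : IsOpen {z | l < L z} := isOpen_lt continuous_const L.continuous
    have c₁ : Convex ℝ B₁ := hB.inter (convex_halfSpace_lt L.toLinearMap.isLinear u)
    have c₂ : Convex ℝ B₂ := hB.inter (convex_halfSpace_gt L.toLinearMap.isLinear l)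
    have g₁ := ih B₁ (hBo.inter o₁) c₁ (Set.inter_subset_left.trans hBD)
      ⟨b₁, ⟨hb₁'.2, show L b₁ < u by linarith⟩, h.br_subset _ hb₁'.1⟩ (s.filter (L · < u))
      (fun y => by rw [Finset.mem_filter, hs, hB₁]; exact and_assoc)
      (Nat.le_of_lt_succ <| (Finset.card_lt_card <| (Finset.filter_ssubset (p := (L · < u))).2
        ⟨b₂, hb₂, not_lt.2 hu⟩).trans_le hsn)
    have g₂ := ih B₂ (hBo.inter o₂) c₂ (Set.inter_subset_left.trans hBD)
      ⟨b₂, ⟨hb₂'.2, show l < L b₂ by linarith⟩, h.br_subset _ hb₂'.1⟩ (s.filter (¬ L · < u))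
      (fun y => by
        rw [Finset.mem_filter, hs, hB₂, and_assoc, Set.mem_inter_iff, Set.mem_ofPred_eq]
        refine and_congr_right fun hy => and_congr_right fun _ => ⟨fun hy' => ?_, fun hy' => ?_⟩
        · exact hlu.trans_le (not_lt.1 hy')
        · exact fun hy'' => hI _ (Finset.mem_image_of_mem L hy) ⟨hy', hy''⟩)
      (Nat.le_of_lt_succ <| (Finset.card_lt_card <| (Finset.filter_ssubset (p := fun y => ¬ L y < u)).2
        ⟨b₁, hb₁, by rw [not_not]; linarith⟩).trans_le hsn)
    obtain ⟨b, hb, hbL⟩ : ∃ b ∈ segment ℝ b₁ b₂, L b = (l + u) / 2 := by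
      have := image_segment ℝ L.toLinearMap.toAffineMap b₁ b₂
      have h2 : (l + u) / 2 ∈ segment ℝ (L b₁) (L b₂) := by
        rw [segment_eq_Icc hL.le]
        exact ⟨by linarith, by linarith⟩
      exact (Set.ext_iff.1 this _).2 h2
    have hbB : b ∈ B₁ ∩ B₂ := by
      have := hB.segment_subset hb₁'.2 hb₂'.2 hb
      exact ⟨⟨this, by rw [Set.mem_ofPred_eq, hbL]; linarith⟩, this, by rw [Set.mem_ofPred_eq, hbL]; linarith⟩
    have hbD : b ∈ D' := h.convex.segment_subset (h.br_subset _ hb₁'.1) (h.br_subset _ hb₂'.1) hb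
    have hbr : ∀ y ∈ br, y ∉ B₁ ∩ B₂ := fun y hy hyB =>
      hI _ (Finset.mem_image_of_mem L hy) ⟨hyB.2.2, hyB.1.2⟩
    have hsub : B₁ ∩ B₂ ⊆ D := fun y hy => hBD hy.1.1
    obtain ⟨g₃, g₃'⟩ := h.goodSpace_of_center (c₁.inter c₂) hsub hbB hbD
      fun y hy hyB => absurd hyB (hbr y hy)
    rw [h.card b (hsub hbB) fun hb' => hbr b hb' hbB] at g₃
    have hmono : ∀ {B' : Set ℂ}, B' ⊆ B → rootLocus p B' ∩ K ⊆ rootLocus p B ∩ K := fun hB' z hz =>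
      ⟨⟨hB' hz.1.1, hz.1.2⟩, hz.2⟩
    let U : Set ↥(rootLocus p B ∩ K) := Subtype.val ⁻¹' (rootLocus p B₁ ∩ K)
    let V : Set ↥(rootLocus p B ∩ K) := Subtype.val ⁻¹' (rootLocus p B₂ ∩ K)
    have hU : IsOpen U := by
      convert! o₁.preimage (f := fun z : ↥(rootLocus p B ∩ K) => z.1.2) (by fun_prop) using 1
      ext z
      exact ⟨fun hz => hz.1.1.2, fun hz => ⟨⟨⟨z.2.1.1, hz⟩, z.2.1.2⟩, z.2.2⟩⟩
    have hV : IsOpen V := by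
      convert! o₂.preimage (f := fun z : ↥(rootLocus p B ∩ K) => z.1.2) (by fun_prop) using 1
      ext z
      exact ⟨fun hz => hz.1.1.2, fun hz => ⟨⟨⟨z.2.1.1, hz⟩, z.2.1.2⟩, z.2.2⟩⟩
    have hUV : U ∪ V = Set.univ := by
      refine Set.eq_univ_of_forall fun z => ?_
      rcases lt_or_ge (L z.1.2) u with hz | hz
      · exact Or.inl ⟨⟨⟨z.2.1.1, hz⟩, z.2.1.2⟩, z.2.2⟩
      · exact Or.inr ⟨⟨⟨z.2.1.1, hlu.trans_le hz⟩, z.2.1.2⟩, z.2.2⟩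
    have hUV' : U ∩ V = Subtype.val ⁻¹' (rootLocus p (B₁ ∩ B₂) ∩ K) := by
      ext z
      exact ⟨fun hz => ⟨⟨⟨hz.1.1.1, hz.2.1.1⟩, hz.1.1.2⟩, hz.1.2⟩,
        fun hz => ⟨⟨⟨hz.1.1.1, hz.1.2⟩, hz.2⟩, ⟨⟨hz.1.1.2, hz.1.2⟩, hz.2⟩⟩⟩
    let e₁ := (preimageValHomeomorph (hmono (B' := B₁) Set.inter_subset_left)).symm.toHomotopyEquiv
    let e₂ := (preimageValHomeomorph (hmono (B' := B₂) Set.inter_subset_left)).symm.toHomotopyEquiv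
    let e₃ := ((Homeomorph.setCongr hUV').trans (preimageValHomeomorph (hmono (B' := B₁ ∩ B₂)
      (Set.inter_subset_left.trans Set.inter_subset_left)))).symm.toHomotopyEquiv
    have := GoodSpace.union hU hV hUV (g₁.of_homotopyEquiv e₁) (g₂.of_homotopyEquiv e₂)
      (g₃.of_homotopyEquiv e₃) (isZero_homology_of_homotopyEquiv e₃ g₃')
    convert this using 1
    rw [← Finset.sum_filter_add_sum_filter_not s (L · < u)]
    ring

theorem goodSpace (hD : IsOpen D) (hDc : Convex ℝ D) (hne : D'.Nonempty) (hDD : D' ⊆ D) :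
    GoodSpace ↥(rootLocus p D ∩ K) (d - ∑ b ∈ br, ((d : ℤ) - (p b).roots.toFinset.card)) :=
  h.goodSpace_aux br.card D hD hDc subset_rfl (by rwa [Set.inter_eq_right.2 hDD]) br
    (fun y => ⟨fun hy => ⟨hy, hDD (h.br_subset y hy)⟩, And.left⟩) le_rfl

end BranchData

end BranchedCover

/-! ### Sheets of the root locus and their slopes -/

section Sheet

open Filter Topology

variable {p : ℂ → Polynomial ℂ} {W : Set ℂ} {d : ℕ}

theorem exists_local_root (hm : ∀ y, (p y).Monic) (hd : ∀ y, (p y).natDegree = d) {x₀ y₀ : ℂ}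
    (hp : AnalyticFamily p y₀) (hs : (p y₀).roots.toFinset.card = d) (h : (p y₀).eval x₀ = 0) :
    ∃ ζ : ℂ → ℂ, AnalyticAt ℂ ζ y₀ ∧ ζ y₀ = x₀ ∧
      ∀ᶠ z : ℂ × ℂ in 𝓝 (x₀, y₀), (p z.2).eval z.1 = 0 → z.1 = ζ z.2 := by
  obtain ⟨ξ, hξ, hev⟩ := exists_analytic_roots hm hd hp hs
  obtain ⟨hinj, he⟩ := hev.self_of_nhds
  have hroot : ∀ {y : ℂ} {x : ℂ}, p y = ∏ k, (Polynomial.X - Polynomial.C (ξ k y)) →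
      (p y).eval x = 0 → ∃ k, x = ξ k y := fun {y x} hy hx => by
    rw [hy, Polynomial.eval_prod, Finset.prod_eq_zero_iff] at hx
    simpa [sub_eq_zero] using hx
  obtain ⟨k, hk⟩ := hroot he h
  refine ⟨ξ k, hξ k, hk.symm, ?_⟩
  have h2 : Tendsto (fun z : ℂ × ℂ => z.2) (𝓝 (x₀, y₀)) (𝓝 y₀) := continuousAt_snd
  have hne : ∀ j, j ≠ k → ∀ᶠ z : ℂ × ℂ in 𝓝 (x₀, y₀), z.1 - ξ j z.2 ≠ 0 := fun j hj => by
    have hc : ContinuousAt (fun z : ℂ × ℂ => z.1 - ξ j z.2) (x₀, y₀) :=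
      continuousAt_fst.sub (ContinuousAt.comp (f := Prod.snd) (g := ξ j) (hξ j).continuousAt h2)
    refine hc.eventually_ne (y := 0) ?_
    simp only [hk]
    exact sub_ne_zero.2 fun hkj => hj (hinj hkj).symm
  have hall : ∀ᶠ z : ℂ × ℂ in 𝓝 (x₀, y₀), ∀ j, j ≠ k → z.1 - ξ j z.2 ≠ 0 :=
    eventually_all.2 fun j => by
      by_cases hj : j = k
      · simp [hj]
      · filter_upwards [hne j hj] with z hz _ using hz
  filter_upwards [hall, h2.eventually hev] with z hz hz' hz0
  obtain ⟨j, hj⟩ := hroot hz'.2 hz0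
  by_cases hjk : j = k
  · rw [hj, hjk]
  · exact absurd (sub_eq_zero.2 hj) (hz j hjk)

theorem exists_sheet (hm : ∀ y, (p y).Monic) (hd : ∀ y, (p y).natDegree = d) (hW : IsOpen W)
    (hWc : Convex ℝ W) (hp : ∀ y ∈ W, AnalyticFamily p y)
    (hs : ∀ y ∈ W, (p y).roots.toFinset.card = d) {x₀ y₀ : ℂ} (hy₀ : y₀ ∈ W)
    (h : (p y₀).eval x₀ = 0) :
    ∃ ξ : ℂ → ℂ, ξ y₀ = x₀ ∧ DifferentiableOn ℂ ξ W ∧ ∀ y ∈ W, (p y).eval (ξ y) = 0 := by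
  have cov := isCoveringMap_rootLocusProj (W := W) hm hd hp hs
  have := hWc.contractibleSpace ⟨y₀, hy₀⟩
  have := hW.locallyPathConnectedSpace
  obtain ⟨F, ⟨hF₀, hF⟩, -⟩ := cov.existsUnique_continuousMap_lifts (ContinuousMap.id W) ⟨y₀, hy₀⟩
    ⟨(x₀, y₀), hy₀, h⟩ rfl
  classical
  have hF2 : ∀ y : W, (F y).1.2 = y := fun y => congrArg Subtype.val (congrFun hF y)
  let ξ : ℂ → ℂ := fun y => if hy : y ∈ W then (F ⟨y, hy⟩).1.1 else 0
  have hξ : ∀ y : W, ξ y = (F y).1.1 := fun y => dif_pos y.2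
  have hroot : ∀ y ∈ W, (p y).eval (ξ y) = 0 := fun y hy => by
    have := (F ⟨y, hy⟩).2.2
    rw [hF2] at this
    rw [hξ ⟨y, hy⟩]
    exact this
  have hc : ContinuousOn ξ W := by
    rw [continuousOn_iff_continuous_domRestrict]
    have : W.domRestrict ξ = fun y => (F y).1.1 := funext hξ
    rw [this]
    fun_prop
  refine ⟨ξ, by rw [hξ ⟨y₀, hy₀⟩, hF₀], fun y hy => ?_, hroot⟩
  obtain ⟨ζ, hζ, hζ₀, hev⟩ := exists_local_root hm hd (hp y hy) (hs y hy) (hroot y hy)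
  have hcy : ContinuousAt ξ y := hc.continuousAt (hW.mem_nhds hy)
  have ht : Tendsto (fun y' => (ξ y', y')) (𝓝 y) (𝓝 (ξ y, y)) := hcy.prodMk_nhds continuousAt_id
  have : ξ =ᶠ[𝓝 y] ζ := by
    filter_upwards [ht.eventually hev, hW.mem_nhds hy] with y' h1 h2 using h1 (hroot y' h2)
  exact (hζ.differentiableAt.congr_of_eventuallyEq this).differentiableWithinAt

/-- If the roots over the disc of radius `‖y₀‖ / 2` lie in narrow cones with separated slopes,
the slope of each sheet at `y₀` is close to the slope of its cone. -/
theorem exists_local_root_slope (hm : ∀ y, (p y).Monic) (hd : ∀ y, (p y).natDegree = d)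
    {x₀ y₀ : ℂ} (hy₀ : y₀ ≠ 0)
    (hp : ∀ y ∈ Metric.ball y₀ (‖y₀‖ / 2), AnalyticFamily p y)
    (hs : ∀ y ∈ Metric.ball y₀ (‖y₀‖ / 2), (p y).roots.toFinset.card = d)
    {S : Finset ℂ} {κ : ℝ} (hκ : 0 < κ) (hS : ∀ s ∈ S, ∀ s' ∈ S, s ≠ s' → 4 * κ < ‖s - s'‖)
    (hcone : ∀ y ∈ Metric.ball y₀ (‖y₀‖ / 2), ∀ x, (p y).eval x = 0 →
      ∃ s ∈ S, ‖x - s * y‖ ≤ κ * ‖y‖)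
    (h : (p y₀).eval x₀ = 0) :
    ∃ ζ : ℂ → ℂ, ∃ ζ' : ℂ, HasDerivAt ζ ζ' y₀ ∧ ζ y₀ = x₀ ∧
      (∀ᶠ z : ℂ × ℂ in 𝓝 (x₀, y₀), (p z.2).eval z.1 = 0 → z.1 = ζ z.2) ∧
      ∃ s ∈ S, ‖x₀ - s * y₀‖ ≤ κ * ‖y₀‖ ∧ ‖ζ' - s‖ ≤ 4 * κ := by
  set W := Metric.ball y₀ (‖y₀‖ / 2) with hWdef
  have hn : 0 < ‖y₀‖ := norm_pos_iff.2 hy₀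
  have hmem : y₀ ∈ W := Metric.mem_ball_self (by positivity)
  have hnW : ∀ y ∈ W, y ≠ 0 := fun y hy h0 => by
    rw [h0, hWdef, mem_ball_iff_norm, zero_sub, norm_neg] at hy
    linarith
  obtain ⟨ξ, hξ₀, hξd, hξr⟩ := exists_sheet hm hd Metric.isOpen_ball (convex_ball _ _) hp hs hmem h
  obtain ⟨s, hsS, hs₀⟩ := hcone y₀ hmem x₀ h
  have hq : ∀ y ∈ W, ∀ s', ‖ξ y - s' * y‖ = ‖ξ y / y - s'‖ * ‖y‖ := fun y hy s' => by
    rw [← norm_mul, sub_mul, div_mul_cancel₀ _ (hnW y hy)]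
  have hcont : ContinuousOn (fun y => ‖ξ y / y - s‖) W :=
    ((hξd.continuousOn.div continuousOn_id hnW).sub continuousOn_const).norm
  have hdich : ∀ y ∈ W, ‖ξ y / y - s‖ ≤ κ ∨ 3 * κ < ‖ξ y / y - s‖ := fun y hy => by
    obtain ⟨s', hs'S, hs'⟩ := hcone y hy _ (hξr y hy)
    rw [hq y hy, mul_le_mul_iff_left₀ (norm_pos_iff.2 (hnW y hy))] at hs'
    by_cases hss : s' = s
    · exact Or.inl (hss ▸ hs')
    · right
      have h1 := hS s' hs'S s hsS hss
      have h2 : ‖s' - s‖ ≤ ‖ξ y / y - s‖ + ‖ξ y / y - s'‖ := by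
        have := norm_sub_le (ξ y / y - s) (ξ y / y - s')
        simpa using this
      linarith
  have hs₀' : ‖ξ y₀ / y₀ - s‖ ≤ κ := by
    rw [← hξ₀, hq y₀ hmem, mul_le_mul_iff_left₀ hn] at hs₀
    exact hs₀
  have hall : ∀ y ∈ W, ‖ξ y / y - s‖ ≤ κ := fun y hy => by
    rcases hdich y hy with h1 | h1
    · exact h1
    · exfalso
      have hpre : _root_.IsPreconnected W := (convex_ball y₀ (‖y₀‖ / 2)).isPreconnected
      obtain ⟨y', hy', h2⟩ := hpre.intermediate_value hmem hy hcont
        (show 2 * κ ∈ Set.Icc _ _ from ⟨by linarith, by linarith⟩)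
      simp only at h2
      rcases hdich y' hy' with h3 | h3 <;> linarith
  have hclosed : Metric.closedBall y₀ (‖y₀‖ / 3) ⊆ W := Metric.closedBall_subset_ball (by linarith)
  have hdc : DiffContOnCl ℂ (fun y => ξ y - s * y) (Metric.ball y₀ (‖y₀‖ / 3)) := by
    have hd' : DifferentiableOn ℂ (fun y => ξ y - s * y) W :=
      hξd.sub ((differentiable_id.const_mul s).differentiableOn)
    exact (hd'.mono hclosed).diffContOnCl_ball subset_rfl
  have hderiv := Complex.norm_deriv_le_of_forall_mem_sphere_norm_le (C := κ * (4 / 3 * ‖y₀‖))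
    (by positivity) hdc fun y hy => by
      have hyW := hclosed (Metric.sphere_subset_closedBall hy)
      rw [hq y hyW]
      refine mul_le_mul (hall y hyW) ?_ (norm_nonneg _) hκ.le
      have h1 : ‖y - y₀‖ = ‖y₀‖ / 3 := mem_sphere_iff_norm.1 hy
      have h2 := norm_le_norm_add_norm_sub y₀ y
      rw [norm_sub_rev] at h2
      linarith
  have hdξ : DifferentiableAt ℂ ξ y₀ := hξd.differentiableAt (Metric.isOpen_ball.mem_nhds hmem)
  have hd1 : deriv (fun y => ξ y - s * y) y₀ = deriv ξ y₀ - s := by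
    have := hdξ.hasDerivAt.fun_sub ((hasDerivAt_id y₀).const_mul s)
    simpa using this.deriv
  obtain ⟨ζ, hζ, hζ₀, hev⟩ := exists_local_root hm hd (hp y₀ hmem) (hs y₀ hmem) h
  refine ⟨ζ, deriv ξ y₀, ?_, hζ₀, hev, s, hsS, hs₀, ?_⟩
  · have ht : Tendsto (fun y' => (ξ y', y')) (𝓝 y₀) (𝓝 (x₀, y₀)) := by
      rw [← hξ₀]
      exact hdξ.continuousAt.prodMk_nhds continuousAt_id
    refine hdξ.hasDerivAt.congr_of_eventuallyEq ?_
    filter_upwards [ht.eventually hev, Metric.isOpen_ball.mem_nhds hmem] with y' h1 h2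
    exact (h1 (hξr y' h2)).symm
  · rw [← hd1]
    refine hderiv.trans_eq ?_
    field_simp

end Sheet

/-! ### Radial monotonicity of the size of the roots -/

section Monotone

open Filter Topology

theorem inner_neg_of_slope {A α y b h h' : ℂ} {c κ : ℝ} (hc : 0 < c) (hA : A ≠ 0) (hy : y ≠ 0)
    (hb : ‖b‖ ≤ ‖y‖ / 2) (hh : ‖h‖ ≤ κ * ‖y‖) (hh' : ‖h'‖ ≤ 4 * κ) (hκ : 48 * (‖α‖ * κ) ≤ ‖A‖) :
    inner ℝ (A * y + α * h) (-(c : ℂ) * ((A + α * h') * (y - b))) < 0 := by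
  set u := A * y + α * h with hu
  set v := (A + α * h') * (y - b) with hv
  have hcv : -(c : ℂ) * v = (-c : ℝ) • v := by
    rw [Complex.real_smul]; push_cast; ring
  have hA' := norm_pos_iff.2 hA
  have hy' := norm_pos_iff.2 hy
  have e1 : ‖α * h‖ ≤ ‖A‖ * ‖y‖ / 48 := by
    rw [norm_mul]
    calc ‖α‖ * ‖h‖ ≤ ‖α‖ * (κ * ‖y‖) := by gcongr
      _ = 48 * (‖α‖ * κ) * ‖y‖ / 48 := by ring
      _ ≤ _ := by gcongr
  have e2 : ‖α * h' * (y - b)‖ ≤ ‖A‖ * ‖y‖ / 8 := by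
    rw [norm_mul, norm_mul]
    calc ‖α‖ * ‖h'‖ * ‖y - b‖ ≤ ‖α‖ * (4 * κ) * (‖y‖ + ‖y‖ / 2) := by
          have h1 := norm_sub_le y b
          have h2 : 0 ≤ κ := by linarith [norm_nonneg h']
          gcongr
          linarith
      _ = 48 * (‖α‖ * κ) * ‖y‖ / 8 := by ring
      _ ≤ _ := by gcongr
  have e3 : ‖A * b‖ ≤ ‖A‖ * ‖y‖ / 2 := by
    rw [norm_mul, mul_div_assoc]
    gcongr
  have hpos : 0 < ‖A‖ * ‖y‖ := mul_pos hA' hy'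
  have h1 : ‖u - v‖ < ‖u‖ := by
    have e4 : u - v = A * b + α * h - α * h' * (y - b) := by rw [hu, hv]; ring
    have e5 : ‖u - v‖ ≤ ‖A * b‖ + ‖α * h‖ + ‖α * h' * (y - b)‖ := by
      rw [e4]
      exact (norm_sub_le _ _).trans (by gcongr; exact norm_add_le _ _)
    have e6 : ‖A‖ * ‖y‖ ≤ ‖u‖ + ‖α * h‖ := by
      rw [← norm_mul]
      have : A * y = u - α * h := by rw [hu]; ring
      rw [this]
      exact norm_sub_le _ _
    linarith
  have h2 : 0 < inner ℝ u v := by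
    have := norm_sub_sq_real u v
    nlinarith [norm_nonneg (u - v), norm_nonneg v, norm_nonneg u]
  rw [hcv, inner_smul_right]
  nlinarith

theorem eventually_norm_lt_of_inner_neg {l : ℝ → ℂ} {l' : ℂ} {r : ℝ} (hl : HasDerivWithinAt l l' (Set.Ioi r) r)
    (h : inner ℝ (l r) l' < 0) : ∀ᶠ z in 𝓝[>] r, ‖l z‖ < ‖l r‖ := by
  have h1 := hl.norm_sq
  have h2 := h1.limsup_slope_le' (lt_irrefl r : r ∉ Set.Ioi r) (r := 0) (by linarith)
  filter_upwards [h2, self_mem_nhdsWithin] with z hz hz'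
  have hz' : r < z := hz'
  rw [slope_def_field, div_lt_iff₀ (sub_pos.2 hz'), zero_mul, sub_neg] at hz
  exact lt_of_pow_lt_pow_left₀ 2 (norm_nonneg _) hz

variable {p : ℂ → Polynomial ℂ} {d : ℕ} {a : ℂ} {ε κ : ℝ} {S : Finset ℂ}

theorem eventually_le_of_cone (hκ : 0 < κ) (h1 : 48 * ((1 + ‖a‖) * κ) ≤ 1)
    (h2 : ∀ s ∈ S, s ≠ 0 → 48 * ((1 + ‖a‖) * κ) ≤ ‖s‖)
    (h3 : ∀ s ∈ S, a * s + 1 ≠ 0 → 48 * ((1 + ‖a‖) * κ) ≤ ‖a * s + 1‖)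
    {x y : ℝ → ℂ} {b s ζ' : ℂ} {r c : ℝ} (hc : 0 < c) (hy0 : y r ≠ 0) (hb : ‖b‖ ≤ ‖y r‖ / 2)
    (hy : HasDerivWithinAt y (-(c : ℂ) * (y r - b)) (Set.Ioi r) r)
    (hx : HasDerivWithinAt x (-(c : ℂ) * (y r - b) * ζ') (Set.Ioi r) r)
    (hs : s ∈ S) (hsx : ‖x r - s * y r‖ ≤ κ * ‖y r‖) (hζ : ‖ζ' - s‖ ≤ 4 * κ)
    (hN : ‖x r‖ ≤ ε ∧ ‖a * x r + y r‖ ≤ ε) :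
    ∀ᶠ z in 𝓝[>] r, ‖x z‖ ≤ ε ∧ ‖a * x z + y z‖ ≤ ε := by
  have hy' := norm_pos_iff.2 hy0
  have ha := norm_nonneg a
  have hl2 : HasDerivWithinAt (fun z => a * x z + y z)
      (a * (-(c : ℂ) * (y r - b) * ζ') + -(c : ℂ) * (y r - b)) (Set.Ioi r) r :=
    (hx.const_mul a).fun_add hy
  have hak : ‖a‖ * κ ≤ (1 + ‖a‖) * κ := by gcongr; linarith
  have hk1 : κ ≤ (1 + ‖a‖) * κ := by nlinarith
  refine Filter.Eventually.and ?_ ?_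
  · by_cases hs0 : s = 0
    · have hlt : ‖x r‖ < ε := by
        rw [hs0, zero_mul, sub_zero] at hsx
        have e1 : ‖y r‖ ≤ ‖a * x r + y r‖ + ‖a‖ * ‖x r‖ := by
          rw [← norm_mul]
          have := norm_sub_le (a * x r + y r) (a * x r)
          simpa using this
        have e2 : ‖a‖ * ‖x r‖ ≤ ‖a‖ * (κ * ‖y r‖) := by gcongr
        have e3 : 48 * ((1 + ‖a‖) * κ) * ‖y r‖ ≤ 1 * ‖y r‖ := by gcongr
        nlinarith
      have := hx.continuousWithinAt.norm.eventually (gt_mem_nhds hlt)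
      filter_upwards [this] with z hz using hz.le
    · have := eventually_norm_lt_of_inner_neg hx (by
        have := inner_neg_of_slope (α := 1) hc hs0 hy0 hb hsx hζ
          (by rw [norm_one, one_mul]; linarith [h2 s hs hs0])
        convert this using 2 <;> ring)
      filter_upwards [this] with z hz using hz.le.trans hN.1
  · by_cases hs0 : a * s + 1 = 0
    · have hlt : ‖a * x r + y r‖ < ε := by
        have hs1 : s ≠ 0 := by
          rintro rfl
          simp at hs0
        have e0 := h2 s hs hs1
        have e1 : ‖a * x r + y r‖ ≤ ‖a‖ * (κ * ‖y r‖) := by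
          have : a * x r + y r = a * (x r - s * y r) := by linear_combination y r * hs0
          rw [this, norm_mul]
          gcongr
        have e2 : ‖s‖ * ‖y r‖ ≤ ‖x r‖ + κ * ‖y r‖ := by
          rw [← norm_mul]
          have := norm_sub_le (x r) (x r - s * y r)
          rw [sub_sub_cancel] at this
          linarith
        have e3 : 48 * ((1 + ‖a‖) * κ) * ‖y r‖ ≤ ‖s‖ * ‖y r‖ := by gcongr
        nlinarith
      have := hl2.continuousWithinAt.norm.eventually (gt_mem_nhds hlt)
      filter_upwards [this] with z hz using hz.le
    · have := eventually_norm_lt_of_inner_neg hl2 (by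
        have := inner_neg_of_slope (α := a) hc hs0 hy0 hb hsx hζ
          (by linarith [h3 s hs hs0])
        convert this using 2 <;> ring)
      filter_upwards [this] with z hz using hz.le.trans hN.2

/-- Following the roots radially towards a point near the origin does not increase their size, as
long as the roots lie in narrow cones. -/
theorem norm_le_of_move (hm : ∀ y, (p y).Monic) (hd : ∀ y, (p y).natDegree = d)
    (hκ : 0 < κ) (h1 : 48 * ((1 + ‖a‖) * κ) ≤ 1)
    (h2 : ∀ s ∈ S, s ≠ 0 → 48 * ((1 + ‖a‖) * κ) ≤ ‖s‖)
    (h3 : ∀ s ∈ S, a * s + 1 ≠ 0 → 48 * ((1 + ‖a‖) * κ) ≤ ‖a * s + 1‖)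
    (hS : ∀ s ∈ S, ∀ s' ∈ S, s ≠ s' → 4 * κ < ‖s - s'‖) {η R : ℝ}
    (hp : ∀ y : ℂ, ‖y‖ < 2 * R → AnalyticFamily p y)
    (hs : ∀ y : ℂ, η ≤ ‖y‖ → ‖y‖ < 2 * R → (p y).roots.toFinset.card = d)
    (hcone : ∀ y : ℂ, η ≤ ‖y‖ → ‖y‖ < 2 * R → ∀ x, (p y).eval x = 0 →
      ∃ s ∈ S, ‖x - s * y‖ ≤ κ * ‖y‖)
    (hsmall : ∀ y : ℂ, ‖y‖ < 2 * η → ‖y‖ < R → ∀ x, (p y).eval x = 0 → ‖x‖ ≤ ε ∧ ‖a * x + y‖ ≤ ε)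
    {b y : ℂ} (hb : ‖b‖ < η) (hbR : η ≤ R) (hy : ‖y‖ < R) {t : ℝ} (ht : t ∈ Set.Ico (0 : ℝ) 1) {x : ℝ → ℂ}
    (hx : ContinuousOn x (Set.Icc 0 t))
    (hroot : ∀ r ∈ Set.Icc 0 t, (p (segmentPoint b y r)).eval (x r) = 0)
    (hx0 : ‖x 0‖ ≤ ε ∧ ‖a * x 0 + y‖ ≤ ε) :
    ‖x t‖ ≤ ε ∧ ‖a * x t + segmentPoint b y t‖ ≤ ε := by
  have hR : ∀ r ∈ Set.Icc (0 : ℝ) 1, ‖segmentPoint b y r‖ < R := fun r hr => by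
    simpa using segmentPoint_mem (convex_ball (0 : ℂ) R) (b := b) (y := y)
      (by simpa using hb.trans_le hbR) (by simpa using hy) hr.1 hr.2
  have hcs : Continuous (segmentPoint b y) := by unfold segmentPoint; fun_prop
  have hIcc : Set.Icc 0 t ⊆ {r | ‖x r‖ ≤ ε ∧ ‖a * x r + segmentPoint b y r‖ ≤ ε} := by
    refine IsClosed.Icc_subset_of_forall_mem_nhdsWithin ?_ ?_ ?_
    · have c1 : ContinuousOn (fun r => max ‖x r‖ ‖a * x r + segmentPoint b y r‖) (Set.Icc 0 t) := by
        fun_prop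
      have := c1.preimage_isClosed_of_isClosed isClosed_Icc (isClosed_Iic (a := ε))
      convert this using 1
      ext r
      simp [and_comm]
    · simpa [segmentPoint_zero] using hx0
    · rintro r ⟨hN, hr0, hrt⟩
      have hr1 : r < 1 := hrt.trans ht.2
      have hrR := hR r ⟨hr0, hr1.le⟩
      have hmem : ∀ᶠ z in 𝓝[>] r, z ∈ Set.Icc 0 t := by
        filter_upwards [Ioo_mem_nhdsGT hrt] with z hz using ⟨hr0.trans hz.1.le, hz.2.le⟩
      by_cases hη : ‖segmentPoint b y r‖ < 2 * η
      · have e1 : ∀ᶠ z in 𝓝[>] r, ‖segmentPoint b y z‖ < 2 * η :=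
          (hcs.norm.continuousAt.eventually (gt_mem_nhds hη)).filter_mono nhdsWithin_le_nhds
        filter_upwards [e1, hmem] with z hz hz'
        exact hsmall _ hz (hR z ⟨hz'.1, hz'.2.trans ht.2.le⟩) _ (hroot z hz')
      rw [not_lt] at hη
      set y₀ := segmentPoint b y r with hy₀
      have hη0 : 0 < η := (norm_nonneg b).trans_lt hb
      have hball : ∀ w ∈ Metric.ball y₀ (‖y₀‖ / 2), η ≤ ‖w‖ ∧ ‖w‖ < 2 * R := fun w hw => by
        rw [mem_ball_iff_norm] at hw
        have e1 := norm_le_norm_add_norm_sub y₀ w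
        have e2 := norm_le_norm_add_norm_sub w y₀
        rw [norm_sub_rev] at e1
        exact ⟨by linarith, by linarith⟩
      have hy00 : y₀ ≠ 0 := norm_pos_iff.1 (by linarith)
      obtain ⟨ζ, ζ', hζ, hζ₀, hev, s, hsS, hs1, hs2⟩ := exists_local_root_slope hm hd hy00
        (fun w hw => hp w (hball w hw).2) (fun w hw => hs w (hball w hw).1 (hball w hw).2) hκ hS
        (fun w hw => hcone w (hball w hw).1 (hball w hw).2) (hroot r ⟨hr0, hrt.le⟩)
      have hd1 : HasDerivAt (segmentPoint b y) (-((1 - r)⁻¹ : ℝ) * (y₀ - b)) r := by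
        have e1 : -(((1 - r)⁻¹ : ℝ) : ℂ) * (y₀ - b) = b - y := by
          rw [hy₀, segmentPoint_sub]
          have : (1 - r : ℂ) ≠ 0 := by exact_mod_cast (sub_pos.2 hr1).ne'
          push_cast
          field_simp
          ring
        rw [e1]
        have := ((hasDerivAt_id r).ofReal_comp.mul_const (b - y)).const_add y
        rw [Complex.ofReal_one, one_mul] at this
        exact this
      have hxζ : x =ᶠ[𝓝[>] r] fun z => ζ (segmentPoint b y z) := by
        have hcx : Tendsto x (𝓝[>] r) (𝓝 (x r)) :=
          (hx r ⟨hr0, hrt.le⟩).mono_left (le_inf nhdsWithin_le_nhds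
            (le_principal_iff.2 hmem))
        have ht : Tendsto (fun z => (x z, segmentPoint b y z)) (𝓝[>] r) (𝓝 (x r, y₀)) := by
          rw [nhds_prod_eq]
          exact hcx.prodMk (hcs.continuousAt.mono_left nhdsWithin_le_nhds)
        filter_upwards [ht.eventually hev, hmem] with z h4 h5 using h4 (hroot z h5)
      have hd2 : HasDerivWithinAt x (-((1 - r)⁻¹ : ℝ) * (y₀ - b) * ζ') (Set.Ioi r) r := by
        have := (HasDerivAt.comp_of_eq r hζ hd1 rfl).hasDerivWithinAt (s := Set.Ioi r)
        rw [mul_comm]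
        exact this.congr_of_eventuallyEq hxζ hζ₀.symm
      exact eventually_le_of_cone hκ h1 h2 h3 (inv_pos.2 (sub_pos.2 hr1)) hy00 (by linarith)
        hd1.hasDerivWithinAt hd2 hsS hs1 hs2 hN
  exact hIcc ⟨ht.1, le_rfl⟩

end Monotone

/-! ### The tangent cone -/

section TangentCone

open Filter Topology

variable {f : MvPolynomial (Fin 2) ℂ} {a : ℂ} {d : ℕ}

theorem eval_smul_homogeneousComponent (f : MvPolynomial (Fin 2) ℂ) (k : ℕ) (t : ℂ)
    (v : Fin 2 → ℂ) : eval (t • v) (homogeneousComponent k f) =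
      t ^ k * eval v (homogeneousComponent k f) := by
  rw [eval_eq', eval_eq', Finset.mul_sum]
  refine Finset.sum_congr rfl fun m hm => ?_
  have : m.degree = k := by
    by_contra h
    rw [mem_support_iff, coeff_homogeneousComponent, if_neg h] at hm
    exact hm rfl
  simp only [Pi.smul_apply, smul_eq_mul, mul_pow, Finset.prod_mul_distrib, Finset.prod_pow_eq_pow_sum]
  rw [← Finsupp.degree_eq_sum, this]
  ring

theorem exists_lowest_homogeneousComponent (hf : f ≠ 0) :
    ∃ d, homogeneousComponent d f ≠ 0 ∧ ∀ k < d, homogeneousComponent k f = 0 := by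
  have : ∃ d, homogeneousComponent d f ≠ 0 := by
    by_contra! h
    exact hf (by rw [← sum_homogeneousComponent f, Finset.sum_eq_zero fun i _ => h i])
  classical
  exact ⟨Nat.find this, Nat.find_spec this, fun k hk => not_not.1 (Nat.find_min this hk)⟩

theorem exists_slope (h : homogeneousComponent d f ≠ 0) :
    ∃ a : ℂ, eval ![1, a] (homogeneousComponent d f) ≠ 0 := by
  by_contra! h0
  have h1 : X 0 * homogeneousComponent d f = 0 := by
    refine MvPolynomial.funext fun v => ?_
    rw [map_mul, eval_X, map_zero]
    by_cases hv : v 0 = 0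
    · rw [hv, zero_mul]
    · have h2 : v = v 0 • ![1, v 1 / v 0] := by
        ext i
        fin_cases i
        · simp
        · simp [mul_div_cancel₀ _ hv]
      rw [h2, eval_smul_homogeneousComponent, h0, mul_zero, mul_zero]
  exact (mul_ne_zero (X_ne_zero 0) h) h1

theorem norm_eval_sub_homogeneousComponent_le (hk : ∀ k < d, homogeneousComponent k f = 0) :
    ∃ C : ℝ, 0 ≤ C ∧ ∀ v : Fin 2 → ℂ, ‖v‖ ≤ 1 →
      ‖eval v f - eval v (homogeneousComponent d f)‖ ≤ C * ‖v‖ ^ (d + 1) := by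
  set g := f - homogeneousComponent d f with hg
  have hsupp : ∀ m ∈ g.support, d + 1 ≤ m.degree := fun m hm => by
    rw [mem_support_iff, hg, coeff_sub, coeff_homogeneousComponent] at hm
    by_contra hlt
    rcases (Nat.lt_succ_iff.1 (not_le.1 hlt)).lt_or_eq with h | h
    · have := congrArg (coeff m) (hk _ h)
      rw [coeff_homogeneousComponent, if_pos rfl, coeff_zero] at this
      rw [if_neg h.ne, this] at hm
      simp at hm
    · rw [if_pos h, sub_self] at hm
      exact hm rfl
  refine ⟨∑ m ∈ g.support, ‖coeff m g‖, Finset.sum_nonneg fun _ _ => norm_nonneg _,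
    fun v hv => ?_⟩
  rw [← map_sub, ← hg, eval_eq', Finset.sum_mul]
  refine (norm_sum_le _ _).trans (Finset.sum_le_sum fun m hm => ?_)
  rw [norm_mul, norm_prod]
  gcongr
  calc ∏ i, ‖v i ^ m i‖ ≤ ∏ i, ‖v‖ ^ m i := Finset.prod_le_prod (fun _ _ => norm_nonneg _)
        fun i _ => by rw [norm_pow]; gcongr; exact norm_le_pi_norm v i
    _ = ‖v‖ ^ m.degree := by rw [Finset.prod_pow_eq_pow_sum, ← Finsupp.degree_eq_sum]
    _ ≤ _ := pow_le_pow_of_le_one (norm_nonneg _) hv (hsupp m hm)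

theorem map_germEval_zero_homogeneousComponent (f : MvPolynomial (Fin 2) ℂ) (a : ℂ) (k : ℕ) :
    (germPoly a (homogeneousComponent k f)).map (germEval 0) =
      Polynomial.C (eval ![1, a] (homogeneousComponent k f)) * Polynomial.X ^ k := by
  refine Polynomial.funext fun x => ?_
  rw [eval_germPoly]
  have : ![x, a * x + 0] = x • ![1, a] := by
    ext i
    fin_cases i <;> simp [mul_comm]
  rw [this, eval_smul_homogeneousComponent, Polynomial.eval_mul, Polynomial.eval_C,
    Polynomial.eval_pow, Polynomial.eval_X, mul_comm]

theorem coeff_map_germEval_zero (f : MvPolynomial (Fin 2) ℂ) (a : ℂ) (k : ℕ) :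
    ((germPoly a f).map (germEval 0)).coeff k = eval ![1, a] (homogeneousComponent k f) := by
  conv_lhs => rw [← sum_homogeneousComponent f]
  rw [map_sum, Polynomial.map_sum, Polynomial.finsetSum_coeff]
  simp only [map_germEval_zero_homogeneousComponent, Polynomial.coeff_C_mul_X_pow]
  rw [Finset.sum_ite_eq]
  split_ifs with h
  · rfl
  · rw [homogeneousComponent_eq_zero _ _ (by simpa using h), map_zero]

theorem map_germEval_zero_ne_zero (ha : eval ![1, a] (homogeneousComponent d f) ≠ 0) :
    (germPoly a f).map (germEval 0) ≠ 0 := fun h => ha (by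
  rw [← coeff_map_germEval_zero, h, Polynomial.coeff_zero])

theorem lineMult_eq (hk : ∀ k < d, homogeneousComponent k f = 0)
    (ha : eval ![1, a] (homogeneousComponent d f) ≠ 0) : lineMult a f = d := by
  rw [lineMult, Polynomial.rootMultiplicity_eq_natTrailingDegree']
  refine le_antisymm (Polynomial.natTrailingDegree_le_of_ne_zero ?_)
    (Polynomial.le_natTrailingDegree (map_germEval_zero_ne_zero ha) fun k hk' => ?_)
  · rwa [coeff_map_germEval_zero]
  · rw [coeff_map_germEval_zero, hk k hk', map_zero]

theorem exists_tangent_slopes (ha : eval ![1, a] (homogeneousComponent d f) ≠ 0) :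
    ∃ S : Finset ℂ, ∀ v : Fin 2 → ℂ, v ≠ 0 → eval v (homogeneousComponent d f) = 0 →
      v 1 - a * v 0 ≠ 0 ∧ ∃ s ∈ S, v 0 = s * (v 1 - a * v 0) := by
  classical
  set G := homogeneousComponent d f with hG
  set q := (germPoly a G).map (germEval 1) with hq
  have hq0 : q ≠ 0 := fun h => ha (by
    have h1 : (fun t : ℂ => eval ![1, a + t] G) = fun _ => 0 := by
      refine Continuous.ext_on (dense_compl_singleton (0 : ℂ))
        ((MvPolynomial.continuous_eval G).comp (by fun_prop)) continuous_const fun t ht => ?_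
      have ht : t ≠ 0 := ht
      have h2 : ![1, a + t] = t • ![t⁻¹, a * t⁻¹ + 1] := by
        ext i
        fin_cases i
        · simp [ht]
        · simp; field_simp
      have h3 : eval ![t⁻¹, a * t⁻¹ + 1] G = q.eval t⁻¹ := by rw [hq, eval_germPoly]
      rw [h2, hG, eval_smul_homogeneousComponent, ← hG, h3, h, Polynomial.eval_zero, mul_zero]
    simpa using congrFun h1 0)
  refine ⟨q.roots.toFinset, fun v hv h => ?_⟩
  have hne : v 1 - a * v 0 ≠ 0 := fun h0 => by
    have h1 : v = v 0 • ![1, a] := by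
      ext i
      fin_cases i
      · simp
      · simp; linear_combination h0
    rw [h1, hG, eval_smul_homogeneousComponent, ← hG] at h
    have h2 : v 0 ≠ 0 := fun h2 => hv (by rw [h1, h2, zero_smul])
    exact mul_ne_zero (pow_ne_zero _ h2) ha h
  refine ⟨hne, v 0 / (v 1 - a * v 0), ?_, (div_mul_cancel₀ _ hne).symm⟩
  rw [Multiset.mem_toFinset, Polynomial.mem_roots hq0, Polynomial.IsRoot, hq, eval_germPoly]
  have h1 : v = (v 1 - a * v 0) • ![v 0 / (v 1 - a * v 0), a * (v 0 / (v 1 - a * v 0)) + 1] := by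
    ext i
    fin_cases i
    · simp [mul_div_cancel₀ _ hne]
    · simp; field_simp; ring
  rw [h1, hG, eval_smul_homogeneousComponent, ← hG] at h
  exact (mul_eq_zero.1 h).resolve_left (pow_ne_zero _ hne)

/-- Near the origin, the points where `f` is small lie in narrow cones around the tangent lines. -/
theorem exists_cone (hk : ∀ k < d, homogeneousComponent k f = 0)
    (ha : eval ![1, a] (homogeneousComponent d f) ≠ 0) :
    ∃ S : Finset ℂ, ∀ κ : ℝ, 0 < κ → ∃ r > 0, ∀ v : Fin 2 → ℂ, v ≠ 0 → ‖v‖ < r →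
      ‖eval v f‖ ≤ ‖v‖ ^ (d + 1) → ∃ s ∈ S, ‖v 0 - s * (v 1 - a * v 0)‖ ≤ κ * ‖v 1 - a * v 0‖ := by
  obtain ⟨S, hS⟩ := exists_tangent_slopes ha
  obtain ⟨C, hC, hle⟩ := norm_eval_sub_homogeneousComponent_le hk
  refine ⟨S, fun κ hκ => ?_⟩
  set G := homogeneousComponent d f with hG
  let T : Set (Fin 2 → ℂ) := Metric.sphere 0 1 ∩
    {v | ∀ s ∈ S, κ * ‖v 1 - a * v 0‖ ≤ ‖v 0 - s * (v 1 - a * v 0)‖}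
  have hT : IsCompact T := by
    refine (isCompact_sphere 0 1).inter_right ?_
    have : {v : Fin 2 → ℂ | ∀ s ∈ S, κ * ‖v 1 - a * v 0‖ ≤ ‖v 0 - s * (v 1 - a * v 0)‖} =
        ⋂ s ∈ S, {v | κ * ‖v 1 - a * v 0‖ ≤ ‖v 0 - s * (v 1 - a * v 0)‖} := by
      ext v
      simp
    rw [this]
    exact isClosed_biInter fun s _ => isClosed_le (by fun_prop) (by fun_prop)
  obtain ⟨θ, hθ, hθT⟩ : ∃ θ > 0, ∀ v ∈ T, θ ≤ ‖eval v G‖ := by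
    refine hT.exists_forall_le' (MvPolynomial.continuous_eval G).norm.continuousOn (a := 0)
      fun v hv => norm_pos_iff.2 fun h0 => ?_
    have hv1 : ‖v‖ = 1 := mem_sphere_zero_iff_norm.1 hv.1
    have hv0 : v ≠ 0 := norm_pos_iff.1 (by rw [hv1]; exact one_pos)
    obtain ⟨h1, s, hs, h2⟩ := hS v hv0 h0
    have h3 := hv.2 s hs
    rw [← h2, sub_self, norm_zero] at h3
    exact h3.not_gt (mul_pos hκ (norm_pos_iff.2 h1))
  refine ⟨min 1 (θ / (C + 1)), lt_min one_pos (by positivity), fun v hv hvr hvf => ?_⟩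
  have hn := norm_pos_iff.2 hv
  by_contra! hcon
  have hw : ((‖v‖⁻¹ : ℝ) : ℂ) • v ∈ T := by
    refine ⟨?_, fun s hs => ?_⟩
    · rw [mem_sphere_zero_iff_norm, norm_smul, Complex.norm_real, norm_inv, norm_norm,
        inv_mul_cancel₀ hn.ne']
    · simp only [Pi.smul_apply, smul_eq_mul]
      set t : ℂ := ((‖v‖⁻¹ : ℝ) : ℂ)
      have e1 : t * v 1 - a * (t * v 0) = t * (v 1 - a * v 0) := by ring
      have e2 : t * v 0 - s * (t * (v 1 - a * v 0)) = t * (v 0 - s * (v 1 - a * v 0)) := by ring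
      rw [e1, e2, norm_mul, norm_mul, mul_left_comm]
      exact mul_le_mul_of_nonneg_left (hcon s hs).le (norm_nonneg _)
  have h1 := hθT _ hw
  rw [hG, eval_smul_homogeneousComponent, ← hG, norm_mul, norm_pow, Complex.norm_real, norm_inv,
    norm_norm, inv_pow, inv_mul_eq_div, le_div_iff₀ (by positivity)] at h1
  have h2 := hle v (hvr.le.trans (min_le_left _ _))
  have h3 : ‖eval v G‖ ≤ ‖eval v f‖ + ‖eval v f - eval v G‖ := by
    have := norm_sub_le (eval v f) (eval v f - eval v G)
    rwa [sub_sub_cancel] at this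
  have h4 : θ * ‖v‖ ^ d ≤ (C + 1) * ‖v‖ * ‖v‖ ^ d := by
    calc θ * ‖v‖ ^ d ≤ _ := h1
      _ ≤ ‖v‖ ^ (d + 1) + C * ‖v‖ ^ (d + 1) := by linarith
      _ = _ := by ring
  have h5 := le_of_mul_le_mul_right h4 (by positivity)
  have h6 := (lt_div_iff₀ (by positivity)).1 (hvr.trans_le (min_le_right _ _))
  linarith

end TangentCone

/-! ### Counting the solutions of an analytic equation -/

section Counting

open Filter Topology

theorem card_nthRoots_toFinset {n : ℕ} (hn : n ≠ 0) {δ : ℂ} (hδ : δ ≠ 0) :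
    (Polynomial.nthRoots n δ).toFinset.card = n := by
  have hζ := Complex.isPrimitiveRoot_exp n hn
  rw [Multiset.toFinset_card_of_nodup (hζ.nthRoots_nodup hδ), hζ.card_nthRoots, if_pos]
  exact IsAlgClosed.exists_pow_nat_eq δ (Nat.pos_of_ne_zero hn)

/-- An analytic function vanishing to order `n` is the `n`-th power of a local coordinate. -/
theorem exists_eq_pow {φ : ℂ → ℂ} (hφ : AnalyticAt ℂ φ 0) {n : ℕ} (hn : n ≠ 0)
    (ho : analyticOrderAt φ 0 = n) :
    ∃ h : ℂ → ℂ, AnalyticAt ℂ h 0 ∧ h 0 = 0 ∧ deriv h 0 ≠ 0 ∧ ∀ᶠ t in 𝓝 0, φ t = h t ^ n := by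
  obtain ⟨g, hg, hg0, hev⟩ := hφ.analyticOrderAt_eq_natCast.1 ho
  obtain ⟨c, hc⟩ := IsAlgClosed.exists_pow_nat_eq (g 0) (Nat.pos_of_ne_zero hn)
  have hc0 : c ≠ 0 := by
    rintro rfl
    rw [zero_pow hn] at hc
    exact hg0 hc.symm
  let r : ℂ → ℂ := fun t => c * (g t / g 0) ^ (n : ℂ)⁻¹
  have hr0 : r 0 = c := by simp [r, div_self hg0]
  have hr : AnalyticAt ℂ r 0 := by
    refine analyticAt_const.fun_mul (AnalyticAt.cpow (hg.fun_div analyticAt_const hg0)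
      analyticAt_const ?_)
    rw [div_self hg0]
    exact Complex.one_mem_slitPlane
  have hd : HasDerivAt (fun t => t * r t) c 0 := by
    have := (hasDerivAt_id (0 : ℂ)).fun_mul hr.differentiableAt.hasDerivAt
    simpa [hr0] using this
  refine ⟨fun t => t * r t, analyticAt_id.fun_mul hr, by simp, by rwa [hd.deriv], ?_⟩
  filter_upwards [hev] with t ht
  rw [ht, sub_zero, smul_eq_mul, mul_pow, mul_pow, Complex.cpow_nat_inv_pow _ hn, hc,
    mul_div_cancel₀ _ hg0]

theorem exists_card_solutions {φ : ℂ → ℂ} (hφ : AnalyticAt ℂ φ 0) {n : ℕ} (hn : n ≠ 0)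
    (ho : analyticOrderAt φ 0 = n) :
    ∃ τ₀ > (0 : ℝ), ∀ τ : ℝ, 0 < τ → τ ≤ τ₀ → ∀ η : ℝ, 0 < η → ∀ᶠ δ in 𝓝 (0 : ℂ), δ ≠ 0 →
      ∃ s : Finset ℂ, s.card = n ∧ (∀ t, t ∈ s ↔ ‖t‖ < τ ∧ φ t = δ) ∧ ∀ t ∈ s, ‖t‖ < η := by
  classical
  obtain ⟨h, hh, hh0, hd, hev⟩ := exists_eq_pow hφ hn ho
  have hstrict : HasStrictDerivAt h (deriv h 0) 0 := hh.hasStrictDerivAt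
  set L := hstrict.localInverse h _ _ hd
  have hL : ContinuousAt L (h 0) := (hstrict.to_localInverse hd).hasDerivAt.continuousAt
  have hleft := hstrict.eventually_left_inverse hd
  have hright := hstrict.eventually_right_inverse hd
  have hL0 : L (h 0) = 0 := hleft.self_of_nhds
  rw [hh0] at hL hright hL0
  obtain ⟨τ₀, hτ₀, hball⟩ := Metric.eventually_nhds_iff.1 (hleft.and hev)
  refine ⟨τ₀, hτ₀, fun τ hτ hττ η hη => ?_⟩
  have hLt : Tendsto L (𝓝 0) (𝓝 0) := by
    have := hL.tendsto
    rwa [hL0] at this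
  have hsm : ∀ᶠ w in 𝓝 (0 : ℂ), h (L w) = w ∧ ‖L w‖ < min τ η := by
    have := hLt.norm.eventually (gt_mem_nhds (show ‖(0 : ℂ)‖ < min τ η by
      rw [norm_zero]; exact lt_min hτ hη))
    exact hright.and this
  obtain ⟨σ, hσ, hσb⟩ := Metric.eventually_nhds_iff.1 hsm
  have hδσ : ∀ᶠ δ in 𝓝 (0 : ℂ), ‖δ‖ < σ ^ n := by
    have := Metric.ball_mem_nhds (0 : ℂ) (pow_pos hσ n)
    filter_upwards [this] with δ hδ using by simpa using hδ
  filter_upwards [hδσ] with δ hδ hδ0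
  have hw : ∀ w ∈ (Polynomial.nthRoots n δ).toFinset, w ^ n = δ ∧ h (L w) = w ∧
      ‖L w‖ < min τ η := fun w hw => by
    rw [Multiset.mem_toFinset, Polynomial.mem_nthRoots (Nat.pos_of_ne_zero hn)] at hw
    refine ⟨hw, hσb ?_⟩
    rw [dist_zero_right]
    refine lt_of_pow_lt_pow_left₀ n hσ.le ?_
    rwa [← norm_pow, hw]
  refine ⟨(Polynomial.nthRoots n δ).toFinset.image L, ?_, fun t => ⟨fun ht => ?_, fun ht => ?_⟩,
    fun t ht => ?_⟩
  · rw [Finset.card_image_of_injOn, card_nthRoots_toFinset hn hδ0]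
    intro w hw1 w' hw2 hww
    rw [← (hw w hw1).2.1, ← (hw w' hw2).2.1]
    exact congrArg h hww
  · obtain ⟨w, hw1, rfl⟩ := Finset.mem_image.1 ht
    obtain ⟨e1, e2, e3⟩ := hw w hw1
    have e4 := e3.trans_le (min_le_left _ _)
    refine ⟨e4, ?_⟩
    rw [(hball (show dist (L w) 0 < τ₀ by rw [dist_zero_right]; linarith)).2, e2, e1]
  · have e1 := hball (show dist t 0 < τ₀ by rw [dist_zero_right]; linarith [ht.1])
    refine Finset.mem_image.2 ⟨h t, ?_, e1.1⟩
    rw [Multiset.mem_toFinset, Polynomial.mem_nthRoots (Nat.pos_of_ne_zero hn), ← e1.2, ht.2]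
  · obtain ⟨w, hw1, rfl⟩ := Finset.mem_image.1 ht
    exact (hw w hw1).2.2.trans_le (min_le_right _ _)

end Counting

section FibreFamily

open Filter Topology

/-- The roots near the origin of the equation `h = δ`, where `h` is a polynomial over the germs
in `y`, are those of a monic family which is analytic in `(y, δ)`. -/
theorem exists_fibre_family {h : Polynomial Germ} (h0 : h.map (germEval 0) ≠ 0) {d : ℕ}
    (hd : (h.map (germEval 0)).rootMultiplicity 0 = d) :
    ∃ A : ℂ × ℂ → Polynomial ℂ, (∀ z, (A z).Monic) ∧ (∀ z, (A z).natDegree = d) ∧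
      (∀ᶠ z in 𝓝 0, AnalyticFamily A z) ∧
      (∀ τ : ℝ, 0 < τ → ∀ᶠ z in 𝓝 0, ∀ x, (A z).eval x = 0 → ‖x‖ < τ) ∧
      ∃ ρ > 0, ∀ᶠ z in 𝓝 0, ∀ x, ‖x‖ < ρ →
        (A z).rootMultiplicity x =
          (h.map (germEval z.1) - Polynomial.C z.2).rootMultiplicity x ∧
        ((A z).eval x = 0 ↔ (h.map (germEval z.1)).eval x = z.2) := by
  obtain ⟨b, hb, hb0⟩ := Polynomial.exists_eq_pow_rootMultiplicity_mul_and_not_dvd _ h0 0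
  rw [hd, Polynomial.C_0, sub_zero] at hb
  rw [Polynomial.C_0, sub_zero, Polynomial.X_dvd_iff, Polynomial.coeff_zero_eq_eval_zero] at hb0
  have hbne : b ≠ 0 := fun hb' => hb0 (by simp [hb'])
  have hdeg : ∀ y, (h.map (germEval y)).natDegree ≤ h.natDegree := fun y =>
    Polynomial.natDegree_map_le
  have hbdeg : b.natDegree ≤ h.natDegree := by
    have := hdeg 0
    rw [hb, Polynomial.natDegree_mul (pow_ne_zero _ Polynomial.X_ne_zero) hbne] at this
    omega
  have hcop : IsCoprime ((Polynomial.X : Polynomial ℂ) ^ d) b := by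
    refine IsCoprime.pow_left ?_
    rw [Polynomial.irreducible_X.coprime_iff_not_dvd, Polynomial.X_dvd_iff,
      Polynomial.coeff_zero_eq_eval_zero]
    exact hb0
  have hpa : AnalyticFamily (fun z : ℂ × ℂ => h.map (germEval z.1) - Polynomial.C z.2) 0 :=
    ((analyticFamily_map h).comp (f := Prod.fst) (x := (0 : ℂ × ℂ)) analyticAt_fst).sub
      (AnalyticFamily.C analyticAt_snd)
  obtain ⟨A, B, hA, hB, hAa, hBa, hA0, hB0, hAB⟩ := exists_analytic_factorization
    (k := d) (m := h.natDegree) (fun z => by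
      refine (Polynomial.natDegree_sub_C (p := h.map (germEval z.1)) (a := z.2)).le.trans ?_
      have := hdeg z.1
      omega) hpa (Polynomial.monic_X_pow d) (Polynomial.natDegree_X_pow d) hbdeg hcop
      (by simpa using hb)
  refine ⟨A, fun z => (hA z).1, fun z => (hA z).2, ?_, fun τ hτ => ?_, ?_⟩
  · have := (eventually_all_finset (Finset.range d)).2 fun i _ =>
      (hAa i).eventually_analyticAt
    filter_upwards [this] with z hz i
    rcases lt_trichotomy i d with hi | hi | hi
    · exact hz i (Finset.mem_range.2 hi)
    · refine (analyticAt_const (v := (1 : ℂ))).congr (Eventually.of_forall fun w => ?_)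
      have := (hA w).1.coeff_natDegree
      rw [(hA w).2, ← hi] at this
      exact this.symm
    · refine (analyticAt_const (v := (0 : ℂ))).congr (Eventually.of_forall fun w => ?_)
      exact (Polynomial.coeff_eq_zero_of_natDegree_lt ((hA w).2.trans_lt hi)).symm
  · filter_upwards [eventually_exists_root_near (fun z => (hA z).1) (fun z => (hA z).2) hAa hτ]
      with z hz x hx
    obtain ⟨x₀, hx₀, hlt⟩ := hz x hx
    rw [hA0] at hx₀
    rw [Polynomial.eval_pow, Polynomial.eval_X] at hx₀
    have : x₀ = 0 := eq_zero_of_pow_eq_zero hx₀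
    simpa [this] using hlt
  · have hc : ContinuousAt (fun z : (ℂ × ℂ) × ℂ => (B z.1).eval z.2) (0, 0) :=
      ((hBa.comp (f := Prod.fst) (x := ((0 : ℂ × ℂ), (0 : ℂ))) analyticAt_fst).eval
        (fun z => hB z.1) analyticAt_snd).continuousAt
    have hev := hc.eventually_ne (y := 0) (by simpa [hB0] using hb0)
    rw [nhds_prod_eq] at hev
    obtain ⟨pa, hpa, pb, hpb, hab⟩ := eventually_prod_iff.1 hev
    obtain ⟨ρ, hρ, hρb⟩ := Metric.eventually_nhds_iff.1 hpb
    refine ⟨ρ, hρ, ?_⟩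
    filter_upwards [hpa, hAB] with z hz hzAB x hx
    have hBx : (B z).eval x ≠ 0 := hab hz (hρb (by simpa using hx))
    have hBz : B z ≠ 0 := fun h => hBx (by simp [h])
    constructor
    · rw [hzAB, Polynomial.rootMultiplicity_mul (mul_ne_zero (hA z).1.ne_zero hBz),
        Polynomial.rootMultiplicity_eq_zero (p := B z) hBx, add_zero]
    · have := congrArg (Polynomial.eval x) hzAB
      rw [Polynomial.eval_sub, Polynomial.eval_C, Polynomial.eval_mul] at this
      rw [← sub_eq_zero (b := z.2), this]
      simp [hBx]

end FibreFamily

section CriticalCount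

open Filter Topology

theorem rootMultiplicity_prod_X_sub_C {ι : Type*} [Fintype ι] (ξ : ι → ℂ) (x : ℂ) :
    (∏ i, (Polynomial.X - Polynomial.C (ξ i))).rootMultiplicity x =
      (Finset.univ.filter fun i => ξ i = x).card := by
  classical
  have h : (∏ i, (Polynomial.X - Polynomial.C (ξ i))).roots = Finset.univ.val.map ξ := by
    rw [← Polynomial.roots_multiset_prod_X_sub_C (Finset.univ.val.map ξ), Multiset.map_map]
    rfl
  rw [← Polynomial.count_roots, h, Multiset.count_map]
  simp only [eq_comm (a := x)]
  rfl

/-- The roots of a monic polynomial lost by collision are counted by critical points. -/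
theorem natDegree_sub_card_roots {A p G Q : Polynomial ℂ} (hA : A.Monic) {ι : Type*} [Fintype ι]
    {ξ : ι → ℂ} (hp : p.derivative = G * ((∏ i, (Polynomial.X - Polynomial.C (ξ i))) * Q))
    (hmult : ∀ x, A.eval x = 0 → A.rootMultiplicity x = p.rootMultiplicity x)
    (hG : ∀ x, A.eval x = 0 → G.eval x ≠ 0) (hQ : ∀ x, A.eval x = 0 → Q.eval x ≠ 0) :
    (A.natDegree : ℤ) - A.roots.toFinset.card =
      (Finset.univ.filter fun i => A.eval (ξ i) = 0).card := by
  classical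
  have hmem : ∀ x, x ∈ A.roots.toFinset ↔ A.eval x = 0 := fun x => by
    simp [Polynomial.mem_roots hA.ne_zero]
  have h1 : A.natDegree = ∑ x ∈ A.roots.toFinset, A.rootMultiplicity x := by
    rw [← (IsAlgClosed.splits A).natDegree_eq_card_roots.symm, ← Multiset.toFinset_sum_count_eq]
    exact Finset.sum_congr rfl fun x _ => Polynomial.count_roots _
  have h2 : ∀ x ∈ A.roots.toFinset, A.rootMultiplicity x =
      (Finset.univ.filter fun i => ξ i = x).card + 1 := by
    intro x hx
    rw [hmem] at hx
    have hpos : 0 < A.rootMultiplicity x :=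
      (Polynomial.rootMultiplicity_pos hA.ne_zero).2 hx
    have hp0 : p ≠ 0 := by
      rintro rfl
      rw [hmult x hx] at hpos
      simp at hpos
    have hroot : p.IsRoot x := (Polynomial.rootMultiplicity_pos hp0).1 (hmult x hx ▸ hpos)
    have h3 := Polynomial.derivative_rootMultiplicity_of_root hroot
    have hG0 : G ≠ 0 := fun h => hG x hx (by simp [h])
    have hQ0 : Q ≠ 0 := fun h => hQ x hx (by simp [h])
    have hP0 : (∏ i, (Polynomial.X - Polynomial.C (ξ i))) ≠ 0 :=
      (Polynomial.monic_prod_X_sub_C ξ Finset.univ).ne_zero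
    rw [hp, Polynomial.rootMultiplicity_mul (mul_ne_zero hG0 (mul_ne_zero hP0 hQ0)),
      Polynomial.rootMultiplicity_mul (mul_ne_zero hP0 hQ0),
      Polynomial.rootMultiplicity_eq_zero (p := G) (hG x hx),
      Polynomial.rootMultiplicity_eq_zero (p := Q) (hQ x hx),
      rootMultiplicity_prod_X_sub_C, ← hmult x hx] at h3
    omega
  have h4 : (Finset.univ.filter fun i => A.eval (ξ i) = 0).card =
      ∑ x ∈ A.roots.toFinset, (Finset.univ.filter fun i => ξ i = x).card := by
    rw [Finset.card_eq_sum_card_fiberwise (f := ξ) (t := A.roots.toFinset)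
      (fun i hi => by simpa [hA.ne_zero] using hi)]
    refine Finset.sum_congr rfl fun x hx => congrArg _ ?_
    rw [Finset.filter_filter]
    refine Finset.filter_congr fun i _ => ?_
    rw [hmem] at hx
    constructor
    · exact fun h => h.2
    · rintro rfl
      exact ⟨hx, rfl⟩
  have h5 := h1.trans (Finset.sum_congr rfl h2)
  rw [Finset.sum_add_distrib, ← h4, Finset.sum_const, smul_eq_mul, mul_one] at h5
  omega

theorem eventually_natDegree_sub_card_roots {m : ℕ}
    {g : Fin (m + 1) → MvPolynomial (Fin 2) ℂ} {c : Fin (m + 1) → ℕ} (hc : ∀ i, 1 ≤ c i) {a : ℂ}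
    {A : ℂ × ℂ → Polynomial ℂ} (hm : ∀ z, (A z).Monic)
    (hsmall : ∀ τ : ℝ, 0 < τ → ∀ᶠ z in 𝓝 0, ∀ x, (A z).eval x = 0 → ‖x‖ < τ) {ρ : ℝ} (hρ : 0 < ρ)
    (hA : ∀ᶠ z in 𝓝 0, ∀ x, ‖x‖ < ρ →
        (A z).rootMultiplicity x = ((germPoly a (∏ i, g i ^ c i)).map (germEval z.1) -
          Polynomial.C z.2).rootMultiplicity x ∧
        ((A z).eval x = 0 ↔ ((germPoly a (∏ i, g i ^ c i)).map (germEval z.1)).eval x = z.2))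
    {P Q : Polynomial Germ} (hW : IsWeierstrass (germPoly a (polar a g c)) P Q) {K : ℕ}
    (hK : K ≠ 0) {ι : Type*} [Fintype ι] {ξ : ι → ℂ → ℂ} (hξ : ∀ i, AnalyticAt ℂ (ξ i) 0)
    (hξ0 : ∀ i, ξ i 0 = 0)
    (hP : ∀ᶠ t in 𝓝 0, P.map (germEval (t ^ K)) =
      ∏ i, (Polynomial.X - Polynomial.C (ξ i t))) :
    ∀ᶠ z : ℂ × ℂ in 𝓝 0, z.2 ≠ 0 →
      ((A (z.1 ^ K, z.2)).natDegree : ℤ) - (A (z.1 ^ K, z.2)).roots.toFinset.card =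
        (Finset.univ.filter fun i =>
          eval ![ξ i z.1, a * ξ i z.1 + z.1 ^ K] (∏ i, g i ^ c i) = z.2).card := by
  have hpow : Tendsto (fun z : ℂ × ℂ => (z.1 ^ K, z.2)) (𝓝 0) (𝓝 0) := by
    have : ContinuousAt (fun z : ℂ × ℂ => (z.1 ^ K, z.2)) 0 := by fun_prop
    simpa [ContinuousAt, hK, ← Prod.zero_eq_mk] using this
  have hfst : Tendsto (fun z : ℂ × ℂ => z.1) (𝓝 0) (𝓝 0) :=
    continuous_fst.tendsto (0 : ℂ × ℂ)
  have hQ : ContinuousAt (fun z : ℂ × ℂ => (Q.map (germEval z.1)).eval z.2) (0, 0) :=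
    (((analyticFamily_map Q).comp (f := Prod.fst) (x := ((0 : ℂ), (0 : ℂ))) analyticAt_fst).eval
      (D := Q.natDegree) (fun z => Polynomial.natDegree_map_le) analyticAt_snd).continuousAt
  have hQ0 := hQ.eventually_ne (y := 0) (by
    rw [← Polynomial.coeff_zero_eq_eval_zero, Polynomial.coeff_map]
    exact hW.unit)
  rw [nhds_prod_eq] at hQ0
  obtain ⟨pa, hpa, pb, hpb, hab⟩ := eventually_prod_iff.1 hQ0
  obtain ⟨ρ', hρ', hρb⟩ := Metric.eventually_nhds_iff.1 hpb
  have hξs : ∀ᶠ t in 𝓝 (0 : ℂ), ∀ i, ‖ξ i t‖ < ρ := eventually_all.2 fun i =>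
    (hξ i).continuousAt.norm.eventually_lt_const (by simpa [hξ0 i] using hρ)
  have hpow1 : Tendsto (fun z : ℂ × ℂ => z.1 ^ K) (𝓝 0) (𝓝 0) := by
    have : ContinuousAt (fun z : ℂ × ℂ => z.1 ^ K) 0 := by fun_prop
    simpa [ContinuousAt, hK] using this
  filter_upwards [hpow.eventually (hsmall _ (lt_min hρ hρ')), hpow.eventually hA,
    hpow1.eventually hpa, hpow1.eventually hW.eventually_eq, hfst.eventually hP,
    hfst.eventually hξs] with z h1 h2 h3 h4 h5 h6 hz
  rw [natDegree_sub_card_roots (hm _) (ξ := fun i => ξ i z.1)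
    (p := (germPoly a (∏ i, g i ^ c i)).map (germEval (z.1 ^ K)) - Polynomial.C z.2)
    (G := (germPoly a (∏ i, g i ^ (c i - 1))).map (germEval (z.1 ^ K)))
    (Q := Q.map (germEval (z.1 ^ K)))]
  · congr 2
    ext i
    simp only [Finset.mem_filter]
    rw [(h2 _ (h6 i)).2, eval_germPoly]
  · rw [Polynomial.derivative_sub, Polynomial.derivative_C, sub_zero, ← map_germEval_dirDeriv,
      dirDeriv_prod_pow a g hc, map_mul, Polynomial.map_mul, h4, h5]
  · exact fun x hx => (h2 x ((h1 x hx).trans_le (min_le_left _ _))).1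
  · intro x hx h0
    have := (h2 x ((h1 x hx).trans_le (min_le_left _ _))).2.1 hx
    rw [eval_germPoly, map_prod] at this h0
    obtain ⟨i, -, hi⟩ := Finset.prod_eq_zero_iff.1 h0
    refine hz ?_
    rw [← this]
    refine Finset.prod_eq_zero (Finset.mem_univ i) ?_
    rw [map_pow] at hi ⊢
    rw [eq_zero_of_pow_eq_zero hi, zero_pow (by have := hc i; omega)]
  · exact fun x hx => hab h3 (hρb (by simpa using (h1 x hx).trans_le (min_le_right _ _)))

end CriticalCount

section BranchCount

open Filter Topology

/-- If, after the substitution `y = t ^ K`, a defect `N y δ` counts the functions `φ i` taking the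
value `δ` at `t`, then the total defect near the origin is given by the orders of the `φ i`. -/
theorem exists_branch_points {N : ℂ → ℂ → ℤ} {K : ℕ} (hK : K ≠ 0) {ι : Type*} [Fintype ι]
    {φ : ι → ℂ → ℂ} (hφ : ∀ i, AnalyticAt ℂ (φ i) 0) (hφ0 : ∀ i, φ i 0 = 0) {n : ι → ℕ}
    (hn : ∀ i, analyticOrderAt (φ i) 0 = n i)
    (hN : ∀ᶠ z : ℂ × ℂ in 𝓝 0, z.2 ≠ 0 →
      N (z.1 ^ K) z.2 = (Finset.univ.filter fun i => φ i z.1 = z.2).card) :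
    ∃ R > 0, ∀ η : ℝ, 0 < η → ∀ᶠ δ in 𝓝 (0 : ℂ), δ ≠ 0 → ∃ br : Finset ℂ,
      (∀ b ∈ br, ‖b‖ < η) ∧ (∀ y, ‖y‖ < R → y ∉ br → N y δ = 0) ∧
      K * ∑ b ∈ br, N b δ = ∑ i, (n i : ℤ) := by
  classical
  have hn0 : ∀ i, n i ≠ 0 := fun i h => by
    have := (hφ i).analyticOrderAt_ne_zero.2 (hφ0 i)
    rw [hn i, h] at this
    exact this rfl
  rw [Prod.zero_eq_mk, nhds_prod_eq] at hN
  obtain ⟨pa, hpa, pb, hpb, hab⟩ := eventually_prod_iff.1 hN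
  obtain ⟨τ₁, hτ₁, hpa'⟩ := Metric.eventually_nhds_iff.1 hpa
  choose τ₀ hτ₀ hcard using fun i => exists_card_solutions (hφ i) (hn0 i) (hn i)
  obtain ⟨τ, hτ, hττ₁, hττ₀⟩ : ∃ τ > 0, τ ≤ τ₁ ∧ ∀ i, τ ≤ τ₀ i := by
    have h : ∀ᶠ τ : ℝ in 𝓝[>] 0, τ ≤ τ₁ ∧ ∀ i, τ ≤ τ₀ i :=
      ((eventually_le_nhds hτ₁).and (eventually_all.2 fun i =>
        eventually_le_nhds (hτ₀ i))).filter_mono nhdsWithin_le_nhds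
    obtain ⟨τ, h1, h2⟩ := (h.and self_mem_nhdsWithin).exists
    exact ⟨τ, h2, h1⟩
  refine ⟨τ ^ K, pow_pos hτ K, fun η hη => ?_⟩
  have hev := eventually_all.2 fun i => hcard i τ hτ (hττ₀ i) (min η 1) (lt_min hη one_pos)
  filter_upwards [hev, hpb] with δ hδ hδb hδ0
  choose s hs hmem hsmall using fun i => hδ i hδ0
  have hroot : ∀ {t t' : ℂ}, t ^ K = t' ^ K → ‖t'‖ < τ → ‖t‖ < τ := fun {t t'} h h' => by
    have := congrArg norm h
    rw [norm_pow, norm_pow] at this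
    rwa [(pow_left_inj₀ (norm_nonneg _) (norm_nonneg _) hK).1 this]
  have hNt : ∀ t, ‖t‖ < τ → N (t ^ K) δ = (Finset.univ.filter fun i => t ∈ s i).card := by
    intro t ht
    rw [hab (hpa' (by simpa using ht.trans_le hττ₁)) hδb hδ0]
    congr 2
    ext i
    simp [hmem, ht]
  set T := Finset.univ.biUnion s with hT
  have hTτ : ∀ t ∈ T, ‖t‖ < τ := fun t ht => by
    obtain ⟨i, -, hi⟩ := Finset.mem_biUnion.1 ht
    exact ((hmem i t).1 hi).1
  refine ⟨T.image fun t => t ^ K, fun b hb => ?_, fun y hy hyb => ?_, ?_⟩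
  · obtain ⟨t, ht, rfl⟩ := Finset.mem_image.1 hb
    obtain ⟨i, -, hi⟩ := Finset.mem_biUnion.1 ht
    have h := hsmall i t hi
    rw [norm_pow]
    exact (pow_le_of_le_one (norm_nonneg _) (h.le.trans (min_le_right _ _)) hK).trans_lt
      (h.trans_le (min_le_left _ _))
  · obtain ⟨t, rfl⟩ := IsAlgClosed.exists_pow_nat_eq y (Nat.pos_of_ne_zero hK)
    rw [norm_pow] at hy
    rw [hNt t (lt_of_pow_lt_pow_left₀ K hτ.le hy), Nat.cast_eq_zero, Finset.card_eq_zero,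
      Finset.filter_eq_empty_iff]
    exact fun i _ hi => hyb (Finset.mem_image_of_mem _ (Finset.mem_biUnion.2
      ⟨i, Finset.mem_univ i, hi⟩))
  · have h1 : ∀ b ∈ T.image fun t => t ^ K, K * N b δ =
        ∑ t ∈ T.filter fun t => t ^ K = b, N (t ^ K) δ := by
      intro b hb
      obtain ⟨t, ht, rfl⟩ := Finset.mem_image.1 hb
      have ht0 : t ≠ 0 := by
        rintro rfl
        obtain ⟨i, -, hi⟩ := Finset.mem_biUnion.1 ht
        exact hδ0 (by rw [← ((hmem i 0).1 hi).2, hφ0])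
      have hset : (T.filter fun t' => t' ^ K = t ^ K) =
          (Polynomial.nthRoots K (t ^ K)).toFinset := by
        ext t'
        rw [Finset.mem_filter, Multiset.mem_toFinset,
          Polynomial.mem_nthRoots (Nat.pos_of_ne_zero hK)]
        refine ⟨fun h => h.2, fun h => ⟨?_, h⟩⟩
        have h2 := hNt t (hTτ t ht)
        have h3 := hNt t' (hroot h (hTτ t ht))
        rw [h, h2, Nat.cast_inj] at h3
        obtain ⟨i, -, hi⟩ := Finset.mem_biUnion.1 ht
        have h4 : 0 < (Finset.univ.filter fun i => t' ∈ s i).card := by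
          rw [← h3]
          exact Finset.card_pos.2 ⟨i, by simpa using hi⟩
        obtain ⟨j, hj⟩ := Finset.card_pos.1 h4
        exact Finset.mem_biUnion.2 ⟨j, Finset.mem_univ j, (Finset.mem_filter.1 hj).2⟩
      rw [Finset.sum_congr rfl fun t' ht' => by rw [(Finset.mem_filter.1 ht').2],
        Finset.sum_const, hset, card_nthRoots_toFinset hK (pow_ne_zero K ht0), nsmul_eq_mul]
    rw [Finset.mul_sum, Finset.sum_congr rfl h1,
      Finset.sum_fiberwise_of_maps_to (fun t ht => Finset.mem_image_of_mem _ ht),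
      Finset.sum_congr rfl fun t ht => hNt t (hTτ t ht)]
    have h2 : ∀ i, s i = T.filter fun t => t ∈ s i := fun i => by
      ext t
      rw [Finset.mem_filter]
      exact ⟨fun h => ⟨Finset.mem_biUnion.2 ⟨i, Finset.mem_univ i, h⟩, h⟩, fun h => h.2⟩
    rw [← Nat.cast_sum, ← Nat.cast_sum, Nat.cast_inj]
    simp only [Finset.card_filter]
    rw [Finset.sum_comm]
    refine Finset.sum_congr rfl fun i _ => ?_
    rw [← Finset.card_filter, ← h2 i, hs i]

end BranchCount

section Fibre

open Filter Topology

/-- The linear change of coordinates `(x₀, x₁) ↦ (x₀, x₁ - a x₀)`. -/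
def slopeHomeomorph (a : ℂ) : ℂ × ℂ ≃ₜ ℂ × ℂ where
  toFun z := (z.1, z.2 - a * z.1)
  invFun z := (z.1, a * z.1 + z.2)
  left_inv z := by simp
  right_inv z := by simp
  continuous_toFun := by fun_prop
  continuous_invFun := by fun_prop

theorem exists_cone_width (a : ℂ) (S : Finset ℂ) : ∃ κ > 0, 48 * ((1 + ‖a‖) * κ) ≤ 1 ∧
    (∀ s ∈ S, s ≠ 0 → 48 * ((1 + ‖a‖) * κ) ≤ ‖s‖) ∧
    (∀ s ∈ S, a * s + 1 ≠ 0 → 48 * ((1 + ‖a‖) * κ) ≤ ‖a * s + 1‖) ∧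
    ∀ s ∈ S, ∀ s' ∈ S, s ≠ s' → 4 * κ < ‖s - s'‖ := by
  have hle : ∀ c : ℝ, 0 < c → ∀ᶠ κ : ℝ in 𝓝[>] 0, 48 * ((1 + ‖a‖) * κ) ≤ c := fun c hc => by
    have h : ContinuousAt (fun κ : ℝ => 48 * ((1 + ‖a‖) * κ)) 0 := by fun_prop
    exact (h.eventually (eventually_le_nhds (by simpa using hc))).filter_mono nhdsWithin_le_nhds
  have hlt : ∀ c : ℝ, 0 < c → ∀ᶠ κ : ℝ in 𝓝[>] 0, 4 * κ < c := fun c hc => by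
    have h : ContinuousAt (fun κ : ℝ => 4 * κ) 0 := by fun_prop
    exact (h.eventually (gt_mem_nhds (by simpa using hc))).filter_mono nhdsWithin_le_nhds
  have h1 := hle 1 one_pos
  have h2 := (eventually_all_finset S).2 fun s _ =>
    eventually_imp_distrib_left.2 fun h : s ≠ 0 => hle _ (norm_pos_iff.2 h)
  have h3 := (eventually_all_finset S).2 fun s _ =>
    eventually_imp_distrib_left.2 fun h : a * s + 1 ≠ 0 => hle _ (norm_pos_iff.2 h)
  have h4 := (eventually_all_finset S).2 fun s _ => (eventually_all_finset S).2 fun s' _ =>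
    eventually_imp_distrib_left.2 fun h : s ≠ s' => hlt _ (norm_pos_iff.2 (sub_ne_zero.2 h))
  obtain ⟨κ, ⟨⟨⟨h1, h2⟩, h3⟩, h4⟩, hκ⟩ := ((((h1.and h2).and h3).and h4).and self_mem_nhdsWithin).exists
  exact ⟨κ, hκ, h1, h2, h3, h4⟩

theorem norm_mul_add_lt {a x y : ℂ} {s : ℝ} (hx : ‖x‖ < s / (2 * (1 + ‖a‖))) (hy : ‖y‖ < s / 2) :
    ‖x‖ < s ∧ ‖a * x + y‖ < s := by
  have ha := norm_nonneg a
  rw [lt_div_iff₀ (by positivity)] at hx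
  have h1 := norm_add_le (a * x) y
  rw [norm_mul] at h1
  have h2 := norm_nonneg x
  have h3 := mul_nonneg h2 ha
  constructor <;> nlinarith

theorem norm_le_mul_of_norm_mul_add_le {a x y : ℂ} {s : ℝ} (hx : ‖x‖ ≤ s) (hy : ‖a * x + y‖ ≤ s) :
    ‖y‖ ≤ (1 + ‖a‖) * s := by
  have h1 : ‖y‖ ≤ ‖a * x + y‖ + ‖a * x‖ := by
    simpa using norm_sub_le (a * x + y) (a * x)
  rw [norm_mul] at h1
  have := mul_le_mul_of_nonneg_left hx (norm_nonneg a)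
  linarith

theorem eventually_forall_norm_lt {p : ℂ × ℂ → Prop} (h : ∀ᶠ z in 𝓝 0, p z) :
    ∃ r > 0, ∀ y δ : ℂ, ‖y‖ < r → ‖δ‖ < r → p (y, δ) := by
  obtain ⟨r, hr, h⟩ := Metric.eventually_nhds_iff.1 h
  exact ⟨r, hr, fun y δ hy hδ => h (by
    rw [dist_zero_right, Prod.norm_def]
    exact max_lt hy hδ)⟩

theorem exists_goodSpace_fibre {f : MvPolynomial (Fin 2) ℂ} {a : ℂ} {d : ℕ}
    (hk : ∀ k < d, homogeneousComponent k f = 0)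
    (ha : eval ![1, a] (homogeneousComponent d f) ≠ 0)
    {A : ℂ × ℂ → Polynomial ℂ} (hm : ∀ z, (A z).Monic) (hd : ∀ z, (A z).natDegree = d)
    (han : ∀ᶠ z in 𝓝 0, AnalyticFamily A z)
    (hsmall : ∀ τ : ℝ, 0 < τ → ∀ᶠ z in 𝓝 0, ∀ x, (A z).eval x = 0 → ‖x‖ < τ) {ρ : ℝ} (hρ : 0 < ρ)
    (hA : ∀ᶠ z in 𝓝 0, ∀ x, ‖x‖ < ρ →
        ((A z).eval x = 0 ↔ eval ![x, a * x + z.1] f = z.2)) {R₁ : ℝ} (hR₁ : 0 < R₁) {T : ℤ}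
    (hbr : ∀ η : ℝ, 0 < η → ∀ᶠ δ in 𝓝 (0 : ℂ), δ ≠ 0 → ∃ br : Finset ℂ,
      (∀ b ∈ br, ‖b‖ < η) ∧
      (∀ y, ‖y‖ < R₁ → y ∉ br → (d : ℤ) - (A (y, δ)).roots.toFinset.card = 0) ∧
      ∑ b ∈ br, ((d : ℤ) - (A (b, δ)).roots.toFinset.card) = T) :
    ∃ ε₀ > (0 : ℝ), ∀ ε : ℝ, 0 < ε → ε ≤ ε₀ →
      ∃ δ₀ > (0 : ℝ), ∀ δ : ℂ, δ ≠ 0 → ‖δ‖ < δ₀ →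
        GoodSpace {z : ℂ × ℂ // z ∈ Metric.closedBall 0 ε ∧ eval ![z.1, z.2] f = δ} (d - T) := by
  obtain ⟨S, hS⟩ := exists_cone hk ha
  obtain ⟨κ, hκ, hκ1, hκ2, hκ3, hκ4⟩ := exists_cone_width a S
  obtain ⟨r, hr, hcone⟩ := hS κ hκ
  have ha1 : 0 < 1 + ‖a‖ := by positivity
  obtain ⟨R₂, hR₂, hE⟩ := eventually_forall_norm_lt ((han.and hA).and
    (hsmall _ (lt_min (show 0 < r / (2 * (1 + ‖a‖)) by positivity) hρ)))
  obtain ⟨R, hR0, hRR₁, hRR₂, hRr⟩ : ∃ R > 0, 2 * R ≤ R₁ ∧ 2 * R ≤ R₂ ∧ 2 * R ≤ r / 2 := by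
    refine ⟨min (min R₁ R₂) (r / 2) / 2, by positivity, ?_, ?_, ?_⟩ <;>
      simp [mul_div_cancel₀]
  obtain ⟨ε₀, hε₀, hε₀ρ, hε₀R⟩ : ∃ ε₀ > 0, ε₀ < ρ ∧ (1 + ‖a‖) * ε₀ < R := by
    have h : ContinuousAt (fun κ : ℝ => (1 + ‖a‖) * κ) 0 := by fun_prop
    have h1 := ((gt_mem_nhds hρ).and (h.eventually_lt_const (by simpa using hR0)))
      |>.filter_mono (nhdsWithin_le_nhds (s := Set.Ioi 0))
    obtain ⟨ε₀, ⟨h1, h2⟩, h3⟩ := (h1.and self_mem_nhdsWithin).exists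
    exact ⟨ε₀, h3, h1, h2⟩
  refine ⟨ε₀, hε₀, fun ε hε hεε₀ => ?_⟩
  obtain ⟨η₂, hη₂, hroots⟩ := eventually_forall_norm_lt
    (hsmall _ (show 0 < ε / (2 * (1 + ‖a‖)) by positivity))
  obtain ⟨η, hη, hηη₂, hηε, hηR⟩ : ∃ η > 0, 2 * η ≤ η₂ ∧ 2 * η ≤ ε / 2 ∧ η ≤ R := by
    refine ⟨min (min η₂ (ε / 2) / 2) R, by positivity, ?_, ?_, min_le_right _ _⟩
    · have := (min_le_left (min η₂ (ε / 2) / 2) R)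
      have := min_le_left η₂ (ε / 2)
      linarith
    · have := (min_le_left (min η₂ (ε / 2) / 2) R)
      have := min_le_right η₂ (ε / 2)
      linarith
  have hpos : 0 < (η / (1 + ‖a‖)) ^ (d + 1) := by positivity
  have hn : ContinuousAt (fun δ : ℂ => ‖δ‖) 0 := by fun_prop
  have hlt : ∀ c : ℝ, 0 < c → ∀ᶠ δ in 𝓝 (0 : ℂ), ‖δ‖ < c := fun c hc =>
    hn.eventually (gt_mem_nhds (by simpa using hc))
  obtain ⟨δ₀, hδ₀, hδ⟩ := Metric.eventually_nhds_iff.1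
    ((((hbr η hη).and (hlt R₂ hR₂)).and (hlt η₂ hη₂)).and (hlt _ hpos))
  refine ⟨δ₀, hδ₀, fun δ hδ0 hδδ₀ => ?_⟩
  obtain ⟨⟨⟨h1, hδR₂⟩, hδη₂⟩, hδpow⟩ := hδ (by simpa using hδδ₀)
  obtain ⟨br, hbrη, hbr0, hbrT⟩ := h1 hδ0
  have hsm : ∀ y : ℂ, ‖y‖ < 2 * η → ∀ x, (A (y, δ)).eval x = 0 → ‖x‖ ≤ ε ∧ ‖a * x + y‖ ≤ ε := by
    intro y hy x hx
    obtain ⟨h1, h2⟩ := norm_mul_add_lt (a := a) (hroots y δ (hy.trans_le hηη₂) hδη₂ x hx)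
      (hy.trans_le hηε)
    exact ⟨h1.le, h2.le⟩
  have hcard : ∀ y : ℂ, ‖y‖ < 2 * R → y ∉ br → (A (y, δ)).roots.toFinset.card = d :=
    fun y hy hyb => by
      have := hbr0 y (hy.trans_le hRR₁) hyb
      omega
  have hconeA : ∀ y : ℂ, η ≤ ‖y‖ → ‖y‖ < 2 * R → ∀ x, (A (y, δ)).eval x = 0 →
      ∃ s ∈ S, ‖x - s * y‖ ≤ κ * ‖y‖ := by
    intro y hyη hy x hx
    obtain ⟨⟨-, hAy⟩, hx'⟩ := hE y δ (hy.trans_le hRR₂) hδR₂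
    have hxs := hx' x hx
    have hf := (hAy x (hxs.trans_le (min_le_right _ _))).1 hx
    obtain ⟨h1, h2⟩ := norm_mul_add_lt (a := a) (hxs.trans_le (min_le_left _ _))
      (hy.trans_le hRr)
    set v : Fin 2 → ℂ := ![x, a * x + y] with hv
    have hvr : ‖v‖ < r := (pi_norm_lt_iff hr).2 fun i => by
      fin_cases i
      · exact h1
      · exact h2
    have hyv : ‖y‖ ≤ (1 + ‖a‖) * ‖v‖ :=
      norm_le_mul_of_norm_mul_add_le (norm_le_pi_norm v 0) (norm_le_pi_norm v 1)
    have hηv : η / (1 + ‖a‖) ≤ ‖v‖ := by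
      rw [div_le_iff₀' ha1]
      exact hyη.trans hyv
    have hv0 : v ≠ 0 := norm_pos_iff.1 ((by positivity : 0 < η / (1 + ‖a‖)).trans_le hηv)
    have := hcone v hv0 hvr (by
      rw [hf]
      exact hδpow.le.trans (pow_le_pow_left₀ (by positivity) hηv _))
    simpa [hv] using this
  have hB : BranchData (fun y => A (y, δ)) d (Metric.ball 0 R) (Metric.ball 0 η) br
      {z | ‖z.1‖ ≤ ε ∧ ‖a * z.1 + z.2‖ ≤ ε} := by
    have hana : ∀ y : ℂ, ‖y‖ < 2 * R → AnalyticFamily (fun y => A (y, δ)) y := fun y hy =>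
      AnalyticFamily.comp (f := fun y => (y, δ)) (hE y δ (hy.trans_le hRR₂) hδR₂).1.1
        (analyticAt_id.prod analyticAt_const)
    refine ⟨fun y => hm _, fun y => hd _, fun y hy => hana y ?_, convex_ball _ _,
      fun b hb => by simpa using hbrη b hb, fun y hy => hcard y ?_, fun y hy x hx => ?_,
      fun b hb y hy _ s hs x hx hroot hx0 => ?_⟩
    · rw [mem_ball_zero_iff] at hy
      linarith
    · rw [mem_ball_zero_iff] at hy
      linarith
    · rw [mem_ball_zero_iff] at hy
      exact hsm y (by linarith) x hx
    · rw [mem_ball_zero_iff] at hb hy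
      exact norm_le_of_move (p := fun y => A (y, δ)) (fun y => hm _) (fun y => hd _) hκ hκ1 hκ2
        hκ3 hκ4 hana (fun y hyη hy => hcard y hy fun hyb => (hbrη y hyb).not_ge hyη) hconeA
        (fun y hy _ => hsm y hy) hb hηR hy hs hx hroot hx0
  have hgood := hB.goodSpace Metric.isOpen_ball (convex_ball _ _)
    ⟨0, Metric.mem_ball_self hη⟩ (Metric.ball_subset_ball hηR)
  rw [hbrT] at hgood
  refine GoodSpace.of_homotopyEquiv (Homeomorph.toHomotopyEquiv
    (Homeomorph.subtype (slopeHomeomorph a) fun z => ?_).symm) hgood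
  rw [mem_closedBall_zero_iff, Prod.norm_def, max_le_iff]
  change _ ↔ ((slopeHomeomorph a z).2 ∈ Metric.ball 0 R ∧
    (A ((slopeHomeomorph a z).2, δ)).eval (slopeHomeomorph a z).1 = 0) ∧
      ‖(slopeHomeomorph a z).1‖ ≤ ε ∧ ‖a * (slopeHomeomorph a z).1 + (slopeHomeomorph a z).2‖ ≤ ε
  have e1 : (slopeHomeomorph a z).1 = z.1 := rfl
  have e2 : (slopeHomeomorph a z).2 = z.2 - a * z.1 := rfl
  have e3 : a * z.1 + (z.2 - a * z.1) = z.2 := by ring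
  rw [e1, e2, e3, mem_ball_zero_iff]
  have hball : ‖z.1‖ ≤ ε → ‖z.2‖ ≤ ε → ‖z.2 - a * z.1‖ < R := fun h1 h2 => by
    have := norm_le_mul_of_norm_mul_add_le (a := a) (y := z.2 - a * z.1) h1 (by rwa [e3])
    have := mul_le_mul_of_nonneg_left hεε₀ ha1.le
    linarith
  have hiff : ‖z.1‖ ≤ ε → ‖z.2‖ ≤ ε →
      ((A (z.2 - a * z.1, δ)).eval z.1 = 0 ↔ eval ![z.1, z.2] f = δ) := fun h1 h2 => by
    have := (hE (z.2 - a * z.1) δ ((hball h1 h2).trans_le (by linarith)) hδR₂).1.2 z.1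
      (h1.trans_lt (by linarith))
    rwa [e3] at this
  constructor
  · rintro ⟨⟨h1, h2⟩, h3⟩
    exact ⟨⟨hball h1 h2, (hiff h1 h2).2 h3⟩, h1, h2⟩
  · rintro ⟨⟨-, h3⟩, h1, h2⟩
    exact ⟨⟨h1, h2⟩, (hiff h1 h2).1 h3⟩

end Fibre

end MilnorFibre

/-- Lemma 4.3 (a result of Melle): for `f₀ = ∏ gᵢ^{cᵢ}` with `gᵢ` pairwise coprime irreducible
germs at the origin of `ℂ²` vanishing at the origin, the Euler characteristic of the Milnor
fibre `f₀⁻¹(δ) ∩ B_ε` (for `0 < |δ| ≪ ε ≪ 1`) equals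
`∑ cᵢ (1 - μᵢ - I_O(gᵢ, ∏_{j ≠ i} gⱼ))`. -/
theorem euler_milnor_fibre (m : ℕ) (g : Fin (m + 1) → MvPolynomial (Fin 2) ℂ)
    (c : Fin (m + 1) → ℕ) (hc : ∀ i, 1 ≤ c i)
    (hval : ∀ i, MvPolynomial.eval (0 : Fin 2 → ℂ) (g i) = 0)
    (hirr : ∀ i, Irreducible ((↑(g i) : MvPowerSeries (Fin 2) ℂ)))
    (hcop : ∀ i j, i ≠ j →
      ¬ Associated ((↑(g i) : MvPowerSeries (Fin 2) ℂ)) (↑(g j) : MvPowerSeries (Fin 2) ℂ)) :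
    ∃ ε₀ > (0 : ℝ), ∀ ε : ℝ, 0 < ε → ε ≤ ε₀ →
      ∃ δ₀ > (0 : ℝ), ∀ δ : ℂ, δ ≠ 0 → ‖δ‖ < δ₀ →
        eulerChar {z : ℂ × ℂ // z ∈ Metric.closedBall 0 ε ∧
            MvPolynomial.eval ![z.1, z.2] (∏ i, g i ^ c i) = δ} =
          ∑ i, (c i : ℤ) *
            (1 - (milnorNumber (g i) : ℤ) -
              (interMult (g i) (∏ j ∈ ({i}ᶜ : Finset (Fin (m + 1))), g j) : ℤ)) := by
  classical
  set f := ∏ i, g i ^ c i with hf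
  have hg0 : ∀ i, g i ≠ 0 := fun i h => (hirr i).ne_zero (by simp [h])
  have hf0 : f ≠ 0 := Finset.prod_ne_zero_iff.2 fun i _ => pow_ne_zero _ (hg0 i)
  obtain ⟨d, hd, hk⟩ := MilnorFibre.exists_lowest_homogeneousComponent hf0
  obtain ⟨a, ha⟩ := MilnorFibre.exists_slope hd
  have hfnz := MilnorFibre.map_germEval_zero_ne_zero ha
  have hfd := MilnorFibre.lineMult_eq hk ha
  have hnz : ∀ i, (MilnorFibre.germPoly a (g i)).map (MilnorFibre.germEval 0) ≠ 0 := by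
    intro i h
    refine hfnz ?_
    rw [hf, map_prod, Polynomial.map_prod]
    refine Finset.prod_eq_zero (Finset.mem_univ i) ?_
    rw [map_pow, Polynomial.map_pow, h, zero_pow (by have := hc i; omega)]
  obtain ⟨P, Q, hW, K, hK, ι, _, ξ, hξ, hξ0, hP, n, hn, hsum⟩ :=
    MilnorFibre.exists_polar_roots hc hval hirr hcop hnz
  obtain ⟨A, hm, hAd, han, hsmall, ρ, hρ, hA⟩ := MilnorFibre.exists_fibre_family hfnz hfd
  have hN := MilnorFibre.eventually_natDegree_sub_card_roots hc hm hsmall hρ hA hW hK hξ hξ0 hP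
  have hφ : ∀ i, AnalyticAt ℂ (fun t => eval ![ξ i t, a * ξ i t + t ^ K] f) 0 := by
    intro i
    have hpair : AnalyticAt ℂ (fun t => ![ξ i t, a * ξ i t + t ^ K]) 0 := by
      refine AnalyticAt.pi fun j => ?_
      fin_cases j
      · exact hξ i
      · exact (analyticAt_const.fun_mul (hξ i)).fun_add (analyticAt_id.fun_pow K)
    exact AnalyticAt.fun_comp (g := fun v : Fin 2 → ℂ => eval v f)
      (f := fun t => ![ξ i t, a * ξ i t + t ^ K])
      (AnalyticOnNhd.eval_mvPolynomial f _ (Set.mem_univ _)) hpair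
  obtain ⟨R, hR, hbr⟩ := MilnorFibre.exists_branch_points
    (N := fun y δ => ((A (y, δ)).natDegree : ℤ) - (A (y, δ)).roots.toFinset.card) hK hφ
    (fun i => by
      have h0 : ![ξ i 0, a * ξ i 0 + 0 ^ K] = 0 := by
        ext j
        fin_cases j <;> simp [hξ0 i, hK]
      simp only [h0]
      rw [hf, map_prod]
      exact Finset.prod_eq_zero (Finset.mem_univ 0)
        (by rw [map_pow, hval, zero_pow (by have := hc 0; omega)])) hn hN
  obtain ⟨ε₀, hε₀, h⟩ := MilnorFibre.exists_goodSpace_fibre (T := ∑ i, (c i : ℤ) *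
      ((milnorNumber (g i) : ℤ) + MilnorFibre.lineMult a (g i) +
        interMult (g i) (∏ j ∈ ({i}ᶜ : Finset (Fin (m + 1))), g j) - 1))
    hk ha hm hAd han hsmall hρ
    (by
      filter_upwards [hA] with z hz x hx
      rw [(hz x hx).2, MilnorFibre.eval_germPoly]) hR
    (by
      intro η hη
      filter_upwards [hbr η hη] with δ hδ hδ0
      obtain ⟨br, h1, h2, h3⟩ := hδ hδ0
      simp only [hAd] at h2 h3
      refine ⟨br, h1, h2, ?_⟩
      rw [Nat.cast_sum] at hsum
      exact mul_left_cancel₀ (Nat.cast_ne_zero.2 hK) (h3.trans hsum))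
  refine ⟨ε₀, hε₀, fun ε hε hεε₀ => ?_⟩
  obtain ⟨δ₀, hδ₀, h⟩ := h ε hε hεε₀
  refine ⟨δ₀, hδ₀, fun δ hδ hδδ₀ => ?_⟩
  rw [(h δ hδ hδδ₀).eulerChar_eq, ← hfd, (MilnorFibre.lineMult_prod_pow hnz c).2, Nat.cast_sum,
    ← Finset.sum_sub_distrib]
  refine Finset.sum_congr rfl fun i _ => ?_
  push_cast
  ring
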